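/- There are exactly three inequivalent binary self-dual [44,22,8] codes having an automorphism of type 7-(3,23), i.e., an automorphism of order 7 whose cycle decomposition consists of 3 independent 7-cycles and 23 fixed points. -/

import Mathlib

namespace SD

variable {ι : Type*}

/-- The (Hamming) weight of a binary vector. -/
def wt [Fintype ι] (v : ι → ZMod 2) : ℕ := (Finset.univ.filter fun i => v i ≠ 0).card

/-- A binary code (subspace of `F_2^ι`) is self-dual if it coincides with its dual
under the standard inner product. -/
def isSelfDual [Fintype ι] (Code : Submodule (ZMod 2) (ι → ZMod 2)) : Prop :=
  ∀ u : ι → ZMod 2, u ∈ Code ↔ ∀ v ∈ Code, ∑ i, u i * v i = 0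

/-- The linear map permuting coordinates of vectors by `σ`. -/
def permLM (σ : Equiv.Perm ι) : (ι → ZMod 2) →ₗ[ZMod 2] (ι → ZMod 2) where
  toFun v := v ∘ σ
  map_add' _ _ := rfl
  map_smul' _ _ := rfl

/-- The image of a code under a coordinate permutation. -/
def permCode (σ : Equiv.Perm ι) (Code : Submodule (ZMod 2) (ι → ZMod 2)) :
    Submodule (ZMod 2) (ι → ZMod 2) := Submodule.map (permLM σ) Code

/-- Two binary codes are equivalent if a coordinate permutation maps one onto the other. -/
def codeEquiv (C D : Submodule (ZMod 2) (ι → ZMod 2)) : Prop :=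
  ∃ σ : Equiv.Perm ι, permCode σ C = D

/-- The code has minimum weight (exactly) `d`. -/
def minWtEq [Fintype ι] (Code : Submodule (ZMod 2) (ι → ZMod 2)) (d : ℕ) : Prop :=
  (∀ v ∈ Code, v ≠ 0 → d ≤ wt v) ∧ ∃ v ∈ Code, v ≠ 0 ∧ wt v = d

/-- An automorphism of type `p-(c,f)` of a code of length `n`: order `p`, exactly `f`
fixed points (hence exactly `c` independent `p`-cycles, as `n = p*c + f`). -/
def autOfType {n : ℕ} (σ : Equiv.Perm (Fin n)) (p c f : ℕ) : Prop :=
  orderOf σ = p ∧ (Finset.univ.filter fun i => σ i = i).card = f ∧ n = p * c + f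

open scoped Matrix

section Duality

variable {α β γ : Type*}

/-- Transport of a code along a bijection of the coordinate sets. -/
def pull (e : α ≃ β) (W : Submodule (ZMod 2) (β → ZMod 2)) : Submodule (ZMod 2) (α → ZMod 2) :=
  W.comap (LinearMap.funLeft (ZMod 2) (ZMod 2) e.symm)

theorem mem_pull {e : α ≃ β} {W : Submodule (ZMod 2) (β → ZMod 2)} {v : α → ZMod 2} :
    v ∈ pull e W ↔ v ∘ e.symm ∈ W := Iff.rfl

theorem comp_mem_pull {e : α ≃ β} {W : Submodule (ZMod 2) (β → ZMod 2)} {v : β → ZMod 2} :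
    v ∘ e ∈ pull e W ↔ v ∈ W := by
  rw [mem_pull, Function.comp_assoc, e.self_comp_symm, Function.comp_id]

theorem pull_eq_map (e : α ≃ β) (W : Submodule (ZMod 2) (β → ZMod 2)) :
    pull e W = W.map (LinearEquiv.funCongrLeft (ZMod 2) (ZMod 2) e).toLinearMap := by
  ext v
  rw [Submodule.mem_map, mem_pull]
  constructor
  · intro h
    exact ⟨_, h, by ext i; simp [LinearEquiv.funCongrLeft, LinearMap.funLeft]⟩
  · rintro ⟨w, hw, rfl⟩
    convert hw
    ext i; simp [LinearEquiv.funCongrLeft, LinearMap.funLeft]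

theorem finrank_pull (e : α ≃ β) (W : Submodule (ZMod 2) (β → ZMod 2)) :
    Module.finrank (ZMod 2) (pull e W) = Module.finrank (ZMod 2) W := by
  rw [pull_eq_map, LinearEquiv.finrank_map_eq]

theorem permCode_eq_pull (σ : Equiv.Perm α) (W : Submodule (ZMod 2) (α → ZMod 2)) :
    permCode σ W = pull σ W := by
  rw [pull_eq_map]; rfl

variable [Fintype α] [Fintype β]

/-- The dual code. -/
def dual (W : Submodule (ZMod 2) (α → ZMod 2)) : Submodule (ZMod 2) (α → ZMod 2) where
  carrier := {y | ∀ p ∈ W, y ⬝ᵥ p = 0}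
  zero_mem' _ _ := zero_dotProduct _
  add_mem' ha hb p hp := by rw [add_dotProduct, ha p hp, hb p hp, add_zero]
  smul_mem' c x hx p hp := by rw [smul_dotProduct, hx p hp, smul_zero]

theorem mem_dual {W : Submodule (ZMod 2) (α → ZMod 2)} {y : α → ZMod 2} :
    y ∈ dual W ↔ ∀ p ∈ W, y ⬝ᵥ p = 0 := Iff.rfl

theorem finrank_add_finrank_dual (W : Submodule (ZMod 2) (α → ZMod 2)) :
    Module.finrank (ZMod 2) W + Module.finrank (ZMod 2) (dual W) = Fintype.card α := by
  classical
  have h := Subspace.finrank_add_finrank_dualAnnihilator_eq W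
  rw [Module.finrank_fintype_fun_eq_card] at h
  have : (dual W).map (dotProductEquiv (ZMod 2) α).toLinearMap = W.dualAnnihilator := by
    ext f
    rw [Submodule.mem_map, Submodule.mem_dualAnnihilator]
    constructor
    · rintro ⟨y, hy, rfl⟩ w hw
      exact hy w hw
    · intro hf
      obtain ⟨y, rfl⟩ := (dotProductEquiv (ZMod 2) α).surjective f
      exact ⟨y, fun p hp => hf p hp, rfl⟩
  rw [← h, ← LinearEquiv.finrank_map_eq (dotProductEquiv (ZMod 2) α) (dual W), this]

/-- A vector orthogonal to everything orthogonal to `W` lies in `W`. -/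
theorem mem_of_forall_dual {W : Submodule (ZMod 2) (α → ZMod 2)} {x : α → ZMod 2}
    (h : ∀ y, (∀ p ∈ W, y ⬝ᵥ p = 0) → y ⬝ᵥ x = 0) : x ∈ W := by
  classical
  by_contra hx
  obtain ⟨f, hf, hW⟩ := Submodule.exists_le_ker_of_notMem hx
  obtain ⟨y, rfl⟩ := (dotProductEquiv (ZMod 2) α).surjective f
  exact hf (h y fun p hp => LinearMap.mem_ker.mp (hW hp))

theorem isSelfDual_iff_dual {W : Submodule (ZMod 2) (α → ZMod 2)} :
    isSelfDual W ↔ dual W = W := by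
  rw [SetLike.ext_iff]
  exact ⟨fun h u => (h u).symm, fun h u => (h u).symm⟩

theorem wt_comp (e : α ≃ β) (v : β → ZMod 2) : wt (v ∘ e) = wt v := by
  classical
  unfold wt
  refine Finset.card_bij (fun i _ => e i) (by simp) (by simp) fun b hb => ⟨e.symm b, ?_, by simp⟩
  simpa using hb

theorem dot_comp (e : α ≃ β) (v w : β → ZMod 2) : (v ∘ e) ⬝ᵥ (w ∘ e) = v ⬝ᵥ w :=
  comp_equiv_dotProduct_comp_equiv v w e

theorem dual_pull (e : α ≃ β) (W : Submodule (ZMod 2) (β → ZMod 2)) :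
    dual (pull e W) = pull e (dual W) := by
  ext v
  rw [mem_pull, mem_dual, mem_dual]
  constructor
  · intro h p hp
    rw [← dot_comp e, Function.comp_assoc, e.symm_comp_self, Function.comp_id]
    exact h _ (comp_mem_pull.mpr hp)
  · intro h p hp
    rw [← dot_comp e.symm]
    exact h _ hp

end Duality

section Weight

variable {α β : Type*} [Fintype α] [Fintype β]

theorem zmod_two_ne_zero {a : ZMod 2} : a ≠ 0 ↔ a = 1 := by revert a; decide

theorem wt_eq_zero {v : α → ZMod 2} : wt v = 0 ↔ v = 0 := by
  simp [wt, Finset.filter_eq_empty_iff, funext_iff]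

theorem wt_add (v w : α → ZMod 2) : wt (v + w) +
    2 * (Finset.univ.filter fun i => v i ≠ 0 ∧ w i ≠ 0).card = wt v + wt w := by
  simp only [wt, Finset.card_filter, Finset.mul_sum, ← Finset.sum_add_distrib, Pi.add_apply]
  refine Finset.sum_congr rfl fun i _ => ?_
  generalize v i = a
  generalize w i = b
  revert a b
  decide

theorem dot_eq_card (v w : α → ZMod 2) :
    v ⬝ᵥ w = ((Finset.univ.filter fun i => v i ≠ 0 ∧ w i ≠ 0).card : ZMod 2) := by
  simp only [dotProduct, Finset.card_filter, Nat.cast_sum]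
  refine Finset.sum_congr rfl fun i _ => ?_
  generalize v i = a
  generalize w i = b
  revert a b
  decide

theorem wt_elim (v : α → ZMod 2) (w : β → ZMod 2) : wt (Sum.elim v w) = wt v + wt w := by
  simp only [wt, Finset.card_filter, Fintype.sum_sum_type, Sum.elim_inl, Sum.elim_inr]
  congr

theorem dot_elim (v v' : α → ZMod 2) (w w' : β → ZMod 2) :
    Sum.elim v w ⬝ᵥ Sum.elim v' w' = v ⬝ᵥ v' + w ⬝ᵥ w' := by
  simp only [dotProduct, Fintype.sum_sum_type, Sum.elim_inl, Sum.elim_inr]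

end Weight

section Mask

/-- The vector of the first `n` binary digits of `m`. -/
def vec (n m : ℕ) : Fin n → ZMod 2 := fun i => if m.testBit i then 1 else 0

theorem vec_ne_zero {n m : ℕ} {i : Fin n} : vec n m i ≠ 0 ↔ m.testBit i = true := by
  simp [vec]

theorem vec_xor (n a b : ℕ) : vec n (a ^^^ b) = vec n a + vec n b := by
  funext i
  simp only [vec, Nat.testBit_xor, Pi.add_apply]
  cases a.testBit i <;> cases b.testBit i <;> decide

theorem vec_zero (n : ℕ) : vec n 0 = 0 := by
  funext i; simp [vec]

theorem exists_vec {n : ℕ} (v : Fin n → ZMod 2) : ∃ m < 2 ^ n, vec n m = v := by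
  refine ⟨Nat.ofBits fun i => decide (v i ≠ 0), Nat.ofBits_lt_two_pow _, ?_⟩
  funext i
  simp only [vec, Nat.testBit_ofBits_lt _ i.1 i.2, Fin.eta, decide_eq_true_eq]
  generalize v i = a
  revert a
  decide

theorem vec_inj {n a b : ℕ} (ha : a < 2 ^ n) (hb : b < 2 ^ n) (h : vec n a = vec n b) : a = b := by
  refine Nat.eq_of_testBit_eq fun i => ?_
  by_cases hi : i < n
  · have := congrFun h ⟨i, hi⟩
    simp only [vec] at this
    revert this
    cases a.testBit i <;> cases b.testBit i <;> decide
  · rw [Nat.testBit_lt_two_pow (ha.trans_le (Nat.pow_le_pow_right two_pos (not_lt.mp hi))),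
      Nat.testBit_lt_two_pow (hb.trans_le (Nat.pow_le_pow_right two_pos (not_lt.mp hi)))]

/-- Table of the digit sums of the bytes, four bits per entry. -/
def popTable : ℕ :=
  95125173855764218123276304889944061997689682402263585766959741291920687686033329201817409157123347502415384089435969498586180241031507595463600295898153685276653211633572815512294064538494957912327413386667662218713394765509704508661031522276467630197481635010039778342554499416459730172574551513689147646224

/-- Digit sum of a byte. -/
def pop8 (b : ℕ) : ℕ := Nat.land (Nat.shiftRight popTable (Nat.mul 4 b)) 15

/-- Digit sum of a number below `2 ^ 24`. -/
def pop (m : ℕ) : ℕ :=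
  Nat.add (pop8 (Nat.land m 255)) (Nat.add (pop8 (Nat.land (Nat.shiftRight m 8) 255))
    (pop8 (Nat.shiftRight m 16)))

theorem pop8_eq : ∀ b < 256, pop8 b = ∑ i ∈ Finset.range 8, (b.testBit i).toNat := by
  decide +kernel

theorem pop_eq {m : ℕ} (hm : m < 2 ^ 24) :
    pop m = ∑ i ∈ Finset.range 24, (m.testBit i).toNat := by
  have key : ∀ x, (∑ i ∈ Finset.range 8, ((x &&& 255).testBit i).toNat) =
      ∑ i ∈ Finset.range 8, (x.testBit i).toNat := fun x => by
    refine Finset.sum_congr rfl fun i hi => ?_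
    rw [show 255 = 2 ^ 8 - 1 by norm_num, Nat.testBit_and, Nat.testBit_two_pow_sub_one]
    simp [Finset.mem_range.mp hi]
  have h255 : ∀ x, x &&& 255 < 256 := fun x => Nat.and_lt_two_pow x (n := 8) (by norm_num)
  change pop8 (m &&& 255) + (pop8 ((m >>> 8) &&& 255) + pop8 (m >>> 16)) = _
  rw [pop8_eq _ (h255 _), pop8_eq _ (h255 _), pop8_eq, key, key,
    show 24 = 8 + (8 + 8) from rfl, Finset.sum_range_add, Finset.sum_range_add]
  · simp only [Nat.testBit_shiftRight, ← add_assoc]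
  · rw [Nat.shiftRight_eq_div_pow]; omega

theorem wt_vec_eq_sum (n m : ℕ) : wt (vec n m) = ∑ i ∈ Finset.range n, (m.testBit i).toNat := by
  rw [wt, Finset.card_filter, ← Fin.sum_univ_eq_sum_range fun i => (m.testBit i).toNat]
  refine Finset.sum_congr rfl fun i _ => ?_
  simp only [vec_ne_zero]
  cases m.testBit i <;> rfl

theorem wt_vec {n m : ℕ} (hn : n ≤ 24) (hm : m < 2 ^ n) : wt (vec n m) = pop m := by
  rw [wt_vec_eq_sum, pop_eq (hm.trans_le (Nat.pow_le_pow_right two_pos hn))]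
  refine Finset.sum_subset (Finset.range_mono hn) fun i _ hi => ?_
  rw [Finset.mem_range, not_lt] at hi
  rw [Nat.testBit_lt_two_pow (hm.trans_le (Nat.pow_le_pow_right two_pos hi))]; rfl

theorem dot_vec {n a b : ℕ} (hn : n ≤ 24) (ha : a < 2 ^ n) :
    vec n a ⬝ᵥ vec n b = (pop (a &&& b) : ZMod 2) := by
  rw [← wt_vec hn (Nat.and_le_left.trans_lt ha), dot_eq_card, wt]
  congr 2
  ext i
  simp only [vec_ne_zero, Nat.testBit_and, Finset.mem_filter, Finset.mem_univ, true_and,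
    Bool.and_eq_true]

end Mask

section Dodecad

variable {α : Type*}

theorem add_self_eq_zero (v : α → ZMod 2) : v + v = 0 := by
  funext i
  exact CharTwo.add_self_eq_zero (v i)

variable [Fintype α]

theorem finrank_le_succ {W W' : Submodule (ZMod 2) (α → ZMod 2)} (z : α → ZMod 2)
    (h : ∀ w ∈ W, w ∈ W' ∨ w + z ∈ W') :
    Module.finrank (ZMod 2) W ≤ Module.finrank (ZMod 2) W' + 1 := by
  have hle : W ≤ W' ⊔ Submodule.span (ZMod 2) {z} := fun w hw => by
    rcases h w hw with h | h
    · exact Submodule.mem_sup_left h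
    · rw [show w = (w + z) + z by rw [add_assoc, add_self_eq_zero, add_zero]]
      exact add_mem (Submodule.mem_sup_left h)
        (Submodule.mem_sup_right (Submodule.mem_span_singleton_self z))
  calc _ ≤ _ := Submodule.finrank_mono hle
    _ ≤ _ := Submodule.finrank_add_le_finrank_add_finrank _ _
    _ ≤ _ := Nat.add_le_add_left ((finrank_span_le_card {z}).trans (by simp)) _

theorem exists_infoSet (m : ℕ) : ∀ W : Submodule (ZMod 2) (α → ZMod 2),
    m ≤ Module.finrank (ZMod 2) W → ∃ (p : Fin m → α) (g : Fin m → α → ZMod 2),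
      (∀ i, g i ∈ W) ∧ ∀ i j, g i (p j) = if i = j then 1 else 0 := by
  induction m with
  | zero => exact fun W _ => ⟨Fin.elim0, Fin.elim0, fun i => i.elim0, fun i => i.elim0⟩
  | succ m ih =>
    intro W hW
    have hne : W ≠ ⊥ := by
      rintro rfl
      rw [finrank_bot] at hW
      omega
    obtain ⟨v, hv, hv0⟩ := Submodule.exists_mem_ne_zero_of_ne_bot hne
    obtain ⟨i, hi⟩ := Function.ne_iff.mp hv0
    replace hi : v i = 1 := zmod_two_ne_zero.mp hi
    obtain ⟨p, g, hg, hpg⟩ := ih (W ⊓ (LinearMap.proj i : (α → ZMod 2) →ₗ[ZMod 2] ZMod 2).ker) (by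
      have := finrank_le_succ (W := W)
        (W' := W ⊓ (LinearMap.proj i : (α → ZMod 2) →ₗ[ZMod 2] ZMod 2).ker) v fun w hw => by
          rcases eq_or_ne (w i) 0 with h | h
          · exact Or.inl ⟨hw, h⟩
          · refine Or.inr ⟨add_mem hw hv, ?_⟩
            change w i + v i = 0
            rw [hi, zmod_two_ne_zero.mp h]; decide
      omega)
    refine ⟨Fin.cons i p, Fin.cons (v + ∑ j, v (p j) • g j) g, ?_, ?_⟩
    · refine Fin.cases ?_ fun j => ?_
      · exact add_mem hv (Submodule.sum_mem _ fun j _ => Submodule.smul_mem _ _ (hg j).1)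
      · exact (hg j).1
    · have hgi : ∀ j, g j i = 0 := fun j => (hg j).2
      refine Fin.cases (Fin.cases ?_ fun j => ?_) fun k => Fin.cases ?_ fun j => ?_
      · simp [hgi, hi]
      · simp only [Fin.cons_zero, Fin.cons_succ, Pi.add_apply, Finset.sum_apply, Pi.smul_apply,
          hpg, smul_eq_mul, mul_ite, mul_one, mul_zero, Finset.sum_ite_eq', Finset.mem_univ,
          if_true, CharTwo.add_self_eq_zero, (Fin.succ_ne_zero j).symm, if_false]
      · simp [hgi, Fin.succ_ne_zero]
      · simp [hpg]

/-- Nine blocks of size 8 on 23 points, meeting by twos in 4 and by threes in 2 points, cannot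
each have a private point. -/
theorem no_regular_system (x : Fin 9 → Fin 23 → ℤ) (h01 : ∀ i c, x i c = 0 ∨ x i c = 1)
    (p : Fin 9 → Fin 23) (hp : Function.Injective p)
    (hpx : ∀ m i, x i (p m) = if i = m then 1 else 0)
    (o : ∀ i j k, ∑ c, x i c * x j c * x k c =
      if i = j then (if j = k then 8 else 4) else if i = k ∨ j = k then 4 else 2) : False := by
  have hx2 : ∀ i c, x i c * x i c = x i c := fun i c => by
    rcases h01 i c with h | h <;> rw [h] <;> norm_num
  have o1 : ∀ i, ∑ c, x i c = 8 := fun i => by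
    have := o i i i
    simpa only [hx2, if_true] using this
  let d : Fin 23 → ℤ := fun c => ∑ i, x i c
  have hd1 : ∑ c, d c = 72 := by
    simp only [d]
    rw [Finset.sum_comm, Finset.sum_congr rfl fun i _ => o1 i]; rfl
  have hd3 : ∑ c, d c * d c * d c = 1944 := by
    have : ∀ c, d c * d c * d c = ∑ i, ∑ j, ∑ k, x i c * x j c * x k c := fun c => by
      simp only [d]
      rw [Finset.sum_mul_sum, Finset.sum_mul]
      refine Finset.sum_congr rfl fun i _ => ?_
      rw [Finset.sum_mul]
      exact Finset.sum_congr rfl fun j _ => Finset.mul_sum _ _ _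
    rw [Finset.sum_congr rfl fun c _ => this c, Finset.sum_comm]
    rw [Finset.sum_congr rfl fun i _ => Finset.sum_comm, Finset.sum_congr rfl fun i _ =>
      Finset.sum_congr rfl fun j _ => Finset.sum_comm, Finset.sum_congr rfl fun i _ =>
      Finset.sum_congr rfl fun j _ => Finset.sum_congr rfl fun k _ => o i j k]
    decide +kernel
  have hd2 : ∑ c, d c * d c = 360 := by
    have : ∀ c, d c * d c = ∑ i, ∑ j, x i c * x j c * x j c := fun c => by
      simp only [d, Finset.sum_mul_sum, mul_assoc, hx2]
    rw [Finset.sum_congr rfl fun c _ => this c, Finset.sum_comm]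
    rw [Finset.sum_congr rfl fun i _ => Finset.sum_comm, Finset.sum_congr rfl fun i _ =>
      Finset.sum_congr rfl fun j _ => o i j j]
    decide +kernel
  have hsum : ∑ c, d c * (d c - 5) * (d c - 6) = 144 := by
    have : ∀ c, d c * (d c - 5) * (d c - 6) = d c * d c * d c - 11 * (d c * d c) + 30 * d c :=
      fun c => by ring
    rw [Finset.sum_congr rfl fun c _ => this c, Finset.sum_add_distrib, Finset.sum_sub_distrib,
      ← Finset.mul_sum, ← Finset.mul_sum, hd1, hd2, hd3]
    norm_num
  have hnn : ∀ c, 0 ≤ d c * (d c - 5) * (d c - 6) := fun c => by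
    have h0 : 0 ≤ d c := Finset.sum_nonneg fun i _ => by 
      rcases h01 i c with h | h <;> simp [h]
    rw [mul_assoc]
    refine mul_nonneg h0 ?_
    rcases le_or_gt (d c) 5 with h | h
    · exact mul_nonneg_of_nonpos_of_nonpos (by linarith) (by linarith)
    · exact mul_nonneg (by linarith) (by linarith)
  have hdp : ∀ m, d (p m) = 1 := fun m => by
    simp [d, hpx]
  have hle : ∑ c ∈ Finset.univ.map ⟨p, hp⟩, d c * (d c - 5) * (d c - 6) ≤
      ∑ c, d c * (d c - 5) * (d c - 6) :=
    Finset.sum_le_sum_of_subset_of_nonneg (Finset.subset_univ _) fun c _ _ => hnn c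
  rw [hsum, Finset.sum_map] at hle
  simp [hdp] at hle

theorem wt_cast (v : α → ZMod 2) : (wt v : ℤ) = ∑ c, if v c ≠ 0 then 1 else 0 := by
  rw [wt, Finset.card_filter, Nat.cast_sum]
  exact Finset.sum_congr rfl fun c _ => by split_ifs; all_goals rfl

theorem sum_add_support (v w : α → ZMod 2) : (∑ c, if (v + w) c ≠ 0 then 1 else 0 : ℤ) +
    2 * (∑ c, (if v c ≠ 0 then 1 else 0) * (if w c ≠ 0 then 1 else 0)) =
    (∑ c, if v c ≠ 0 then 1 else 0) + ∑ c, if w c ≠ 0 then 1 else 0 := by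
  rw [Finset.mul_sum, ← Finset.sum_add_distrib, ← Finset.sum_add_distrib]
  refine Finset.sum_congr rfl fun c _ => ?_
  rw [Pi.add_apply]
  generalize v c = a
  generalize w c = b
  revert a b
  decide

theorem exists_dodecad {F : Submodule (ZMod 2) (Fin 23 → ZMod 2)}
    (horth : ∀ v ∈ F, ∀ w ∈ F, v ⬝ᵥ w = 0) (hmin : ∀ v ∈ F, v ≠ 0 → 8 ≤ wt v)
    (hrank : 10 ≤ Module.finrank (ZMod 2) F) : ∃ u ∈ F, wt u = 12 := by
  by_contra! hno
  have hov : ∀ v ∈ F, ∀ w ∈ F,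
      2 ∣ (Finset.univ.filter fun i => v i ≠ 0 ∧ w i ≠ 0).card := fun v hv w hw => by
    rw [← ZMod.natCast_eq_zero_iff, ← dot_eq_card]
    exact horth v hv w hw
  let E : Submodule (ZMod 2) (Fin 23 → ZMod 2) :=
    { carrier := {v | v ∈ F ∧ 4 ∣ wt v}
      zero_mem' := ⟨zero_mem F, by rw [wt_eq_zero.mpr rfl]; exact dvd_zero 4⟩
      add_mem' := fun {v w} hv hw => ⟨add_mem hv.1 hw.1, by
        have h1 := wt_add v w
        have h2 := hov v hv.1 w hw.1
        have h3 := hv.2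
        have h4 := hw.2
        omega⟩
      smul_mem' := fun c v hv => by
        rcases eq_or_ne c 0 with rfl | h
        · rw [zero_smul]; exact ⟨zero_mem F, by rw [wt_eq_zero.mpr rfl]; exact dvd_zero 4⟩
        · rw [zmod_two_ne_zero.mp h, one_smul]; exact hv }
  have hE : 9 ≤ Module.finrank (ZMod 2) E := by
    by_cases h : ∀ z ∈ F, 4 ∣ wt z
    · have : F ≤ E := fun z hz => ⟨hz, h z hz⟩
      have := Submodule.finrank_mono this
      omega
    · push Not at h
      obtain ⟨z, hz, hz4⟩ := h
      have := finrank_le_succ (W := F) (W' := E) z fun w hw => by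
        by_cases h4 : 4 ∣ wt w
        · exact Or.inl ⟨hw, h4⟩
        · refine Or.inr ⟨add_mem hw hz, ?_⟩
          have h1 := wt_add w z
          have h2 := hov w hw z hz
          have h3 : ∀ v ∈ F, 2 ∣ wt v := fun v hv => by
            have := hov v hv v hv
            simpa [wt] using this
          have h5 := h3 w hw
          have h6 := h3 z hz
          omega
      omega
  obtain ⟨p, g, hg, hpg⟩ := exists_infoSet 9 E hE
  have hp : Function.Injective p := fun i j hij => by
    by_contra h
    have h1 := hpg i j
    rw [← hij, hpg i i] at h1
    simp [h] at h1
  have hcard : ∀ (S : Finset (Fin 9)) (A : Finset (Fin 23)), (∀ m ∉ S, p m ∉ A) →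
      A.card ≤ 14 + S.card := fun S A h => by
    have h1 : Disjoint A (Sᶜ.map ⟨p, hp⟩) := by
      rw [Finset.disjoint_right]
      intro x hx
      obtain ⟨m, hm, rfl⟩ := Finset.mem_map.mp hx
      exact h m (Finset.mem_compl.mp hm)
    have h2 := Finset.card_le_univ (A ∪ Sᶜ.map ⟨p, hp⟩)
    rw [Finset.card_union_of_disjoint h1, Finset.card_map, Finset.card_compl, Fintype.card_fin,
      Fintype.card_fin] at h2
    omega
  have hwt : ∀ (S : Finset (Fin 9)) (v), v ∈ E → v ≠ 0 → (∀ m ∉ S, v (p m) = 0) →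
      S.card ≤ 3 → wt v = 8 ∨ wt v = 16 ∧ 1 < S.card := fun S v hv hv0 hS hS3 => by
    have h1 : wt v ≤ 14 + S.card := hcard S _ fun m hm => by simp [hS m hm]
    have h2 := hmin v hv.1 hv0
    have h3 := hno v hv.1
    have h4 : 4 ∣ wt v := hv.2
    omega
  have hg0 : ∀ i, g i ≠ 0 := fun i h => by
    have := hpg i i
    simp [h] at this
  have hg8 : ∀ i, wt (g i) = 8 := fun i => by
    rcases hwt {i} (g i) (hg i) (hg0 i) (fun m hm => by
      rw [hpg, if_neg]
      rintro rfl
      exact hm (Finset.mem_singleton_self _)) (by simp) with h | ⟨_, h⟩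
    · exact h
    · simp at h
  have hw8 : ∀ (S : Finset (Fin 9)) (v), v ∈ E → v ≠ 0 → (∀ m ∉ S, v (p m) = 0) →
      S.card ≤ 3 → wt v = 8 := fun S v hv hv0 hS hS3 => by
    rcases hwt S v hv hv0 hS hS3 with h | ⟨h16, _⟩
    · exact h
    exfalso
    obtain ⟨l, hl⟩ : ∃ l, l ∉ S := by
      by_contra! h
      have := Finset.card_le_card (fun x _ => h x : Finset.univ ⊆ S)
      simp at this
      omega
    have h1 := wt_add v (g l)
    have h2 : v + g l ∈ E := add_mem hv (hg l)
    have h3 : 4 ∣ wt (v + g l) := h2.2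
    have h4 := hno _ h2.1
    have h5 : (Finset.univ.filter fun i => v i ≠ 0 ∧ g l i ≠ 0).card ≤ 7 := by
      have : (Finset.univ.filter fun i => v i ≠ 0 ∧ g l i ≠ 0) ⊂
          Finset.univ.filter fun i => g l i ≠ 0 := by
        rw [Finset.ssubset_iff_of_subset fun i => by simp]
        exact ⟨p l, by simp [hpg], by simp [hS l hl]⟩
      have := Finset.card_lt_card this
      have h8 : (Finset.univ.filter fun i => g l i ≠ 0).card = 8 := hg8 l
      omega
    have h6 := hcard (insert l S) ((Finset.univ.filter fun i => v i ≠ 0) ∪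
      Finset.univ.filter fun i => g l i ≠ 0) fun m hm => by
        rw [Finset.mem_insert, not_or] at hm
        simp [hS m hm.2, hpg, Ne.symm hm.1]
    have h7 := Finset.card_union_add_card_inter (Finset.univ.filter fun i => v i ≠ 0)
      (Finset.univ.filter fun i => g l i ≠ 0)
    rw [← Finset.filter_and, Finset.card_insert_of_notMem hl] at *
    have h8 : (Finset.univ.filter fun i => g l i ≠ 0).card = 8 := hg8 l
    have h9 : (Finset.univ.filter fun i => v i ≠ 0).card = 16 := h16
    have h10 := hg8 l
    omega
  have h2 : ∀ i j, i ≠ j → wt (g i + g j) = 8 := fun i j hij => by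
    refine hw8 {i, j} _ (add_mem (hg i) (hg j)) (fun h => ?_) (fun m hm => ?_)
      (Finset.card_le_two.trans (by norm_num))
    · have := congrFun h (p i)
      simp [hpg, hij.symm] at this
    · simp only [Finset.mem_insert, Finset.mem_singleton, not_or] at hm
      simp [hpg, Ne.symm hm.1, Ne.symm hm.2]
  have h3 : ∀ i j k, i ≠ j → i ≠ k → j ≠ k → wt (g i + g j + g k) = 8 := fun i j k hij hik hjk => by
    refine hw8 {i, j, k} _ (add_mem (add_mem (hg i) (hg j)) (hg k)) (fun h => ?_) (fun m hm => ?_)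
      Finset.card_le_three
    · have := congrFun h (p i)
      simp [hpg, hij.symm, hik.symm] at this
    · simp only [Finset.mem_insert, Finset.mem_singleton, not_or] at hm
      simp [hpg, Ne.symm hm.1, Ne.symm hm.2.1, Ne.symm hm.2.2]
  let x : Fin 9 → Fin 23 → ℤ := fun i c => if g i c ≠ 0 then 1 else 0
  have hx2 : ∀ i c, x i c * x i c = x i c := fun i c => by simp [x]
  have o1 : ∀ i, ∑ c, x i c = 8 := fun i => by
    have := wt_cast (g i)
    rw [hg8] at this
    exact this.symm
  have hwtZ : ∀ v : Fin 23 → ZMod 2, wt v = 8 → (∑ c, if v c ≠ 0 then 1 else 0 : ℤ) = 8 :=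
    fun v hv => by rw [← wt_cast, hv]; rfl
  have o2 : ∀ i j, i ≠ j → ∑ c, x i c * x j c = 4 := fun i j hij => by
    have := sum_add_support (g i) (g j)
    rw [hwtZ _ (h2 i j hij), hwtZ _ (hg8 i), hwtZ _ (hg8 j)] at this
    linarith
  have o3 : ∀ i j k, i ≠ j → i ≠ k → j ≠ k → ∑ c, x i c * x j c * x k c = 2 :=
    fun i j k hij hik hjk => by
      have h4 := sum_add_support (g i + g j) (g k)
      rw [hwtZ _ (h3 i j k hij hik hjk), hwtZ _ (h2 i j hij), hwtZ _ (hg8 k)] at h4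
      have h5 : ∑ c, (if (g i + g j) c ≠ 0 then 1 else 0) * (if g k c ≠ 0 then 1 else 0) +
          2 * ∑ c, x i c * x j c * x k c = ∑ c, x i c * x k c + ∑ c, x j c * x k c := by
        rw [Finset.mul_sum, ← Finset.sum_add_distrib, ← Finset.sum_add_distrib]
        refine Finset.sum_congr rfl fun c _ => ?_
        have key : ∀ a b d : ZMod 2, (if a + b ≠ 0 then 1 else 0) * (if d ≠ 0 then 1 else 0) +
            2 * ((if a ≠ 0 then 1 else 0) * (if b ≠ 0 then 1 else 0) * (if d ≠ 0 then 1 else 0)) =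
            (if a ≠ 0 then 1 else 0) * (if d ≠ 0 then 1 else 0) +
            (if b ≠ 0 then 1 else 0) * (if d ≠ 0 then (1 : ℤ) else 0) := by decide
        exact key (g i c) (g j c) (g k c)
      rw [o2 i k hik, o2 j k hjk] at h5
      linarith
  have o : ∀ i j k, ∑ c, x i c * x j c * x k c =
      if i = j then (if j = k then 8 else 4) else if i = k ∨ j = k then 4 else 2 := fun i j k => by
    by_cases hij : i = j
    · subst hij
      simp only [hx2, if_true]
      by_cases hjk : i = k
      · subst hjk
        simp only [hx2, if_true, o1]
      · rw [if_neg hjk, o2 i k hjk]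
    · rw [if_neg hij]
      by_cases hik : i = k
      · subst hik
        rw [if_pos (Or.inl rfl), ← o2 i j hij]
        exact Finset.sum_congr rfl fun c _ => by rw [mul_right_comm, hx2]
      · by_cases hjk : j = k
        · subst hjk
          rw [if_pos (Or.inr rfl), ← o2 i j hij]
          exact Finset.sum_congr rfl fun c _ => by rw [mul_assoc, hx2]
        · rw [if_neg (not_or.mpr ⟨hik, hjk⟩), o3 i j k hij hik hjk]
  exact no_regular_system x (fun i c => (em (g i c ≠ 0)).elim (fun h => Or.inr (if_pos h))
    fun h => Or.inl (if_neg h)) p hp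
    (fun m i => by
      change (if g i (p m) ≠ 0 then 1 else 0 : ℤ) = _
      rw [hpg]
      by_cases h : i = m
      · rw [if_pos h, if_pos h]; rfl
      · rw [if_neg h, if_neg h]; rfl) o

end Dodecad

section Search

/-- Applies `f` to `n`, in a form which makes the kernel evaluate `n` first. -/
def forced {α : Type} (n : ℕ) (f : ℕ → α) : α := Nat.rec (f 0) (fun m _ => f (Nat.succ m)) n

/-- Necessary condition for adding the word `w` to a code of minimum weight 8 that contains `rows`
and the all-one word of length 12. -/
def okWord (rows : List ℕ) (w : ℕ) : Bool :=
  rows.all fun r => Nat.beq (Nat.land (pop (Nat.land r w)) 1) 0 &&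
    (Nat.ble 8 (pop (Nat.xor r w)) && Nat.ble 8 (pop (Nat.xor 4095 (Nat.xor r w))))

/-- The 6-subsets of the first 12 points which contain the point 0. -/
def halves : List ℕ :=
  (List.range 4096).filter fun m => Nat.beq (Nat.land m 1) 1 && Nat.beq (pop m) 6

/-- The set `c` with the points `b` and `p` added. -/
def mkWord (b p c : ℕ) : ℕ := Nat.xor c (Nat.xor (Nat.shiftLeft 1 b) (Nat.shiftLeft 1 p))

/-- No two consecutive digits `0, 1` of `c` are in positions where all rows agree. -/
def isSorted (rows : List ℕ) (c : ℕ) : Bool :=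
  (List.range 11).all fun i => c.testBit i || !c.testBit (i + 1) ||
    rows.any fun r => r.testBit i != r.testBit (i + 1)

/-- All ways to add a word through the points 12 and `p`, up to sorting. -/
def addSorted (p : ℕ) (states : List (List ℕ)) : List (List ℕ) :=
  states.flatMap fun rows => (halves.filter fun c =>
    okWord rows (mkWord 12 p c) && isSorted rows c).map fun c => mkWord 12 p c :: rows

/-- All ways to add words through `b` and the interchangeable points `ps`, one for each point. -/
def extend (b : ℕ) : List ℕ → List ℕ → List ℕ → List (List ℕ)
  | _, [], rows => [rows]
  | [], _ :: _, _ => []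
  | c :: cs, p :: ps, rows => forced (mkWord b p c) fun w =>
    bif okWord rows w then extend b cs ps (w :: rows) ++ extend b cs (p :: ps) rows
    else extend b cs (p :: ps) rows

/-- `extend`, starting from all candidate words. -/
def extendAll (b : ℕ) (rows : List ℕ) : List ℕ → List (List ℕ)
  | [] => [rows]
  | p :: ps => extend b (halves.filter fun c => okWord rows (mkWord b p c)) (p :: ps) rows

/-- The words through 12 and 13, 14, 15, 16, which are the same in all cases. -/
def rowsStart : List ℕ := [71017, 37593, 20935, 12351]

/-- The complete systems of words for the partition `12 + (11 - k) + k` of the points. -/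
def systems (k : ℕ) : List (List ℕ) :=
  (extendAll 12 rowsStart (List.range' 17 (6 - k))).flatMap fun rows =>
    extendAll (23 - k) rows (List.range' (24 - k) (k - 1))

/-- Reduction of `v` by rows with distinct leading digits. -/
def reduce (rows : List ℕ) : ℕ → ℕ :=
  List.rec (fun v => v) (fun r _ ih v =>
    forced (Nat.xor v (Nat.mul (Nat.land 1 (Nat.shiftRight v (Nat.log2 r))) r)) ih) rows

/-- Passes on the powers of two whose exponents are the lowest `n` digits of `m` in base 32. -/
def powers {α : Type} (n : ℕ) : ℕ → List ℕ → (List ℕ → α) → α :=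
  Nat.rec (fun _ l f => f l) (fun _ ih m l f =>
    forced (Nat.shiftLeft 1 (Nat.land m 31)) fun a => forced (Nat.shiftRight m 5) fun m =>
      ih m (List.cons a l) f) n

/-- Passes on the sum (exclusive or) of `acc` and the members of a list selected by `g`. -/
def pick (g : List Bool) : List ℕ → ℕ → (ℕ → Bool) → Bool :=
  List.rec (fun _ acc f => f acc) (fun b _ ih q acc f =>
    List.casesOn q (f acc) fun a q => Bool.rec (ih q acc f)
      (forced (Nat.xor a acc) fun x => ih q x f) b) g

/-- Whether `z` is zero or the all-one word of length 12. -/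
def isTrivial (z : ℕ) : Bool := Nat.beq (Nat.mul z (Nat.xor 4095 z)) 0

/-- `f` holds for all members of `l`. -/
def allOf (l : List (List Bool)) (f : List Bool → Bool) : Bool :=
  List.rec true (fun a _ ih => Bool.rec false ih (f a)) l

/-- The binary digits of `m`, the highest of 23 first. -/
def digits (m : ℕ) : List Bool := (List.range 23).map fun i => m.testBit (22 - i)

/-- Decodes a permutation of 23 points. -/
def withPerm (c : ℕ) (f : List ℕ → Bool) : Bool :=
  powers 23 c [] fun q => pick (List.replicate 23 true) q 0 fun x => bif Nat.beq x 8388607 then f q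
    else false

/-- Generators of the three possible tails. -/
def tailGens : ℕ → List ℕ
  | 0 => [518145, 1527938, 2007172, 2842760, 3772560, 1890336, 2420928, 2799872, 3242496, 4131840]
  | 1 => [7676033, 1527938, 2007172, 2842760, 3772560, 1890336, 2420928, 2799872, 3242496, 4131840]
  | _ => [7676033, 6658050, 2007172, 2842760, 3772560, 1890336, 2420928, 2799872, 3242496, 4131840]

/-- The digits of the generators of the three possible tails. -/
def tailDigits : ℕ → List (List Bool)
  | 0 => [
        [false, false, false, false, true, true, true, true, true, true, false, true, false,
     false, false, false, false, false, false, false, false, false, true],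
        [false, false, true, false, true, true, true, false, true, false, true, false, false,
     false, false, true, false, false, false, false, false, true, false],
        [false, false, true, true, true, true, false, true, false, true, false, false, false,
     false, false, true, false, false, false, false, true, false, false],
        [false, true, false, true, false, true, true, false, true, true, false, false, false,
     false, false, true, false, false, false, true, false, false, false],
        [false, true, true, true, false, false, true, true, false, false, true, false, false,
     false, false, true, false, false, true, false, false, false, false],
        [false, false, true, true, true, false, false, true, true, false, true, true, false,
     false, false, false, false, true, false, false, false, false, false],
        [false, true, false, false, true, false, false, true, true, true, true, false, false,
     false, false, true, true, false, false, false, false, false, false],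
        [false, true, false, true, false, true, false, true, false, true, true, true, false,
     false, true, false, false, false, false, false, false, false, false],
        [false, true, true, false, false, false, true, false, true, true, true, true, false, true,
     false, false, false, false, false, false, false, false, false],
        [false, true, true, true, true, true, true, false, false, false, false, true, true, false,
     false, false, false, false, false, false, false, false, false]]
  | 1 => [
        [true, true, true, false, true, false, true, false, false, true, false, false, false,
     false, false, true, false, false, false, false, false, false, true],
        [false, false, true, false, true, true, true, false, true, false, true, false, false,
     false, false, true, false, false, false, false, false, true, false],
        [false, false, true, true, true, true, false, true, false, true, false, false, false,
     false, false, true, false, false, false, false, true, false, false],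
        [false, true, false, true, false, true, true, false, true, true, false, false, false,
     false, false, true, false, false, false, true, false, false, false],
        [false, true, true, true, false, false, true, true, false, false, true, false, false,
     false, false, true, false, false, true, false, false, false, false],
        [false, false, true, true, true, false, false, true, true, false, true, true, false,
     false, false, false, false, true, false, false, false, false, false],
        [false, true, false, false, true, false, false, true, true, true, true, false, false,
     false, false, true, true, false, false, false, false, false, false],
        [false, true, false, true, false, true, false, true, false, true, true, true, false,
     false, true, false, false, false, false, false, false, false, false],
        [false, true, true, false, false, false, true, false, true, true, true, true, false, true,
     false, false, false, false, false, false, false, false, false],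
        [false, true, true, true, true, true, true, false, false, false, false, true, true, false,
     false, false, false, false, false, false, false, false, false]]
  | _ => [
        [true, true, true, false, true, false, true, false, false, true, false, false, false,
     false, false, true, false, false, false, false, false, false, true],
        [true, true, false, false, true, false, true, true, false, false, true, true, false,
     false, false, false, false, false, false, false, false, true, false],
        [false, false, true, true, true, true, false, true, false, true, false, false, false,
     false, false, true, false, false, false, false, true, false, false],
        [false, true, false, true, false, true, true, false, true, true, false, false, false,
     false, false, true, false, false, false, true, false, false, false],
        [false, true, true, true, false, false, true, true, false, false, true, false, false,
     false, false, true, false, false, true, false, false, false, false],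
        [false, false, true, true, true, false, false, true, true, false, true, true, false,
     false, false, false, false, true, false, false, false, false, false],
        [false, true, false, false, true, false, false, true, true, true, true, false, false,
     false, false, true, true, false, false, false, false, false, false],
        [false, true, false, true, false, true, false, true, false, true, true, true, false,
     false, true, false, false, false, false, false, false, false, false],
        [false, true, true, false, false, false, true, false, true, true, true, true, false, true,
     false, false, false, false, false, false, false, false, false],
        [false, true, true, true, true, true, true, false, false, false, false, true, true, false,
     false, false, false, false, false, false, false, false, false]]

/-- The system `rows` contains a permuted tail, or a nonzero word of weight less than 8. -/
def checkSystem (rows : List ℕ) (c : ℕ) : Bool :=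
  bif Nat.beq (Nat.land c 3) 3 then forced (Nat.shiftRight c 2) fun w =>
    isTrivial (reduce rows w) && (Nat.blt 0 w && Nat.blt w 8388608 && Nat.blt (pop w) 8)
  else withPerm (Nat.shiftRight c 2) fun q =>
    allOf (tailDigits (Nat.land c 3)) fun g => pick g q 0 fun x => isTrivial (reduce rows x)

/-- The rows of `start` are contained in a permutation of the system `rows`. -/
def checkStart (rows : List ℕ) (c : ℕ) : Bool :=
  withPerm c fun q =>
    (([4095, 126976] ++ (List.range' 17 6).map fun i => 2 ^ i).all fun m =>
      pick (digits m) q 0 fun x => Nat.beq x m) &&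
    rowsStart.all fun m => pick (digits m) q 0 fun x => isTrivial (reduce rows x)

/-- Checks each member of a list with its own certificate. -/
def checkAll (f : List ℕ → ℕ → Bool) : List (List ℕ) → List ℕ → Bool
  | [], _ => true
  | _ :: _, [] => false
  | r :: rs, c :: cs => f r c && checkAll f rs cs

/-- Certificates for the systems on the points up to 16. -/
def startCerts : List ℕ := [
    29435622565346244453937714881988640, 29435622565346244305284983882289253,
    29435622565346244193705125794356424, 29435622565346244084322448070389065,
    29435622565346244307468545320588419, 29435622565346244195888687232655590,
    29435622565346244047235956232956203, 29435622565346244082138886632089899,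
    29435622565346244230791617631789286, 29435622565346244342371475719722115,
    29435622565346244381948292645422082]

/-- Certificates for the complete systems. -/
def systemCerts : ℕ → List ℕ
  | 1 => [
    117742490261384977815750859527954560, 116082628815601967025960627238084736,
    117081579431308748350684480162635904, 117341089131526165138067831430455424,
    115611394689891038999155026176647296, 117726496215883383000432416536273024,
    117376073317433106275507252012523648, 115911676564181125102906453975769216,
    117015783728182302464152879353045120, 117193240554297348234665353885917312,
    116581444562253782421878457160310912, 115916730197343523573223070615609472,
    117185029477273078494484624713326720, 116044130469757533257206895305302144,
    116556236834424461821904393563676800, 117372642220814076160105783677558912,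
    116079464678733777307008162536628352, 117092027660644206301085912715894912,
    117377499428315517103245054863351936, 115607438306932431111051145529139328,
    117742485459682738029528483365265536, 117340138399729117616205027672072320,
    115935578724102148537172542703935616, 117055833548782986235189326586060928,
    115749570487413870088871089828929664, 116560865026952366101351320569389184,
    115920369697883742573835530279460992, 117727130210862390942155763758801024,
    116082595698897375902420919713800320, 116545788586502338618426579914989696,
    117574363748113728875301883911479424, 116854311155802439159125584890044544,
    117178835269934067853110879151595648, 117096627648175689911130590881915008,
    117716284120425579905393461425479808, 117564866287073442711948589441360000,
    116890246083781983618374885725184128, 117220469684262258576632923000545408,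
    115424847561530501246291822279794816, 116541030254466890565421736260935808,
    117573432318937830858264758769295488, 117583880581064402402493256517951616]
  | 2 => [
    115468601922378294680519078698029141, 117401896456788374988603553720045653,
    115144414369284289680527145614708821, 115307639083278667766905072343322709,
    114967539042522929535621568775065685, 116442290507808005185365327311278165,
    115957107923057986076398464018944085, 116929706959823426920122573931155541,
    116102926746829243835548460667637845, 115957141495986128783843222790344789,
    115946343565674574523336690552279125, 117405724939336384480821611709337685,
    116556073594457322060560746821193813, 115288269615288614341217825201590357,
    117395629030717407298145235218206805, 116048387589926785073513702235836501,
    116068225890217731563432402305421397, 117042889752435018535123016877609045,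
    116545970708372411505211842939326549, 117518579849490673337264475014959189,
    116401785839762502752879720523894869, 117503214227949139439751116949295189,
    116368471167147710623658166953709653, 116540718289421925268119488146182229,
    115900594209708574415358701701828693, 115955398433188314794359495959384149,
    115470364092401854132216951388639317, 117523597060738936030849990543020117,
    115262014450275401950842623029940309, 116396651209023832849797289343193173,
    116601073818639313637899805655306325, 115950294295915804370322292633505877,
    116589035934709243738647452398653525, 115307163710157903593059566651445333,
    116751944045788215795913674799190101, 115617229014082145054515001651630165,
    116928756232159347610946210149699669, 116428540253030998312041797208248405,
    116752711106477521057090002904944725, 115955398487716765028546800620146773,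
    115788380264864180896986954991931477, 115464173502695071177641558142095445,
    116606158797434501574436927949770837, 115778230857047717840282150703992917,
    115454047471876444165170660544614485, 115616955588013419182180590155993173,
    115793412475859989023031743079518293, 115469205737264932804730821003186261,
    115919875261676786035083743626268757, 117011222353466438194942469722083413,
    116200656025268761023862986619752533, 114907241136947133171527696242708565,
    116094177532650478948642491178684501, 116205731452794855909100074876276821,
    116423429509610053237890354891722837, 116209836003961348857029839666024533,
    116047799356713412469607323236831317, 115762983712035158154874972121862229,
    117031495174021317903928068501934165, 116220928536036399456907731201691733,
    115459402325388736844398209060311125, 116591403176118492479518064754561109,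
    116107843689927655002804966125736021, 117406823922386546358525387170123861,
    115621656650603329769166733287100501, 117400659134104243984583387070599253,
    115941272968108935858186537136296021, 116265453108221078206065223716311125,
    114982313698535638709053921861832789, 116266398740850067564547874543112277,
    116914858338709985885777177514086485, 116442285715474792931715991562621013,
    117528662711530959575769251636842581, 115262009503199984401992364836786261,
    116396656011028160980029305197432917, 117400495838622942846588493119361109,
    117351878836706493860826370961576021, 115241559542357648159238422853587029,
    117518589907450406870137403085164629, 116545942236658528762819312699576405,
    116363247219911393053491484898365525, 115267073583754978936761884327809109,
    116401790786842937523384043614507093, 117351245018349417293820739507720277,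
    115566093070976707659113355303850069, 115627394160598176987271679791468629,
    115787910247540109046733907138318421, 116551007938829604172324634156601429,
    115283194056442813912792071812681813, 117390553631147583608731808332779605,
    114983581357612860332139163418890325, 115291135799924299466376518578737237,
    116928781135880263518381372747288661, 115129672834201331081079196949418069,
    116442602623571286316123092758564949, 115632114624697415364617362936696917,
    116599181935773138992611580887437397, 115627370209212412426258312964870229,
    115632167380709924877322389068976213, 115940365253058311498174441827078229,
    115464188667007630101327236733079637, 115788396048146759445366497268207701,
    116599177125002028141736638682501205, 115454032307563433575887659054927957,
    115778200683165520855577662327099477, 115627394207750174468121617676636245,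
    115469216104711433669021294880100437, 115793442649742065266365740756504661,
    115225242389165838445740002333954133, 116083277312562745614202843645087829,
    116245394403394631070751246008979541, 116905053482884366328819804075724885,
    116205740737041242216763219176067157, 116094188054840401488979752814645333,
    115561456859488465724027711376330837, 117071907686261194210968631442149461,
    116099254024033101658472055157559381, 115438841345567885358121351945392213,
    117041488133696241187033629210185813, 116068859970433029499718544755265621,
    115454696465931580530285413082075221, 115955825257254221343030659233615957,
    115631628422179184259857960912818261, 116914044706865460210469865422852181,
    115301929544924729918384834500366421, 115788208963254090337236295193202773,
    115955868440690011785713831911886933, 115787910311890934139819923700191317,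
    114977396136449260335259651724808277, 116428698714338118872957647306625109,
    116761584659498563958224372392792149, 115140606305101052310407069558902869,
    115940648430472778633921817448026197, 116600924941695773230419491982413909,
    116763061985243258143757705115078741, 116600920159336659562436609058279509,
    115787881514521572050323376479408213, 116589189594011897814110648995680341,
    116418522315138787511881224526499925, 116209831201957177523832042102722645,
    116047809264918171480860494349471829, 115925406392264817739907041750945877,
    117026434629731956415705899256254549, 116215852822448527616295175624855637,
    115757452581447126450051673997185109, 117016282897755799683164638967763029,
    116205731738856632864475542196588629, 115064419912837368015081246491414613,
    116099243178304567620865204074844245, 116200656058060587919688842376122453,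
    115465293541837378821270127851606101, 115631633992759296194567944137871445,
    115955860228002686515945147562463317, 116437378361867871648167624859455573,
    114967254941317917602187746503561301, 115777740324227578271877660229767253,
    115631681954322794474060363321315413, 115778106135802436532097238834614357,
    115291788349795519600974521031725141, 115470344942869150072217354495070293,
    116604415786676306880689276792868949, 116590783746565644348595913638547541,
    115616450200446847054779109500784725, 116604401386705442809692106581610581,
    115145480395254775095922293049921621, 115145682023525655978990653243920469,
    115290977343745659682485074783375445, 116766680469967467871529882922258517,
    115399351082539692849852096467701845, 117066832286691669983908822903951445,
    116094188223636521482788367394672725, 115601254121975307756106710471938133,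
    117036412734428948423603201975259221, 116063794160062811312495916155670613,
    115230149583325879928687329802457173, 116083282114114021709984690350592085,
    116245399359839527809024574171123797, 116747869755083162699058690671251541,
    116200665187564912033615940445016149, 116099253855236981664663440577531989,
    117082157120445203138523259499450453, 117092134451276828858266252824809557,
    115945392531032335051599807028400213, 116119520709287921665848697751343189,
    117092129649573381653707955795923029, 116925316155715916193469596715716693,
    116118777171121816670768495694450773, 116280823362234340922739571172839509,
    116762903364971254838417492256493653, 116113701766716284942596140137975893,
    116275747663153140663219887492304981, 115144212583996091431652292840132693,
    116276744049810777352892784014790741, 117087227718010278620350040177381461,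
    114983225915297106665873621431619669, 117087232524850591755955524782526549,
    117081988454444174549413528877666389, 115621973265153951893837305048469589,
    117081993246473800351648705031704661, 116109379509321951434208956335263829,
    115788396038474004874422472239485013, 117092303122415667237782305460457557,
    116281814642540435759744954927419477, 115464135139700874966374138138333269,
    117517010324276303974480182325416021, 117523814507058896578743190937800789,
    115900906325091016586798444436656213, 117204534770580349301276938212872277,
    117187569885440312693523104007589973, 115565137072636403831619877513597013]
  | 3 => [
    116416838239471050639015001471453906, 115256145247635355958181979989609170,
    115226994801329616267738831720155858, 116376913488437752215353896248412882,
    115580351495859876633121057149160146, 115597144761744352038221527191259858,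
    114953019964903127355255218868718290, 115120037559279388425840976625535698,
    115383227789702884561127492747922130, 115073762761002763721022807944071890,
    116529189857221404798016345811847890, 114760341093351324608440781989087954,
    116548338452750459239048046971062994, 115225673464789075952055704164109010,
    115257402661012343053299155082545874, 114744945750798805985113185819167442,
    115549914003135626926585592863132370, 116898684271578334239869977355225810,
    117238889542032218575886896410528466, 117223687477714697049437577861532370,
    117004978807077377282488669558672082, 115935714877866739536623768921311954,
    115135868360656084821893008301624018, 116533095068557640459170944471141074,
    116895020756271243321165917016165074, 115393964197173453259041326185450194,
    115885782901201894151283682322811602, 117239792005185041800193449060862674,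
    116528663534453860787072821350238930, 116584921617975105952655461715151570,
    116361150598580540160999352193649362, 116416953595137489047021176414669522,
    114973578164343355810853025763953362, 115277175338047594064003034184288978,
    117055532216294284070052926589110994, 116879802454567185736066402680441554,
    114800687922670255096425506469448402, 116417438393748281863693544999488210,
    116376208297846511661593796288842450, 116543231471505334761908556787747538,
    115708168375693558230928805695982290, 115079433498489173661036653582617298,
    117239965171714130872486388912229074, 114760144314066746578344765772925650,
    116915753785706140156832285076884178, 117168995804221898126367229378431698,
    116712611833920515378413011390827218, 114785465854257192307553822792878802,
    115722952314038244519180980027787986, 116730884144363709786190983026838226,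
    114920689042944984239334450090085074, 117239052505227685239607865039260370,
    114765401192602952194615405654969042, 114758534170008986145902180155132626,
    115241710681896341266696889360845522, 115942201833688121856615569053321938,
    116376428539919862623066200857512658, 115256879984324783527220511791778514,
    116356090049607813901875948764138194, 115768533841583671944852777803582162,
    115707746078021107822468122112297682, 116234149595401465725762459599506130,
    115724234950900242393254060720523986, 116259966810728415527495402768173778,
    115412699765801371131268119857859282, 116056507949796697297353557755955922,
    115449473064772461323496976743008978, 114759712267455341535717608594213586,
    117183133863134941484948637519842002, 114926407712082018245246189345835730,
    114937331531914770276289692444003026, 115869856945605252926981276235336402,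
    116234308002467484885861541706074834, 116732958606434429223178862147537618,
    116229702575365283844282092104059602, 116738355580111262772543324518746834,
    117214676211472596364070025053735634, 116377235331531194917632937323268818,
    117224647842672550987167478136834770, 116053022103875833741322821849713362,
    115581307218310344091929914426657490, 116890464526406581047599307474209490,
    116895069213646175895998526593829586, 115099590701154303483934932249742034,
    117214517764370354202203140663675602, 116523480601089825052984081580690130,
    116529353243541198790527190088944338, 117219736155530426949846077024635602,
    116107700528220314171594937234229970, 116043039660666977598174857646967506,
    114927199968598282986676033113164498, 116895544554499578272033385534851794,
    116223997983410891970312800024267474, 115448205471936201473824516187753170,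
    115424108949691205461921248214911698, 116738038686662343227925310979836626,
    115093886099538018961302760605223634, 116108968149617474193143935688379090,
    116036701513937999453192903916128978, 115119884049269633077205467165493970,
    115231743717349085743935998121872082, 115226207528614733021839495111248594,
    117168080662008204022610893788547794, 116254579121762128110016018654563026,
    115871283020300326107876812233247442, 115754650348237269841016147050367698,
    115722967313636014041234832189688530, 115586368034608162672121289308768978,
    117370880559429199405961153473546962, 117209572223525738527262611093981906,
    116915792760871263215790063100234450, 115942396489331119580264506595609298,
    116717691585019514662707834266979026, 116041243583787304004867129302190802,
    116854440607129841546356486677072594, 116037796230064568113108654569425618,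
    115874903224875090532613989754604242, 115785176295945569022791163960232658,
    117380833442456161023018411871046354, 117168858542184544290915272762723026,
    116864576705277487792383205153311442, 115712773323207750722584062189505234,
    117386057239780695679500483169487570, 117168827754018132028747871590419154,
    117406368960243729437440274749065938, 115707687434090504148991616510724818,
    114952513938493337208295280271821522, 116900086083070530526810747871300306,
    115383515969461554182953641248426706, 116259922898007105883181481313045202,
    116223936730613665629689143581870802, 116763640675266868943846375621266130,
    117375629297712695033582478225050322, 117212736364672279031994071958948562,
    114968676235958993246832675277507282, 115617871175653338486276463433878226,
    115083090788976999355871441340074706, 114956485621332409820282276033071826,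
    116254241690305724145653877412465362, 115610915190780373006665463347022546,
    116259793232246621078678892540332754, 114753810556958009183764205701171922,
    115229971963424280939308104164838098, 115460694213453916846392615054346962,
    117375470890654961653530585744018130, 117212894860583456568733381194681042,
    115130935329932299668875875168029394, 115455612025462377867165304281631442,
    114915871401637803491455478161214162, 115088113281720867542679655003982546,
    116225353277235965235995368816380626, 115418351113680480203765758344563410,
    116230597500571554018111565756369618, 116382740650701794502680225863961298,
    116524559211357575893904832212503250, 115622903040292824540481684343360210,
    115895136891492450659673832071236306, 116692344447643474220965018147621586,
    117346437327902669562695609953159890, 117218578976546844511224327682788050,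
    117407319669207821308342393142119122, 116732894867788033441571870280387282,
    115074209372931838039161716437289682, 115885009960023383526152423778421458,
    115596480303163852544176040081230546, 116229651521216769530400290505886418,
    116254515426027894948537825457474258, 115790078852066157328340222782606034,
    117208462994924674491447056036661970, 117371672893825151333126376479918802,
    115779978610807808937812424587872978, 116753691804367488815739783648250578,
    116874707416305783259423263888116434, 116051845146941489184565026229455570,
    116702466155192149131522038388886226, 116058231989202503020970134202354386,
    115733079871276169575712553556904658, 116921026335690410140148500885801682,
    117346483135007433869240478157900498, 117223788383272407683661993332574930,
    115250920985922196806817649206102738, 116421755182569162046820909471369938,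
    116382137440656456812407693903006418, 115231902150383273628787324183775954,
    114962843937931504052928918537243346, 114911666732680380264748278092008146,
    115545333721545287152539042440153810, 115413016669700721701038760277445330,
    115115442499910577182672073751923410, 115434732130256921345941692148222674,
    114755423840777648112255269685299922, 116523956001482681065825528317086418,
    114795617479847697797783440997878482, 116381125390851424706117317284727506,
    116422662495873788097464955650050770, 116538160719197472782255407161805522,
    114922239722398784377452202731637458, 115870427497775691751501724609809106,
    117082618045801374968305196856380114, 117006572964569716697212752572320466,
    117223322594726524493939969238371026, 116879788049002839577035377614129874,
    115455443384542206173543766039857874, 114785470955924003502837015781706450,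
    115885048182777402276448676566141650, 115077872615710900699416002549648082,
    116893143266454992891824453296720594, 117081705369643227639611659756112594,
    114753617077013222686438935905831634, 114770625294737608013447384824679122,
    115246781434203908098453372535966418, 115251804580070514960691460984408786,
    115617733890339649867030828614290130, 116356084947940707558696106487581394,
    117182910399982554950599539870010066, 115935700472302098229687847701580498,
    116553408895573311685586229154417362, 115252178558877687234467450522307282,
    115230590557784839411518673803938514, 114739874998491239153356694322547410,
    116736425149487051134227985870228178, 115392730440041117014413874546477778,
    117081859328760075284311919298742994, 116523000490664302873793638852332242,
    115947128356309705533267949134154450, 117061591454223442227709926543854290,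
    115768548247138868518831755825908434, 116533100170224746802359582832331474,
    116732924887522345683035831647996626, 115723523779119760630702242193869522,
    115551157982935249090535611179338450, 117082761782241196812803458721778386,
    116579697515849599718884325674060498, 116523746441448947742549025744882386,
    116366221350888402140652493498092242, 116920680617812438515931745194478290,
    115231551731119375465300279733390034, 116422019395685046603934466526284498,
    115277170236380782868728637280094930, 116712626239475416804487093259733714,
    116269959617463014504351812177496786, 115728978582393296569679252006505170,
    116228910323665772961020064697551570, 115712984885515118755744717320882898,
    116078862361521918241162108925512402, 115435212479109115693079323622902482,
    116037176916470212070429020796357330, 117218310026055902521621226520185554,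
    114770011561035644046917319084083922, 116889355309435715727155190705556178,
    116863695825073575729809047880338130, 115297345094056035576654930569726674,
    116706655649501965382357099770677970, 116271227262368031834788517009033938,
    116691612337539252942294198234778322, 116260917523640553459154071794617042,
    116418264378296026686304890818530002, 117167763699933868581765770339551954,
    116423027792655302058476459570367186, 115546764832332524348971851060480722,
    116043198130913524099488882553391826, 116580374642626187729954400788155090,
    116595417765996467703094186346678994, 115896159955815400127273411140520658,
    116585435176942058938365318493506258, 117207862763076389876076417883704018,
    117182341536302607563059755667819218, 116580216166811948119866068655278802,
    114951435430284623854360038375295698, 114912939373235224251701425260858066,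
    116053497478319392071962126352255698, 116256005237475685802220948019088082,
    116864012679081276596578210164116178, 115753541196907243273710178219985618,
    115713777189481749614185064364640978, 116433158934661127408261674572057298,
    116078703890996738292020118579972818, 115072970454618373516882651656620754,
    115115764368556740299792150297709266, 116057617158890673825246611169741522,
    117207704337281456003239891848792786, 117223063270752056182290816191040210,
    115251718189329891078235128997219026, 115895526112702561099076353304693458,
    116224314940470101848464247088089810, 114769060855905970690559564478286546,
    114810567408955887801052545285229266, 116691453954358963462127755980835538,
    117370880559429199405820415985322706, 117209572223525738527121873605757650,
    116915792760871263215649325612010194, 115942396489331119580123769107385042,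
    116717691585019514662567096778754770, 116041243583787304004726391813966546,
    116854440607129841546215749188848338, 116037796230064568112967917081201362,
    115874903224875090532473252266379986, 115785176295945569022650426472008402,
    117380833442456161022877674382822098, 117168858542184544290774535274498770,
    115448793450419232552839899376650962, 114926071292081426859865903951121106,
    117167252783688821729818389522811602, 117385788298355674150978175837014738,
    117248392757664031019383304300399314, 114951399945591192334069719929850578,
    115707879471188237068181837258558162, 115382901331699160025827929193843410,
    116899471446403725392693642171386578, 116053487232822905939284829860399826,
    116037143160238388064944013340445394, 115622936623798853643042923894409938,
    117375629297712695033723215713274578, 117212736364672279032134809447172818,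
    114968676235958993246973412765731538, 115617871175653338486417200922102482,
    115083090788976999356012178828298962, 114956485621332409820423013521296082,
    116254241690305724145794614900689618, 115610915190780373006806200835246802,
    116259793232246621078819630028557010, 114753810556958009183904943189396178,
    115229971963424280939448841653062354, 115460694213453916846533352542571218,
    117375470890654961653671323232242386, 117212894860583456568874118682905298,
    115130935329932299669016612656253650, 115455612025462377867306041769855698,
    114915871401637803491596215649438418, 115088113281720867542820392492206802,
    116225353277235965236136106304604882, 115418351113680480203906495832787666,
    116230597500571554018252303244593874, 116382740650701794502820963352185554,
    116524559211357575894045569700727506, 115622903040292824540622421831584466,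
    115580500242559522449146598324832978, 115118565831162265365469268575128274,
    117217829869719381407991594852944594, 117345035204370493264027937742654162,
    117248234306178497413896939996580562, 115072965707014043747684234679159506,
    116732140962715250397098197571996370, 115595678425455669995499784033667794,
    115885350859864925419914916161260242, 116057578929331224154829593744902866,
    116043192968345489734392937250425554, 115460708598613530041778400252791506,
    117208462994924674491306318548437714, 117371672893825151332985638991694546,
    115779978610807808937671687099648722, 116753691804367488815599046160026322,
    116874707416305783259282526399892178, 116051845146941489184424288741231314,
    116702466155192149131381300900661970, 116058231989202503020829396714130130,
    115733079871276169575571816068680402, 116921026335690410140007763397577426,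
    117346483135007433869099740669676242, 117223788383272407683521255844350674,
    116234783385935527042449736758069970, 116738028759114923423017739145579218,
    116733285427430768572704447520705234, 116229227191897241687693897052064466,
    117214676225526359031027085879675602, 116524282800718489445721903093385938,
    117219577704045819454285661964733138, 116037969212857449252107823159053010,
    115094529847682015906563905602849490, 115605552602689525831959337110735570,
    115586368071782631669300941073550034, 116900139352272907428880342765931218,
    115722957425832030523973976184720082, 116234624969198101325714821621091026,
    116259491427260382594279510590491346, 115709023593417922358484676492004050,
    114926397768969678545854473055636178, 116041771961747518575887635529730770,
    114962695374987725992248101906287314, 115231278290593849512527648119720658,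
    117167922210523605750422232384015058, 115916909775119673590408282791611090,
    115885068289033819518438306526399186, 115424108912516736464469192435960530,
    115580188096369711546716407407446738, 116108809692824935980853080306617042,
    116051437501987178174658826142354130, 115606661739054368408454342002215634,
    114760019223383147934922673039215314, 114754641505476225045029455585741522,
    117183292314619539757137298924374738, 115886494377782646142646196461767378,
    116255054505230161043231910832245458, 115093896047637177661956224387779282,
    115099590654006196483941789316811474, 115707755970207447449777801898625746,
    117214517750316591535246079837735634, 116375957748434488368306920758577874,
    116382305774353904262438224318827218, 117224806294157158482727893196737234,
    116107225158787172858291475231935186, 116058092551685362087389856337627858,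
    115413977339226611172042041936972498, 116224473366878934126900995076262610,
    116900614707180072471872262532893394, 116728205090155002205200994615298770,
    116732968548035611695043494807734994, 114937331579062877276555239391103698,
    117208621451396091764905977827166930, 117371831349994346375053686413069010,
    115942238047059397003582774033124050, 116915951231249892556124720403188434,
    116717677193517919179620290733935314, 116056915904236018128605092587375314,
    116869637573110432489620226640579282, 116053161541392983898266606764165842,
    115890110094366255887047422019504850, 116758767208621609655184400471689938,
    117346324678838238818314773644577490, 117223629926800990410203071542069970,
    115879939953926177007419132087503570, 116707541385511979328404566933899986,
    117331240380664989353523885161712338, 117223634709613523783452177721330386,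
    117407319669207392840249493369785042, 116737980310810763347611668134890194,
    115545775401037847100933510785010386, 115869783302829661906259313049078482,
    115114773060584620313928750541703890, 116229160832748321448521122751580882,
    116255005805011342423718237063744210, 115790093243572456163713833702132434,
    117374995526500969970526720329255634, 117213370224737448251737246609443538,
    115617712696206149823458615654353618, 114968834659188527712582563795307218,
    115387927789413656477848932217785042, 115575381336463621917085866148498130,
    116225527053064257122435792845933266, 114931083058937725829359547200047826,
    116230423724743262131671141726816978, 116529629664002798295066876345322194,
    116377670198056572101518181731142354, 115136140079578598178451489003145938,
    117375153943230404767170449140615890, 117213211719154569298406101043382994,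
    115455453602233138261090227546491602, 115131093809379193472018911164893906,
    115555137582717548159790941825403602, 115443743772555145050553064175700690,
    116254722475254314361667113286109906, 115123657039557637776394675204393682,
    116259312447298030862665656666688210, 115224901211267677505258441228421842,
    114758881309114612617813868637588178, 114973921349219376489550321803332306,
    116849379767408982684943656367033042, 115727970260774024374838762173237970,
    117381001506714016407272633130945234, 117184024701255812237919596381866706,
    117406368960243291745694146613086930, 115722914091284225768884727240067794,
    115434221181072569438542569811348178, 116895000640047800620770950016797394,
    114911949941355545121181846900706002, 116259432519023658408001069706775250,
    116224427419082113711568311336176338, 116763655375955936931296560371862226,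
    117370722102957782132502231683042002, 117209413767356543485335301160831698,
    116753533333988859475405126345296594, 115780137053079531514494157150358226,
    116874721807807378742510807421160146, 116036172826492775060827062944271058,
    116687269189211558188258298425379538, 116042866677874087235812182007614162,
    115717873001785004221279121292004050, 115947435732197157088561513405483730,
    117380991898927578296477333661551314, 117169016998353739341840977276046034,
    116691443982534635534968379685341906, 116271068791540602002585231451884242,
    116261075994467983291357357351766738, 116706824004506582789682918320114386,
    116580364734119349593560031497947858, 117182499997458612391883700883819218,
    116585286619306054797934885806934738, 115075198809486803094099738119768786,
    116058409474342081467573609970141906, 115915800628474234569468925643459282,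
    115880948612386842759188683723770578, 116433158939345714963635760110111442,
    116269484233994981571135919999814354, 115713767224910976534909867777985234,
    115728196233326041457250571393305298, 116229385697462408560972426719136466,
    116078862347468155574477452113742546, 114953505251461568603276703451712210,
    116052388259898778661886051087420114, 117222904809596042130094568100727506,
    115256788941637610235096819076041426, 114763990098913663978051384847239890,
    114810567404271300245406055733005010, 116848484172462239995282642744511186,
    116078703905050500958704775391742674, 115545011860932127704970656775015122,
    115597471596204287389594770468899538, 116042405815462107233789580878678738,
    117208179706421810594605427266292434, 117218468487211916573817474610498258,
    114764940808727924890055629005261522, 116223839566673466248511885066504914,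
    115880314764891638397570499232271058, 116727095877868724431123489528875730,
    116706665606970299196654161116662482, 115297345098740623132301420121950930,
    116423334821118736031110177814088402, 117208338132518975913347207424772818,
    117167605238777863752941825123551954, 116417957340161195380407642418711250,
    115433618031728806544115020568070866, 115384505396080945506573538201570002,
    116038286134890834703877398935505618, 116848801012113946749189490078780114,
    116255846766648255970017662461938386, 116585445090435716076021435276069586,
    116595417761311880147720100808624850, 115728988532910306982269791781391058,
    117208621451396091764765240338942674, 117371831349994346374912948924844754,
    115942238047059397003442036544899794, 116915951231249892555983982914964178,
    116717677193517919179479553245711058, 116056915904236018128464355099151058,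
    116869637573110432489479489152355026, 116053161541392983898125869275941586,
    115890110094366255886906684531280594, 116758767208621609655043662983465682,
    117346324678838238818174036156353234, 117223629926800990410062334053845714,
    115093247507173195791445213371828946, 115605818566850823478355502330677970,
    117223375362223806716635788360157906, 117329348497695067018439869482535634,
    117248709660660654098913002044656338, 115545007103958632057130900539968210,
    116737212014836582059774341153950418, 115113495814340089972199805298019026,
    115870138593270370588763277387500242, 116042367262363894298715149381536466,
    116058404325827818983808625465756370, 114973930937814680155361810778819282,
    117374995526500969970667457817479890, 117213370224737448251877984097667794,
    115617712696206149823599353142577874, 114968834659188527712723301283531474,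
    115387927789413656477989669706009298, 115575381336463621917226603636722386,
    116225527053064257122576530334157522, 114931083058937725829500284688272082,
    116230423724743262131811879215041234, 116529629664002798295207613833546450,
    116377670198056572101658919219366610, 115136140079578598178592226491370194,
    117375153943230404767311186628840146, 117213211719154569298546838531607250,
    115455453602233138261230965034715858, 115131093809379193472159648653118162,
    115555137582717548159931679313627858, 115443743772555145050693801663924946,
    116254722475254314361807850774334162, 115123657039557637776535412692617938,
    116259312447298030862806394154912466, 115224901211267677505399178716646098,
    114758881309114612617954606125812434, 114973921349219376489691059291556562,
    114961540714730674439953665621101266, 115413324027467753517567288904125138,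
    117182939490364247975406457782930130, 117380242805851248842333982329801426,
    117248868112146178480746137984830162, 115433582556706772357369698665499346,
    115723091737782791899333476032318162, 114910859934754571716381263333034706,
    116894400394282393730017498589432530, 116038275875340576689869141645069010,
    116052354827205717921058457703811794, 115136159272182772908702908251507410,
    117370722102957782132361494194817746, 117209413767356543485194563672607442,
    116753533333988859475264388857072338, 115780137053079531514353419662133970,
    116874721807807378742370069932935890, 116036172826492775060686325456046802,
    116687269189211558188117560937155282, 116042866677874087235671444519389906,
    115717873001785004221138383803779794, 115947435732197157088420775917259474,
    117380991898927578296336596173327058, 117169016998353739341700239787821778,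
    114763673157565919557121759160437458, 115585585656106531065694368473156306,
    115597308169683278090842586558368466, 114790765789594613148027933272705746,
    115423480078177162138639884458527442, 115384346888225601442090174174595794,
    116371847992086297129856893739731666, 115120042506052874139481447245941458,
    115226202518373084518522514726587090, 115078838469755356702260869694884562,
    116529353264848663877141650877844178, 114922605481060976711409126827231954,
    115098961808290482815332039698549458, 115869535047477651005084469687356114,
    115936567667840189207664756640582354, 115119884053954368206804408955177682,
    115383237746718157128942573504826066, 115394008100676234181484400848538322,
    116848796118835871267585528611080914, 115754338387200981171404726025194194,
    114920703994034752814442007756933842, 115728196212623334412065112303209170,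
    116710621898738075865008571601259218, 115581302234060600656780694531476178,
    116889999051289709570365839470889682, 116529194787372160545920108632083154,
    116518573556827292798889299512789714, 116895381164850806527020566824749778,
    115880785180860143443937209815796434, 115935458502914455682937920738691794,
    114764940846507004353248792491985618, 115290858331662733855537278690134738,
    115767806763500799212436414995237586, 115256784022367629683554471026756306,
    116371214112403382964237982144531154, 116738197138142375930955446070938322,
    115606973700870138115452667544341202, 114805660215117114961225840989440722,
    114754641461350580222143300070673106, 115550409430297880133777104190966482,
    116426672130049924703002425068489426, 116382300848283715891532998969002706,
    115394166538092925731755669021919954, 115250920955548230769098284649810642,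
    115115605907849503235293133119032018, 115272477954948407138714406552210130,
    114912775927673633286606612139739858, 116518890505131225980328525808405202,
    115916444309371977205908038152751826, 115115447455750997338644891813677778,
    115077887711872062776184373543832274, 115895521135253025485060636802157266,
    116898549823591573752768240904440530, 116877956724897230797090868472974034,
    115413977311421464859835417499929298, 114936549186474458679960441700092626,
    115769232841690478999532212301466322, 114962690432597039109925023328111314,
    115551201722024118554396458936830674, 116691612401008006029810490362956498,
    116590510576511744425949054531406546, 116862740075795639427407966778821330,
    116878273607163591166749557060143826, 116580216162127508138440174747126482,
    114755433786157018938844006926387922, 114789181259948632422018575467940562,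
    115886331007174456063976006962252498, 115753387692498214596676000434752210,
    115271210356671962672917406508255954, 115708865188623504514067653724342994,
    116711255694277827221003549131541202, 116423022831526264954107970204076754,
    116889999037235946903408778644949714, 116382147318184866017831142861966034,
    116371050704171956114212138690677458, 116900451303477538059902382996851410,
    115895838071878527933152208506456786, 115934983133481314369634458736397010,
    115251718217135332538614801315793618, 116727893124434125989222961907894994,
    116518736965058719648915142966643410, 116733126999515644398073629898836690,
    115768282132933940525739876997532370, 114770006651739301498188462202948306,
    115585263805122175400745686500772562, 115884271035526829726550391913581266,
    115936409211047650995373901258820306, 115606661743739103538053283791899346,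
    114911671723579649152132533979318994, 114922283606710296372471075765881554,
    116864007771447207002111933746907858, 115098966795109341114311987444189906,
    116711097267878430456374107018758866, 115094524853458634468601194539518674,
    115392745400348507002530012875328210, 115712984869194767820608082012146386,
    116428410220688421518693913851988690, 116848003778270895617290036234554066,
    116878748976606177204020346601212626, 116417957335476755398981748510558930,
    115226999809002740193716119867099858, 115271363861392815111773557660715730,
    115871119663745898695891279545502418, 116590515533258572994779311943846610,
    116710780324835241183732759590472402, 116585281658177017693566396440644306,
    114789027755227779983162424315480786, 115724076532052061882152381141093074,
    115916444323425739872592694964521682, 115597154683398544428447511984868050,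
    115549929118185816964272378662226642, 115880309791824458893603606511094482,
    116893955040051434144294899323898578, 116878432094037585388456403890473682,
    114927199930819498671655917507971794, 116726942378144283300455923425872594,
    115079477228058180745383133854173906, 116706824053619341764336895498783442,
    115769074384897940787241356919704274, 115449468122381774441173898164832978,
    114768902366052269274502856188234450, 115423484990193735418561678549322450,
    115435049042614468391513648544221906, 114790924245773243708547340221680338,
    115292601308467579070782337452214994, 114962853831478180332586155401939666,
    115231273275365382007658924059265746, 114921808246665261167554239255415506,
    115546606324477180284488487033506514, 116372006448255482948412166826494674,
    116524282817039135531074616389929682, 115079952616498888625190437302438610,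
    115449785026295444308557375700339410, 114805660210130295959674097313647314,
    114759712218342877711279709403351762, 115393379207207784599070473751497426,
    114936227288691405071448133219781330, 115256150164034580486479381677607634,
    114953346780780693535964195104885458, 115272636411127037699233813501184722,
    116377230400474187545465964481088210, 115551513673530837645536979497126610,
    115075035363925212129004924998650578, 116519048961300411798883798895168210,
    115952239979074990448167228505459410, 116194623209297359221105345607895762,
    116052806109627675238189470148856530, 115874903214893533289124326205950674,
    116032576755545700677334487359687378, 116230173506509896767284672997755602,
    115443743710299044766041303395994322, 117400836417761655143208229982571218,
    114925759181269475098303717720591058, 115585570675558621914699264237374162,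
    116705486627419001373011210284436178, 115753321448500802667192507426802386,
    116925924391886092752298040757455570, 116245325213325015543448517507943122,
    116057871914858592652498267380255442, 116854440651708431196720519249529554,
    116083252886445934906995715103394514, 116260567415037875135646132441582290,
    115575381349162217423816871079185106, 117406027438689658598776619193731794,
    115119997083232113287140955035667154, 115423441690407274202520277775157970,
    115728440905200681361311255299754706, 116727824444303861461733950349249234,
    116753518939005261627313018735037138, 116250415787633676889512944022457042,
    116037609302925965410590642992712402, 116702466185410050549961611230186194,
    116088318232286867481977937966795474, 116255491551693579935393763477818066,
    114931083081595953508717739643112146, 117239792005185166185239783655213778,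
    115880737076038009351220561906371282, 116889945226439929883808135544703698,
    115449739125344959467876659042061010, 115098284514875568836150339001518802,
    115131074625689330754297750035237586, 116088323024468664253241907392678610,
    116260567410352840670339590927813330, 115088113299708518117270330001197778,
    116250410685966861082543732610435794, 116042674808344507254082585829182162,
    116869637608310568753952369223535314, 117087832384491413238680351521508050,
    115713402409466507332078189540412114, 116727839454171013119398700304698066,
    115606932901435348755823972032056018, 114936188646140838297328116490701522,
    114973890875222046452595587939437266, 116047788098068015468465860309551826,
    116230173511194323328243449987205842, 114956485573734825620896825791875794,
    116209849886438790205094537455602386, 116037609312296654130467142428134098,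
    115890110084394595740723978935864018, 117249189207689163418889696504318674,
    116690765044032644019808924982184658, 115753336767560168488841272424008402,
    115413011921491933790927349316979410, 115098317940474955440525387294182098,
    115622591257871001274959165598599890, 116032571653878598945827469379373778,
    116225097647850635753106881147701970, 115610915133194554679016315798293202,
    116194618417115267301949657512544978, 116057871905490644946867301484989138,
    115717872996794840632114899398560466, 117081546927811118788573943350561490,
    115093084268322227210570654030105298, 115423464903284687636192321643612882,
    116862670185677808006865149390621394, 115915417317249405157566667859036882,
    115465407562709498170445827722578642, 116083248094264138135731745677511378,
    116255491556378614400700304991587026, 115418351131049652815264280721099474,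
    116245330314991831350417728919964370, 116052806409440050809006324543785682,
    116687269228807912992729761256180434, 117402065996908325903169771783981778,
    115895775571772183380453627665713874, 116889930216572778226143385589254866,
    114962803307141723999193642045672146, 115585537559142004741342500285975250,
    115780151448213677118567256462330578, 116209845094256698285938849360251602,
    116042675108159623839144973764266706, 115733079866295903083714552128473810,
    116047782996400913736958842329238226, 116225097652535062314065658137152210,
    115123656996630335533871838194174674, 117086137673539449784201684925418194,
    115580337008544685903194285626493650, 114936212168201021162018444700420818,
    116847948602291450653662864088369874, 115915432636308770979215432856242898]
  | 4 => [
    65604135132492851499562531880703362, 65959219365520578951545328538883458, 31457283,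
    63540553257298078714480142839977346, 31457283, 65796960093527068866616660978963842, 31457283,
    65441875860499341414625076817696130, 63545623859694269261099797819168130,
    63702649155966892818381669413426562, 31457283, 65796960079019959031241123767391618, 31457283,
    65928653690986981504799797963658626, 63707719758372528097966788805137794,
    65797006190761059883341713754035586, 65472441535032938861383788647552386, 31457283, 31457283,
    65959265472425976525187406121670018, 63545623859708436360547994437948802, 31457283,
    65472487641938336435012684975707522, 63707719758358360998518592186357122,
    65634746928438956355312495995655554, 65766394423829174698316461552964994, 31457283,
    63707719758367805722477132222043522, 63545623859708436351541070061114754, 31457283,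
    91379610128638891763149993048277254, 91293390159385071873225531110850822, 31457283,
    91704123561448088057736378169295110, 31457283, 31457283, 91704123566283791336194890573152518,
    91541869400632401848087448111284486, 91288319556988881317598951754825990,
    89837062669233412558115645627433222, 31457283, 31457283, 89837062669238134924598377833693446,
    91541869400632401848074266856653062, 91303531364177452970968303257649414, 31457283,
    91541869390960995291166029552025862, 89826921464436309089386679085957382,
    91379605012625364609411743142510854, 91303531364186897694926843293335814,
    89842133271639047828693840642310406, 91866382843113004699573283033841926,
    91921020561168474745659820427575558, 31457283, 31457283, 91758761289174964660731152867655942,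
    31457283, 91758761289174964660717971613024518, 91434242745187944490860636493185286, 31457283,
    86101246810401934637623123873235470, 86187471571842278276826382706409998, 31457283,
    86674244590658748397825720439669262, 31457283, 31457283, 86511985318665238312897052879749646,
    86349730843835788361763837769417230, 86096176208005744081996544517210638,
    84487418679945398624802102151610894, 31457283, 31457283, 84487418679950120991284834357871118,
    86111388015194315735365896020034062, 86349730843835788361750656514785806, 31457283,
    86111388015203760459324436055720462, 84487418679950120982277909981037070,
    86674244595494451676275445340439054, 86349730834164381804842419210158606,
    84472206872747382242970748424684046, 86187466765006811586113905449107982,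
    86733640955207471335881545013658126, 31457283, 31457283, 86571381683213961250944089950650894,
    31457283, 86571381683213961250957271205282318, 86246863139226941081086754830811662, 31457283,
    69869762952464626546613449056847126, 70629408665738091438757538338833686, 31457283,
    69391701456585076129425069887849750, 31457283, 31457283, 69396772058981266676044724867040534,
    70791667947403008080603230706468118, 69874833554860817102240028412871958,
    70816600045784848388756610765423894, 31457283, 31457283, 70654340773791338303823549453960470,
    69874833554874984188177838466401558, 70791667932895898245227693494895894, 31457283,
    69874833554874984197184762843235606, 70978859327449765030606696884602134,
    69381560251787972660696103346373910, 70791667942567304802135930799523094,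
    70978859327449765030593515629970710, 69396772058990711400003264902726934,
    68547615281388502256721723966752022, 31457283, 31457283, 68547456979805978638719071111218454,
    31457283, 68547931884553549492727029287748886, 68547773582971025874724376302191894, 31457283,
    74584458678605318811607888411362462, 74899785064906564575563488394740894, 31457283,
    75826291014210573166929140613514398, 31457283, 31457283, 74904855667302755122183143373931678,
    75988550286204083251866595676521630, 74584458678600596445125156205102238,
    76328820378841437748547302375687326, 31457283, 31457283, 74904855667316922221631339992712350,
    76166561106847927663618634815767710, 74574317473808215342878921869886622, 31457283,
    75988550286204083251853414421890206, 76166561106847927663605453561136286,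
    74589529281010954082186083426239646, 75842042553189500936831093633582238,
    75988550276532676694945177117263006, 74904855667316922212624415615878302,
    73248202191905708242945428835927198, 31457283, 31457283, 73248360493488231860948081431413918,
    31457283, 73247885588740661006940123254883486, 73248202501390718064290497162249374, 31457283,
    81492247547388659899873951651857434, 80909088436742617625246497570423834, 31457283,
    81005478702539702765365911861068826, 31457283, 31457283, 80904017834336982345661378178712602,
    81167737984204619407211604228703258, 81492247552224363178332464055714842,
    78640538588277440967260665020548122, 31457283, 31457283, 80919229641539721084968539735065626,
    78645609190683076246845784412259354, 81492247552224363178323676552627226, 31457283,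
    81167737969697509571836067017131034, 78630397383480337507538622855906330,
    81005469721736723088162136661296154, 78640538588282163342750321603642394,
    81167737979368916128744304321758234, 80919229641530276361009999699379226,
    81540858978901006996592778715202586, 31457283, 31457283, 81378599706907496911664111155282970,
    31457283, 81378599706907496911650929900651546, 81054081153249070184876569973097498, 31457283,
    63702649285469051295538406479893890, 65791730879902789031918010055923074, 31457283,
    65599227783581017174523686236198274, 31457283, 65953990151896299116846677615842690, 31457283,
    63707719887865241842158061459084674, 65436968511587507089586231173191042,
    65791781928906382067244952082191746, 31457283, 65467212321408659026685137724511618, 31457283,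
    63707719887879408941606258077865346, 65954041210571298709090644449826178,
    63540553446649810012767875424851330, 65791730865395679196542472844350850, 31457283, 31457283,
    63545624049055445292352994816562562, 65923746342075147179760952319153538, 31457283,
    63545624049041278192904798197781890, 65467263380083658618915923303863682,
    63555765253847826385592304774944130, 63717861092676512401328300242507138, 31457283,
    65791781933742085345690283231417730, 65923746342075147179752164816065922, 31457283,
    90604602027600500276130875139686662, 91754824942878395281903853437845766, 31457283,
    90609984764381027291257551462990086, 31457283, 31457283, 90609984764381027291257551332966662,
    90604760638668033715478596451565830, 91917084224543311923749545805480198,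
    89788250079293695734165093032001798, 31457283, 31457283, 89788408535618724262840279985684742,
    90604760174440518983460993767047430, 91430306394055671833574824659517702, 31457283,
    90604760483925528804806062483439878, 89788408535618724262840280245731590,
    90609667851730970233907177425600774, 91754824947714098560349184587071750,
    89788408071391209530822677171142918, 90610142756478541087915135602131206,
    89831971965734376279997896028717318, 31457283, 31457283, 89826901363328741000412776637006086,
    31457283, 89842113170531479739719938193359110, 89831971965720209180549699409936646, 31457283,
    86415000000473640181900998651019790, 86187471571842278276967120194634254, 31457283,
    86674244590658748397684982951445006, 31457283, 31457283, 86511985318665238312756315391525390,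
    86349730843835788361904575257641486, 86252740718808723540055306283385358,
    84635253020059361952564803641934350, 31457283, 31457283, 84640323622460274865667190827385358,
    86739518549296363630216846174716430, 86349730843835788361891394003010062, 31457283,
    86739518539624957073308608870089230, 84640323622460274874674115204219406,
    86674244595494451676134707852214798, 86349730834164381804983156698382862,
    84640323622446107775225918585438734, 86187466765006811585973167960883726,
    85949133240560687370218331814625806, 31457283, 31457283, 85944062638155052090633212422914574,
    31457283, 85944062638169219190081409041695246, 85933921433362670997393902464533006, 31457283,
    69869762952464626546754186545071382, 68532284669268918752425696511001878, 31457283,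
    69391701456585076129284332399625494, 31457283, 31457283, 69396772058981266675903987378816278,
    68532443280336452191773417822881046, 69874833554860817102380765901096214,
    71127326719151317888178846498424086, 31457283, 31457283, 71127326719151317888174452746880278,
    69874833554874984188318575954625814, 68532442816108937459755815138362646, 31457283,
    69874833554874984197325500331459862, 71127326709479911331266215442253078,
    69381560251787972660555365858149654, 68532443125593947281100883854755094,
    70640548893499381076467031507862806, 69396772058990711399862527414502678,
    70791706320068550757389122857469206, 31457283, 31457283, 70629447048075040672460455297549590,
    31457283, 71116224864055570927259639231939862, 70953965592062060842335365423564054, 31457283,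
    74584458678605318811467150923138206, 74899785064906564575704225882965150, 31457283,
    73237798905587500044151824173892766, 31457283, 31457283, 74904855667302755122323880862155934,
    73237957207170023662154476769379486, 74584458678600596444984418716877982,
    76157363986078154098919052480218270, 31457283, 31457283, 74904855667316922221772077480936606,
    76319623258071664183847720040137886, 74574317473808215342738184381662366, 31457283,
    73237957207170023662154477159449758, 75832845442091133929048536105747614,
    74589529281010954082045345938015390, 76157363995749560655822896033301662,
    73237956897685013840809408443057310, 74904855667316922212765153104102558,
    76150862326298453256290321351967902, 31457283, 31457283, 76313121598291963341227776414975134,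
    31457283, 75826343782311433086428592480584862, 76150862335969859813211739911226526, 31457283,
    81492247547388659899733214163633178, 81222697566377659603559673881560090, 31457283,
    81005478702539702765506649349293082, 31457283, 31457283, 81060438294384149518622218818552858,
    81167737984204619407352341716927514, 81492247552224363178191726567490586,
    79605215134001945630404309489419290, 31457283, 31457283, 81547216110364679773421402752943130,
    79610285736407580909989428881130522, 81492247552224363178182939064402970, 31457283,
    81167737969697509571976804505355290, 79610285736393413810541232262349850,
    81005469721736723088021399173071898, 79610285736402858534499772298036250,
    81167737979368916128885041809982490, 81547216120036086330329640057570330,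
    80756999475795349394105287730922522, 31457283, 31457283, 80751928873399158847485632751731738,
    31457283, 80751928873384991748037436132951066, 80741787668592610645791201797735450, 31457283,
    90639911210471204270356370412667142, 89631006748587680543397492478574854, 31457283,
    89596022619748801952299932266791174, 31457283, 31457283, 89595864318166278334297279411257606,
    89631165359655213982745213790454022, 90644981812867394825982949768691974,
    90574643748548448317393837788365062, 31457283, 31457283, 90574485137480914878046116476485894,
    89631164895427699250727611105935622, 90644981812881561911920759822221574, 31457283,
    90644981812876839558948414181212422, 89596022310263792130954863680422150,
    90574643903290953228066371886514438, 89631165359655213982745214050500870,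
    89595547405516221276946905503891718, 90574168534315867642040811025465606,
    91753848988361297723107226107117830, 31457283, 31457283, 91916108260354807808035893667037446,
    31457283, 91429330444374277553236709732647174, 91753848988361297723094044852486406, 31457283,
    74899785214662255087503835599734050, 75821215300471147349226411144643874, 31457283,
    74584458828361009328051697804772642, 31457283, 31457283, 74584458828356286961568965598512418,
    74904855817058445643130414955758882, 75983474582136063991072103512278306,
    76004301670440501503772995350562082, 31457283, 31457283, 75842042398446991418835540287554850,
    75983474567628954155696566300706082, 74904855817072612729068225009288482, 31457283,
    74904855817072612738075149386122530, 76166560952105418145623081469740322,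
    74574317623563905859322731263296802, 75983474577300360712604803605333282,
    76166560952105418145609900215108898, 74589529430766644598629892819649826,
    73248207138830161957393484637930786, 31457283, 31457283, 73248365440412685575396137233417506,
    31457283, 73247890535665114721388179056887074, 73248048837247638339390831522350370, 31457283,
    86101231940614800710805845683864474, 86202687866577511851684451083092890, 31457283,
    86689456397407978126932123190428570, 31457283, 31457283, 86689456402243681405390635594285978,
    86096161338218610155179266327839642, 86364947138571021936621906146100122,
    84000165480936015519271278262485914, 31457283, 31457283, 83995094878539824972651623283295130,
    86364947138571021936608724891468698, 86111373145407181808548617830663066, 31457283,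
    86111373145416626532507157866349466, 84000165480940737876747086091912090,
    86689456402243681405381848091198362, 86364947128899615379700487586841498,
    83984953673737999137439924535559066, 86202678571756041315220308199867290,
    86733150730937894799800922416481178, 31457283, 31457283, 86570891458944384714872254856561562,
    31457283, 86570891458944384714859073601930138, 86246372914957364544997344730547098, 31457283,
    81477035740639430170767548901098126, 80909103306529751552063775759794830, 31457283,
    80990262407804469190507843484385934, 31457283, 31457283, 81152521689469385832353535852020366,
    80904032704124116272478656368083598, 81314776468645920085838881341178510,
    79127791787286824072791488909673102, 31457283, 31457283, 80919244511326855011785817924436622,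
    79132862389692459352376608301384334, 81477035745475133449217273801867918, 31457283,
    81152521674962275996977998640448142, 79117650582489720613069446745031310,
    80990257914987493359055733910536846, 79132862389692459361383532678218382,
    80919244511317410287827277888750222, 81152521684633682553886235945075342,
    81541349203170583532673401312379534, 31457283, 31457283, 81379089931177073447735946249372302,
    31457283, 81379089931177073447749127504003726, 81054571377518646720965980073362062, 31457283,
    69391701306829385612981260494439570, 69869762802708936034673101851853970, 31457283,
    70634484379477517256460267807704210, 31457283, 31457283, 70796743651471027341397722870711442,
    69874833405105126581292756831044754, 69396771909225576159600915473630354,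
    71141118754185784633530917790549138, 31457283, 31457283, 69874833405119293680740953449825426,
    70978859482192274548602250230629522, 69381560102032282144252293952963730, 31457283,
    70796743651471027341384541616080018, 70978859482192274548589068975998098,
    69396771909235020883559455509316754, 70654340928533847821819102799987858,
    69874833405119293671734029072991378, 70796743641799620784476304311452818,
    68547610334464048542273668164748434, 31457283, 31457283, 68547452032881524924271015309214866,
    31457283, 68547926937629095778278973485745298, 68547927247114105599624041942090898, 31457283,
    91572941700746488685672251116617990, 91419184596693155649158485528412422, 31457283,
    91905997847956410983026039106044166, 31457283, 31457283, 91743738575962900898097371546124550,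
    91581443868686665734095940591419654, 91410682419081572043826558748983558,
    90639920757216627581345801324331270, 31457283, 31457283, 90644991359612818127965456303522054,
    91581443868686665734082759336788230, 91897460249569212133988098640314630, 31457283,
    91735200963068592213692681371910406, 91905997852792114261475764006813958,
    90644991359617540503455112886616326, 91581443859015259177178915783704838,
    91419220022304474171314224115482886, 90644991359603373404006916267835654,
    89989318946576181260261121860174086, 31457283, 31457283, 89994389548981816539846241251885318,
    31457283, 89994389548967649440398044633104646, 90004530753778919999568283416527110, 31457283,
    74899785214662255087644573087958306, 73237803697769448847927345617700130, 31457283,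
    74584458828361009327910960316548386, 31457283, 31457283, 74584458828356286961428228110288162,
    74904855817058445643271152443983138, 73237962308836982287275066929579298,
    76319623113000561222764797750281506, 31457283, 31457283, 76157363841007051137827342687274274,
    73237961844609467555257464245060898, 74904855817072612729208962497512738, 31457283,
    74904855817072612738215886874346786, 76319623103329154665852166694110498,
    74574317623563905859181993775072546, 73237962154094477376602532961453346,
    75832845287348624411052982759720226, 74589529430766644598489155331425570,
    76145786617394730717041710535410978, 31457283, 31457283, 76308045889388240801979165598418210,
    31457283, 75821268073407710547179981664027938, 75983527345401220632121830478578978, 31457283,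
    86414999536246130047636265607758746, 86202687866577511851825188571317146, 31457283,
    86689456397407978126791385702204314, 31457283, 31457283, 86689456402243681405249898106061722,
    86252740254581213405790573240124314, 86364947138571021936762643634324378,
    84635252561120893069661990614598554, 31457283, 31457283, 84640323163517083616281645593789338,
    86364947138571021936749462379692954, 86739518085068853495952113131455386, 31457283,
    86739518075397446939043875826828186, 84640323163521805991771302176883610,
    86689456402243681405241110602974106, 86364947128899615379841225075065754,
    84640323163507638892323105558102938, 86202678571756041315079570711643034,
    85949132776338337294182467435103130, 31457283, 31457283, 85944062173942146747562812455912346,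
    31457283, 85944062173927979648114615837131674, 85933920969130876188392573672489882, 31457283,
    81477035740639430170626811412873870, 81222698030605169737824406924821134, 31457283,
    80990262407804469190648580972610190, 31457283, 31457283, 81152521689469385832494273340244622,
    81060438758611659652886951861813902, 81314776468645920085698143852954254,
    79605215592940414513307122516755086, 31457283, 31457283, 81547216574592189907686135796204174,
    79610286195346049792892241908466318, 81477035745475133449076536313643662, 31457283,
    81152521674962275997118736128672398, 79610286195331882693444045289685646,
    80990257914987493358914996422312590, 79610286195346049783885317531632270,
    81547216584263596464594373100831374, 81152521684633682554026973433299598,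
    80756999940017699470141152110445198, 31457283, 31457283, 80751929337612064190556032718733966,
    31457283, 80751929337626231290004229337514638, 80741788132824405454792530589778574, 31457283,
    69391701306829385612840523006215314, 69869762802708936034813839340078226, 31457283,
    68532279877086969948650175067194514, 31457283, 31457283, 68532438178669493566652827662681234,
    69874833405105126581433494319269010, 69396771909225576159460177985406098,
    70965067592228910764333101228360850, 31457283, 31457283, 69874833405119293680881690938049682,
    71127326864222420849261768788280466, 69381560102032282144111556464739474, 31457283,
    68532438178669493566652828052751506, 70640549048241890594462584853890194,
    69396771909235020883418718021092498, 71127326873893827406170006092907666,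
    69874833405119293671874766561215634, 68532437869184483745307759336359058,
    70796782028972273296637733674026130, 31457283, 31457283, 70634522756978763211709066114106514,
    31457283, 71121300572959293466508250048496786, 71121300582630700023425274856211602, 31457283,
    96789299162914380616670544281338118, 96571906987178446230378526217208070, 31457283,
    96896420424809178703693340232646918, 31457283, 96734166259171956315315981280215302, 31457283,
    96627039881249463974824851913703686, 97058679696802688788622007792566534,
    94862499606375397982536294306545926, 31457283, 97113817711737104064986391805034758, 31457283,
    96734166259171956315302800025583878, 94857429003974485069433907121094918,
    96333563554078628780501562055590150, 31457283, 96951558425236484144682187033542918, 31457283,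
    96328492951672993500916442663878918, 94867570208776310904645605868830982,
    97058684803158976485173316400054534, 31457283, 96328492951687160600364639282659590,
    94867570208762143805197409250050310, 96318351746880612407677132705497350, 31457283,
    96571901875986455255368705205862662, 97058679706474095345530245097193734, 31457283,
    94857414467991502512159890455527686, 95796898881455315150829291911381254, 31457283,
    95802281618221675066225897077473542, 31457283, 95797057492522848590177013223260422, 31457283,
    94862485070387693067786469811552518, 95802439919804198684228549933007110,
    94793409548920632498813828807917830, 31457283, 94862485070401860153724279865082118, 31457283,
    95797057028295333858159410538742022, 94793409703663137409486363166114054,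
    96784837311675735728899215153561862, 31457283, 94872626275198963626956708594974982, 31457283,
    96622578039682225643970547593642246, 94793409703663137409486362906067206,
    95797374095687895826182318934327558, 31457283, 97109355855662755898769731528032518,
    94792934334688051823460802045018374, 96947096583669245813845457719656710, 31457283,
    95801964705571618008875523040084230, 95802439610319188862883481216614662, 31457283,
    96946196905424736613283988911816966, 94823303612113754391771683035283718, 31457283,
    94788319468456532508575627863261446, 31457283, 97108456187089653255129681279451398, 31457283,
    94823462223181287831119404347162886, 94788319468456532508575627993284870,
    95006033609879422133556465675665670, 31457283, 94823461758953773099101801662644486, 31457283,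
    96621678356602013164954960133488902, 95005874998811888694208744363786502,
    95029310645304434381634482320310534, 31457283, 96946196919931846448646344868757766, 31457283,
    95034381247710069661219601712021766, 94788319158971522687230559276892422,
    94823778981088839977797244286402822, 31457283, 95019169440507330921912440155668742,
    94787844254223951833222601100361990, 95024240042917688567980291753640198, 31457283,
    95006192066204450662231652889395462, 95006191601976935930214049814806790, 31457283,
    95186663147779121578755776783450374, 96611481455232709962983156532904198, 31457283,
    97098294711322215060605685083799814, 31457283, 95181592545382931023129197427425542, 31457283,
    96773740727226220047920611595911430, 97098294706486511782147172679942406,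
    95029320998097427744701427730481414, 31457283, 96773740727226220047907430341280006, 31457283,
    95196804352571502676498548930248966, 95034391600493618291321082709672198,
    96601187518963129751694422047064326, 31457283, 95186663147779121565245390218199302, 31457283,
    96763446790956639836623089606983942, 97098294716157918339055409984569606,
    97098259271213240217782340467294470, 31457283, 96763446790956639836636270861615366,
    96611516885670278248893870093238534, 97087965334943660006497999732998406, 31457283,
    95019179793300324275972461189005574, 95034391600503063015279622745358598, 31457283,
    94990950113681883421328486145851654, 95791951797573919946184330444144902, 31457283,
    96946329521248325247094414786298118, 31457283, 95791793495991396328181677588611334, 31457283,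
    97108588802913241888940107153932550, 94991108724749416860676207457730822,
    95832054410463826544828402406654214, 31457283, 95792269019708986824879773067903238,
    94950424936657727065282251309187334, 95792110718126463206877120212369670, 31457283, 31457283,
    95837125012860017100454981762679046, 94950583547725260504629972621066502, 31457283,
    95837125012860017086944595197427974, 94990633355774331274650646206611718, 31457283,
    96621810972425601798778567262601478, 94950108178750174918604411369947398,
    96784070258926221719082772034093318, 95847266217652398198197753909477638, 31457283,
    94950425091400231975954785277313286, 94991108724749416860676207197683974, 31457283,
    96931087698382446917890121549611270, 95842185973013997489319753739010310, 31457283,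
    94710208701622929924025388439568646, 31457283, 95847256575410188044946333095035142, 31457283,
    94705138099226739368398809083543814, 97093346970375957002827576612618502,
    97064245479743039006617992555790598, 31457283, 95832044768221616396080443780628742,
    96931128240007288274972804873978118, 95837115370617806951707023136653574, 31457283, 31457283,
    96901986198078122364772300188156166, 97093387512000798359910259936985350, 31457283,
    96901986212585232200134656145096966, 96606569154395426748028392678228230, 31457283,
    94705138099212572282460999030014214, 96606609696020268105111076002595078,
    94694996894415468809228570300121350, 96577467649255398916443271409828102, 31457283,
    96931128249678694831894223433236742, 97093346980047363559744601420333318, 31457283,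
    96946355362188797506086487506419974, 94843590808301997974364855319527686, 31457283,
    94950424931977714311450176046629126, 31457283, 94843749109884521592367508175061254, 31457283,
    94950583543045247750797897358508294, 97108614643853714147932179874054406,
    94990950108992425934249205206352134, 31457283, 94843908030437064853060297943286022,
    94857390484422810346369250092253446, 94844066332019588471062950798819590, 31457283, 31457283,
    94991108720059959373596926518231302, 94862461086819000901995829448278278, 31457283,
    94990633351084873787571365267112198, 96621836813366074057770639982723334, 31457283,
    94950108174070162164772336107389190, 94862461086819000888485442883027206,
    94950266939880200514792591647441158, 94990950573219940666266807890870534, 31457283,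
    94862461086809556164526902847340806, 97108614643853714147940967377142022, 31457283,
    94710180050080968883442967797694726, 94872592842042868766272782814544134, 31457283,
    96931128240012015113670841847906566, 31457283, 94867522239646678210646203458519302, 31457283,
    97093387512005525198608296910913798, 94705109447684778327816388441669894,
    96931087698377729023340944525099270, 31457283, 94862451637250487673033472856162566,
    97063112455092605197520488102232326, 94857381034854297117406893500137734, 31457283, 31457283,
    97093346970371239108278399588106502, 96900853173427688555674795734597894, 31457283,
    96606569154390708853479215653716230, 94705109447670611241878578388140294, 31457283,
    96606609696024994943809112976523526, 96900853187934798391037151691538694,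
    96768868968018505028750961791074566, 96931087698377729023354125779730694, 31457283,
    96576334634276371664262791763984646, 94694968242882952501611614070767878, 31457283,
    81355311276873651482494169518310822, 78645598977521471763787904389875110, 31457283,
    80555143122898136701141577243952550, 31457283, 81517570548867161567422837078230438, 31457283,
    78640528375125281208161325033850278, 80555143277640641611814111472125350,
    80550077458199352448804854322955686, 31457283, 78640528375125281221671711599101350, 31457283,
    81030792718379521477261297186899366, 80549919156616828830802201467422118,
    78567328836056024646481649036559782, 31457283, 78630387170332900114922015075468710, 31457283,
    78567487137638548264484301892093350, 80550077612941857359477388811175334,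
    81193051985537328283731452342961574, 31457283, 78567011768663462678458740640974246,
    80549602243966771773451827560056230, 78567169915503481385788859268335014, 31457283,
    80555143277640641611814111732172198, 80554667908665556025788550481053094, 31457283,
    69067361351408065968227874825835266, 70989303054296869005532647175492354, 31457283,
    69229774097602946587377613001724674, 31457283, 71151562326290379090470102238499586, 31457283,
    69072431953804256523854454181860098, 69234844699999137133997267980915458,
    70943474523859913850972858078204674, 31457283, 70664784510309848835670918304109314, 31457283,
    69057220146615684870485102679036674, 71105733795853423935901525638124290,
    70827022583926103223516494800753410, 70989303054296869005545828430123778, 31457283, 31457283,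
    70664763311932593138579039737746178, 69219632892796398394690106424562434, 31457283,
    71151541127913123393378223672136450, 70618955965365783845739985746793218,
    70989281855919613308436374857585410, 69062290749011875430615144223478530, 31457283,
    70943474509352804015606108369720066, 69229774097588779496936340759778050, 31457283,
    65919626167359901051696301480215446, 64166936686068158004302689593328534, 31457283,
    64692861266164415660638524963816342, 31457283, 64166778384485634386300036997841814, 31457283,
    65757366885694984409850609112581014, 64687790663758780381053405572105110,
    63388132968322616037729970669355926, 31457283, 64166777920258119654282433923253142, 31457283,
    65757366900202094245212965069521814, 63393203570718806593356550025380758,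
    65624303202489092788756172322767766, 64166461317093072418277128732279702, 31457283, 31457283,
    65462043920824176146910479955133334, 64687790663772947480501602190885782, 31457283,
    65948821751311816237072019846464406, 63377991763530234939987198522557334,
    65786562464811196316767815074972566, 65432848341707964239975698986566550, 31457283,
    63388132968332060775198897270293398, 64677649458971121645289903443149718, 31457283,
    79132851712303193000043638490793382, 81193036680985072585688600700650918, 31457283,
    80555143122898136701000839755728294, 31457283, 79127781109907002453423983511602598, 31457283,
    81030777399320155943842908333016486, 80555143277640641611673373983901094,
    80550077458199352448945591811179942, 31457283, 81517555229807796034004448224347558, 31457283,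
    79127781109907002439913596946351526, 80549919156616828830942938955646374,
    79038740885726856098180658607818150, 31457283, 81355295943307176113700243452855718, 31457283,
    79038582584144332480178005752284582, 80550077612941857359618126299399590,
    79117639905114621342170824799552934, 31457283, 79039057953119418066203567003403686,
    80549602243966771773592565048280486, 79038899806279399358873448376042918, 31457283,
    80555143277640641611673374243947942, 80554667908665556025647812992828838, 31457283,
    70821819520741458603068705609093890, 69224703689833200203137099581625090, 31457283,
    71110957747930314441098930174563074, 31457283, 69219633087437009656517444602434306, 31457283,
    70659560248747948518140038049174274, 70948698475936804356161475111555842,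
    69072432068662822173804660877693698, 31457283, 69234844894625581309886796105257730, 31457283,
    71146338064728478772939221983564546, 69067361466266631618178081521668866,
    70984052951789788019041332426576642, 69224703689833200216647486146876162, 31457283, 31457283,
    71146312223783298103978787489583874, 70948698461429694520799119154615042, 31457283,
    70659534407802767849179603555193602, 69067361466252464532240271468139266,
    70821793679796277934121452369744642, 70984078792734968688014948175188738, 31457283,
    69057220261460083429994037132923650, 70624179917442674350932996531688194, 31457283,
    64126406397108321471528781461193622, 65919650158794986986959055561556886, 31457283,
    64692861266164415660779262452040598, 31457283, 65757390886801476902021600498549654, 31457283,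
    64126247786040788032181060149314454, 64687790663758780381194143060329366,
    63388132968322616037589233181131670, 31457283, 65757390872294367066659244541608854, 31457283,
    64126248250268302764198663223903126, 63393203570718806593215812537156502,
    65747576483419423042079332191306646, 65432872328307346896784334415594390, 31457283, 31457283,
    65909835765084339683925024558941078, 64687790663772947480642339679110038, 31457283,
    65423057934596699593763484667610006, 63377991763530234939846461034333078,
    65585317221097319514067689439101846, 64125931182875740796175754958341014, 31457283,
    63388132968332060775058159782069142, 64677649458971121645430640931373974, 31457283,
    64166941478250106816936155883373586, 65914550772777186751285595492975634, 31457283,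
    63393203410994209650443360974013458, 31457283, 65752291500783676666348140429968402, 31457283,
    64166782867182573377588434571494418, 63388132808588574370858241582302226,
    64687790813821415491008101269898258, 31457283, 65752291486276566830985784473027602, 31457283,
    64166783331410088109606037646083090, 64692861416217606046634680625923090,
    65624298390964473680435916291834898, 65427772937453843382656755694699538, 31457283, 31457283,
    65462039118970963595507248731915282, 64677649609029034393265329123099666, 31457283,
    65948816949458603685668788623246354, 63388132808602741470306438201082898,
    65624298405471583515811453503407122, 64166466264017526141583129380520978, 31457283,
    64687790813830860228477027870835730, 63377991603800915635094739453346834, 31457283,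
    73907390252986944801721381422371202, 76019816009813111158912774788354434, 31457283,
    73940992641479214852255637035028866, 31457283, 75857556737819601073984107228434818, 31457283,
    73907548864054478241069102734250370, 73935922039083024296629057679004034,
    74019131875494878515746837849444738, 31457283, 76344334553800131328783291162825090, 31457283,
    73907073495079392655043541873201538, 74018973264427345076399116537565570,
    74054274644098249285868516727591298, 76182075281806621243859017354449282, 31457283, 31457283,
    74054116342515725667865864132104578, 74018973728654859808416719222083970, 31457283,
    74054591247263296521873822308635010, 73935922039068857210691247625474434,
    74054274644098249285868517117661570, 73907232260889431005063797543276930, 31457283,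
    74018656816004802751066345314718082, 73925780834276476108445013290258818, 31457283,
    65914584348576170600062967275979794, 64126401604926372370665213897344018, 31457283,
    63393203410994209650302623485789202, 31457283, 64126243303343848752662561301857298, 31457283,
    65752325066911253958217274908345362, 63388132808588574370717504094077970,
    64687790813821415491148838758122514, 31457283, 64126242839116334020644958227268626, 31457283,
    65752325081418363793579630865286162, 64692861416217606046775418114147346,
    65747581294944032927309026344174610, 64125926081208781873967118678098962, 31457283, 31457283,
    65909840566937543012237693904094226, 64677649609029034393406066611323922, 31457283,
    65423062736449902922076154012763154, 63388132808602741470165700712858642,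
    65747581280436923091933489132602386, 65427806522924233788342364782330898, 31457283,
    64687790813830860228617765359059986, 63377991603800915634954001965122578, 31457283,
    74181237492246836101210189775245698, 74422546519738857068040263175508354, 31457283,
    76182233592895121455469044231836034, 31457283, 74427617122135047623666842531533186, 31457283,
    74181396103314369540557911087124866, 76344492864888631540397711791755650,
    74394351453186627830243001633083778, 31457283, 74412405314946475970297491028709762, 31457283,
    74180920734339283954532350226076034, 74394192842119094390895280321204610,
    74221921121530220218556454248386946, 74417475917342666530427532573151618, 31457283, 31457283,
    74221762819947696600553801652900226, 74394193306346609122912883005723010, 31457283,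
    74221762819947696600553801262829954, 75857715034400991450236171900424578,
    74221446216782649364548496071856514, 74181079500149322304552605896151426, 31457283,
    74393876393696552065562509098357122, 76182233578388011620102294523351426, 31457283,
    86385190247511584882955825021322666, 84000150315867860385245289557132714, 31457283,
    85580115039753855593678623402624426, 31457283, 83995079713471669838625634577941930, 31457283,
    86222930965846668241110132653688234, 85579956738171331975675970547090858,
    85585180704452639846015346323621290, 31457283, 86709708796334308331271672545019306, 31457283,
    83995079713471669825115248012690858, 85585180859195144756687880551794090,
    83921884971268945294766537282028970, 31457283, 83984938508679288731875938054309290, 31457283,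
    83922043272851468912769190137562538, 85580115194496360504351157890844074,
    86547449509833688410967467773527466, 31457283, 83921567749133878416071094658270634,
    83921726050716402034073747513804202, 31457283, 85585180859195144756687880811840938,
    85579639825521274918325596639724970, 85584705490220059170662319560721834, 31457283,
    84487403050649581612494099281216938, 86547434205281432712924616131216810, 31457283,
    85580115039753855593819360890848682, 31457283, 86709693477274942797853283691136426, 31457283,
    84482332448253391056867519925192106, 85579956738171331975816708035315114,
    85585180704452639845874608835397034, 31457283, 84482332448253391070377906490443178, 31457283,
    86222915646787302707691743799805354, 85585180859195144756547143063569834,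
    84393297020939776746465546853287338, 31457283, 86547434190774322877549078919644586, 31457283,
    84393138719357253128462893997753770, 85580115194496360504491895379068330,
    84472191243461009963628209966810538, 31457283, 84393614243074843625160989477045674,
    84393455941492320007158336621512106, 31457283, 85585180859195144756547143323616682,
    85579639825521274918466334127949226, 85584705490220059170521582072497578, 31457283]
  | _ => [
    73393253401972437170193185607124126, 81522697445065494003846124190958618,
    68844289382636366523035675923711254, 86395388045929303288722216789869070,
    68844289382787334667527715907831062, 86719906599578142320273062270992910,
    81198179046154151591951800928961562, 73393253406959108606654540635309214,
    91592592253517640992578717188751622, 68844289377952221689383157005157654,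
    91917110652428697479939897952698630, 73393253392452441493136759568073886,
    81198178581927079581791966871028762, 86070869337524096618327444218315278,
    91268073545112434322183944617197830, 73393253411795254588956427853890718,
    81198179200878209758550625739736090, 73393253406959698893457699817784478,
    91592592253503773652721306033324294, 86395387581702088316295811482911246,
    68844289368280667563017133826901270, 80873660492486870428013264323609626,
    91592591634552643475962647164616966, 86395388200653218493054470351618574,
    68844289387623480658836802112718102, 65630948891130748416957629233239426,
    65955467599526662540025270618166658, 65306430492228698552390437157868930,
    65630949510100177763837407977149826, 65468690233276115653728413359150466,
    75355270522972109830852976064988318, 79451839127019891408669864334853146,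
    70005309326051273827083872293225750, 84811941843063266365477722005832206,
    70005304683927242234359395190441238, 84801795686501288000439463304102414,
    79456904777660651796431974019761178, 75355265261878058595438778124469406,
    91553149278751782294932834398634246, 70005323871997851157753789270852886,
    91877504424325023347156841595797766, 75355280117158530020002064029058206,
    79456919632941123220995272406598682, 84806886095942829484112256182649358,
    91228487124048798459674927940632838, 75355280117158530020001531453113502,
    79436637223337471550571325692183578, 75355284759433677340177832907768990,
    91552683813297010992090209816281350, 84811951746583585260205939223560718,
    70005319229722703837577887248155926, 79446783379899454527295602687083546,
    91553317638597125088776559658402054, 84791669336979933589781992509145614,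
    70005319229722703837577354672211222, 64610488949573702615407329683051906,
    64610488959244814019915584234722690, 64610488939902000924095915948905858,
    64610488949573112319596971514271106, 64610488944284504585144337531540866,
    68687259004954886412295156879459474, 81527768042630703642993994152149646,
    73550283779653917280933704651375906, 86390317448364093649574346828678042,
    86714835847275150136935527592625050, 73550283774969182151470827564041506,
    68687259014777261122711428979098770, 81203249798457143775289335607329422,
    91406270376753158616795033326977286, 73550283779805475721236102804276514,
    91243694187273888205201017883984134, 81203249179492289220939836832219790,
    68687258995434890735238730840409234, 86065798894696669523369238974301082,
    91892731294590741640752931415654662, 81203249798443419397698495700927118,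
    68687259014777703831058399126226066, 68687259005106444861604754018665618,
    91568514798301900560267649663500550, 73550283765298218320915162554565922,
    86390316984136878677147941521720218, 80878730935314297522971469567623822,
    91567900780042415011651299697885446, 73550283784641031416734830840382754,
    86390317603088008853906600390427546, 65960533250167418455726148486043010,
    65636014541771504332658507101115778, 65636015160740933679538285845026178,
    65311496142869454468091315025745282, 65798274128099438059927938460423554,
    70167568912370219382802448390423698, 79452314945720104271331142821610126,
    75193010936653164275134399967790370, 84811466024363053502816443519075226,
    84806390470201988055384171495949210, 75193006294529132682410056008992034,
    70167563651276168147388117305918610, 79452309993959951741487265827914382,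
    90574661834838293782413074615369990, 75193025482599741605804183801431330,
    90574344922334630086040455534215430, 79457395451641336083656550893355662,
    70167578506556639571951536354493586, 84801339674841703703844991017288602,
    90574344922353519551954341929025798, 79437113042037684413232604178940558,
    70167578506556639571951003778548882, 70167583148831786892127438377190546,
    90574661834994131444006606726365446, 75193020840324594285628414922720546,
    84811475927883372397544660736803738, 79452329801000580307562867852444302,
    90574028009694017905766610678186246, 75193020840324594285627882346775842,
    84791193518279720727120714022388634, 64610325396412401216683621399008642,
    64610325386741289812175366847337858, 64610325386740699516365008678557058,
    64610325377069588120863953113191810, 64610325391123203199931427726955906,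
    14012557328680428554459186769440773, 14063689183798272937767420754931717,
    12278733155615144045589518629744645, 12907576888208411533956805328121861,
    13338162088217026203194345711480837, 12044163167027299309024593192693765,
    12738345685193337750348595269742597, 11452219872417165789973042539540485,
    11572414107537323865116587646791685, 12278718300334672621307707693477893,
    13577228265960703451770740030320645, 12739142768656926182944935783182341,
    13662670738794318729842179543937029, 12044163167026865810539264745156613,
    13886351666726727602620054505009157, 12907898902964749685277629681774597,
    11572414107537028717211537545637893, 13688038774724492739255243503054853,
    12907735359035679957290608214159365, 12739142783012920002638143646347269,
    12263506493131933868489742976823301, 12738345694411396692564853385605125,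
    11572414107537310030058944681488389, 12907582004821507315538363737976837,
    12044163167027313144082781216190469, 12908052262000458506321256897851397,
    13404961351290066422543342165831685, 12739142777723869830054792036626437,
    11462346221938520200480988477272069, 13363525173279570336348672751054853,
    81148426526240042910833654880142758, 63809181203818719159856063509037974,
    70823087757581772795863227443843842, 73398968734618528890482042519815458,
    63809181194147460185898818908324758, 71147606311230611827414072924967682,
    81472791575333598245818386293589414, 73398963627964751110836859086964002,
    86557647163312553166027098777846286, 70498569203914348669658119589466882,
    63809181194147460167884420935713686, 80823596011691716281732023162373542,
    86557647472802128556530410616652302, 91754851216163108334701408315375878,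
    70823087757562901776675822572540674, 63809181184476496341832355419390870,
    91754851525652683725204720154181894, 73398983280413990493700002001585442,
    91592591629854045626619381827371270, 86395387577003490457945072289841678,
    70660828016520488354667840087134978, 91268073230947278007255338534174982,
    80985548279391186861948964423468454, 86070869332829930590240413745021454,
    63809181198530258990348820082197398, 91917110338264113014077576865775878,
    80986182104691300976086762821649830, 86719906440146765597062652076622350,
    73398978637685495991168760067261730, 73398978019319939258285937205052706,
    79265643230287468085404686069400998, 64813007385640902309750513491641238,
    69828138355436512575743760789803778, 75335134108544512088330927612232994,
    64813012182658554540599345013719958, 69828138365258887277152833903137538,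
    79265643230287615659225196907333030, 75335134113228952074392225108329762,
    84305674039490756345934780500673038, 69828138345916664459129125813490434,
    64813012801628574183288932707468182, 79265643230287615659348891961263526,
    84310739690131502898647631130657294, 91730145148702246396353497952289030,
    69828138356040975467536676867674882, 64813027192681530875834894697759638,
    91730298653267117792233309721723142, 75335134113380658079640013817120034,
    91568059183478532977052469076295942, 84310759497172136076413649360650766,
    69828138351205419776541548324721410, 91243847638949849029221825154253062,
    79265643230287910807398931962660262, 84310754545411983546569772366955022,
    64813027346970688604151818565583766, 91892884746266702482225187241984262,
    79265643230287910806835982026016166, 84310754545411965099843290843447822,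
    75335134112927163332339137723368738, 75335134113531626242146451773850914,
    81001220136212126936592571898660262, 74221003222835258453267469979619714,
    63800471468703918627950909938861074, 86552576561062755961926748010054554,
    74221003222835263060449880198091138, 63800476265721570858799741460939794,
    80838807354818042194913368163354022, 86390317593723122600724500265960346,
    68693449721078455798765636670326038, 63800476884691590501489329154688018,
    74221003222835263078464278690795906, 81488002918459924158999731294569894,
    68693444459833288835899747521922326, 89473217102323665984644293360877830,
    63800491430487052104707688068416530, 74221003222835276904515126132478338,
    89473217102323661237850281821602054, 68693464421465306585204301867648278,
    89473217102323665687406730843521286, 86552576251582902005550281104950170,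
    63800491430033704922352215012803602, 89473217102323652149586238091297030,
    81163652724646840248156086205547942, 68693459624145422899452354217772310,
    74221003222835276472169574789812610, 89473217102323670019869559497425158,
    81163018899346726134018287807366566, 68693459005779866166569531355563286,
    86065798730580133386140062977229722, 86714835837896968392962301308830618,
    78778865859356908454278696083260838, 75154627706340237199674828611129730,
    64777823790225343447431777441940498, 83818896223656619451681930785981338,
    75154944619136687617985365695533442, 64777823780554084473474532841227282,
    78778865859357056028086425098519974, 83823961874297370616076401796842394,
    70142362345262118217069486093239574, 64777823780554084455460134868616210,
    75154310793855462969216095924785538, 78778865859357056027962730044589478,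
    70142362350097673930582612101956886, 90729458393653574974525510848610566,
    64777823770883120624904469859140626, 75154469250624393947272233569751426,
    90729458398338014960586808344707334, 70142362349947148480926743785506070,
    90729458398488983096071649342521606, 83823981681337994570479179265082266,
    64777823784936883277924534015099922, 90729458407707337627545575004569862,
    78778865859357351175577775770830246, 70142362349644769461077696204375318,
    75154469250624393514939863481717122, 90729458408311210241542530886271238,
    78778865859357351176140725707474342, 70142362350249232370885010254857494,
    83823976729577846652316922652263322, 83823976729577828205590441128756122,
    63966528175144955668138280494433298, 70665894286131245475313176535241474,
    86178464257847736446203060103021994, 81203249793758545907939918643069582,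
    86015893020128623175989406768170410, 70503634699817322050167727580386050,
    63966528174842871782683613518234642, 81527768037936537605908285907665550,
    73561227856558843986731603494831262, 86665088583770505140075769899386282,
    63966528174842871800698011490845714, 71152671807133585207923680915886850,
    73561223059692307483334596324623518, 91715106550495839201297736713765126,
    70665893667161244279367112795230978, 91714938190650496394365425036951814,
    86177845287828093756206348029265322, 80878730930620131485885761323139726,
    63966528174541083058644924105884690, 91715567064190453371485723466006790,
    86340738389957421229232124810364330, 91715245199780239181762186436804870,
    73561237914519431725542409173599390, 81527768037936966492707999654740622,
    73561237296153874992659586311390366, 91228630777377784753198752300663046,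
    70828153408203657701375095280636674, 63966528160487320405624859949925394,
    73561242557247926228073651107923102, 81203249174793691353590419867959950,
    64975266817359013940284241421141010, 69827975097262998617804274770776834,
    84290610054849664526764418072184234, 79275636607691939096815726577713806,
    84290610054849812100712884571604394, 69827975092578706214702765803180802,
    64975272078301949448246615009788946, 79280702258332694872909409618625166,
    75178103735547619542107895099425950, 84290610054849812100589189517673898,
    64975271459331929805557027316040722, 69827975111920929032726473892827906,
    75178103740534290965058451648152734, 90599539328272652108672335297773830,
    69827975097867461527611588821259010, 90599380872249854746674827398349062,
    84290610054850107248762924573001130, 79280717113613170909141134649459342,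
    64975286469052674685888928296338450, 90600014696945505807457471133253894,
    84290610054850107248204235243914666, 90599697784446564333452533621457158,
    75178103740081386504560734736876702, 79280717113613152462414653125952142,
    75178103740685849414368048787358878, 90599856241210773089140989697065222,
    69827975102703017218606717364212482, 64975286469506021868244401351951378,
    75178103740534881251861610830627998, 79280722065373323438985011643155086,
    74053678759578784389686196945031554, 63962730900431474991450377150399382,
    86355776421478247189737933887374762, 68855708843018770895015197645341842,
    86680299926896831053257114900366762, 63962736161374410499412750739047318,
    74053678759578789280595387974422914, 68855703891560845208397484759581842,
    81198179191508748703839567875277850, 86031104363254949089170751769150890,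
    74053678759578788704134652850868610, 63962735542404390856723163045299094,
    81360438158857531650102375556973594, 89954929127414016639215547850424582,
    63962750706867640647727460949033878, 89954929127414011748306352530260230,
    86355949733083747142413469811344810, 68855718900979358633826003324109970,
    74053678759578802674300688364212610, 89954929127414030032920839658668294,
    86193056630954419669387693030245802, 89954929127414020669937214363795718,
    80873660328370334281785410555347994, 68855718282613801900943180461900946,
    81522697435687169288607648886948890, 89954929127414025439249206855860486,
    63962750552578482919410537081209750, 74053678759578802687811487233741186,
    81360437849373102901195628683068442, 68855723698299242319577950973985938,
    75154791883316558660537129412071810, 64944995053703348733575593877177238,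
    83803832683919104895646949301159338, 69985331972265225670846453580432530,
    83803832683919252469326722654930346, 64944995053401264848120926900978582,
    75154791883458229943249196873683330, 69985331977403012821248838641779858,
    78788858791857802202562876863022106, 83803832683919252469450417708860842,
    75154791883458229366806036756304258, 64944995053401264866135324873589654,
    78793924442498562590338180284810266, 90729939487784943845193208675434758,
    64944995053099476119578637995475862, 90729939492469236257301916629336326,
    83803832683919547616941768381171114, 69985331976798992633299293217883282,
    75154791883902131960302175389225346, 90729939497909254853600759729619206,
    83803832683919547617500457710257578, 90729939507278282386165145784549638,
    78793939297779034014888284934767642, 69985331977403455543106607268365458,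
    78793939297779015568161803411260442, 90729939497758139144163329189609734,
    64944995039045713471062173332669334, 75154316514941213473725223061164418,
    78793944249539181933050541547586586, 69985331977101371653148340799014034]

set_option maxRecDepth 100000

theorem tailDigits_eq : ∀ i < 4, tailDigits i = (tailGens i).map digits := by decide +kernel

theorem checkAll_start : checkAll checkStart
    (addSorted 16 (addSorted 15 (addSorted 14 (addSorted 13 [[]])))) startCerts = true := by
  decide +kernel

theorem checkAll_systems_one : checkAll checkSystem (systems 1) (systemCerts 1) = true := by
  decide +kernel

theorem checkAll_systems_two : checkAll checkSystem (systems 2) (systemCerts 2) = true := by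
  decide +kernel

theorem checkAll_systems_three : checkAll checkSystem (systems 3) (systemCerts 3) = true := by
  decide +kernel

theorem checkAll_systems_four : checkAll checkSystem (systems 4) (systemCerts 4) = true := by
  decide +kernel

theorem checkAll_systems_five : checkAll checkSystem (systems 5) (systemCerts 5) = true := by
  decide +kernel

end Search

section Soundness

/-- The class of a point of the partition of 23 points into classes of sizes 12, `11 - k`, `k`. -/
def cls (k i : ℕ) : ℕ := if i < 12 then 0 else if i < 23 - k then 1 else 2

/-- A code of minimum weight 8 with the all-one word on the first 12 points and with words
that meet the other points exactly in any two given points of the same class. -/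
structure Good (k : ℕ) (F : Submodule (ZMod 2) (Fin 23 → ZMod 2)) : Prop where
  base : vec 23 4095 ∈ F
  orth : ∀ v ∈ F, ∀ w ∈ F, v ⬝ᵥ w = 0
  min : ∀ v ∈ F, v ≠ 0 → 8 ≤ wt v
  pair : ∀ i j : Fin 23, i ≠ j → cls k i = cls k j → cls k i ≠ 0 →
    ∃ v ∈ F, v i ≠ 0 ∧ v j ≠ 0 ∧ ∀ l, l ≠ i → l ≠ j → 12 ≤ l.1 → v l = 0

theorem cls_eq_zero {k i : ℕ} : cls k i = 0 ↔ i < 12 := by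
  unfold cls; split_ifs <;> simp_all

theorem cls_eq_one {k i : ℕ} (h : 12 ≤ i) (h' : i < 23 - k) : cls k i = 1 := by
  rw [cls, if_neg (not_lt.mpr h), if_pos h']

theorem testBit_4095 (i : ℕ) : (4095).testBit i = decide (i < 12) := by
  rw [show 4095 = 2 ^ 12 - 1 by norm_num, Nat.testBit_two_pow_sub_one]

theorem vec_comp {n a b : ℕ} {σ : Equiv.Perm (Fin n)}
    (h : ∀ i : Fin n, a.testBit (σ i) = b.testBit i) : vec n a ∘ σ = vec n b := by
  funext i
  simp only [Function.comp_apply, vec, h]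

theorem vec_comp_swap {n a b : ℕ} {p q : Fin n} (hp : a.testBit q = b.testBit p)
    (hq : a.testBit p = b.testBit q)
    (h : ∀ i : Fin n, i ≠ p → i ≠ q → a.testBit i = b.testBit i) :
    vec n a ∘ Equiv.swap p q = vec n b := by
  refine vec_comp fun i => ?_
  rcases eq_or_ne i p with rfl | hip
  · rw [Equiv.swap_apply_left, hp]
  · rcases eq_or_ne i q with rfl | hiq
    · rw [Equiv.swap_apply_right, hq]
    · rw [Equiv.swap_apply_of_ne_of_ne hip hiq, h i hip hiq]

theorem Good.pull {k : ℕ} {F : Submodule (ZMod 2) (Fin 23 → ZMod 2)} (h : Good k F)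
    {σ : Equiv.Perm (Fin 23)} (hσ : ∀ i, cls k (σ i) = cls k i) : Good k (pull σ F) where
  base := by
    have : vec 23 4095 ∘ σ = vec 23 4095 := vec_comp fun i => by
      rw [testBit_4095, testBit_4095, decide_eq_decide, ← cls_eq_zero (k := k), hσ, cls_eq_zero]
    rw [← this]
    exact comp_mem_pull.mpr h.base
  orth v hv w hw := by
    rw [← dot_comp σ.symm]
    exact h.orth _ hv _ hw
  min v hv h0 := by
    rw [← wt_comp σ.symm]
    refine h.min _ hv fun h' => h0 ?_
    funext i
    simpa using congrFun h' (σ i)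
  pair i j hij hc h0 := by
    obtain ⟨v, hv, hi, hj, hl⟩ := h.pair (σ i) (σ j) (σ.injective.ne hij)
      (by rw [hσ, hσ, hc]) (by rwa [hσ])
    refine ⟨v ∘ σ, comp_mem_pull.mpr hv, hi, hj, fun l hli hlj h12 => hl _
      (σ.injective.ne hli) (σ.injective.ne hlj) ?_⟩
    rw [← not_lt, ← cls_eq_zero (k := k)] at h12 ⊢
    rwa [hσ]

theorem testBit_mkWord (b p c i : ℕ) :
    (mkWord b p c).testBit i = (c.testBit i ^^ (decide (b = i) ^^ decide (p = i))) := by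
  change (c ^^^ (1 <<< b ^^^ 1 <<< p)).testBit i = _
  rw [Nat.testBit_xor, Nat.testBit_xor, Nat.one_shiftLeft, Nat.one_shiftLeft, Nat.testBit_two_pow,
    Nat.testBit_two_pow]

theorem mkWord_lt {b p c n : ℕ} (hb : b < n) (hp : p < n) (hc : c < 2 ^ n) :
    mkWord b p c < 2 ^ n := by
  change c ^^^ (1 <<< b ^^^ 1 <<< p) < 2 ^ n
  rw [Nat.one_shiftLeft, Nat.one_shiftLeft]
  exact Nat.xor_lt_two_pow hc (Nat.xor_lt_two_pow (Nat.pow_lt_pow_right one_lt_two hb)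
    (Nat.pow_lt_pow_right one_lt_two hp))

theorem testBit_of_lt {c n i : ℕ} (hc : c < 2 ^ n) (hi : n ≤ i) : c.testBit i = false :=
  Nat.testBit_lt_two_pow (hc.trans_le (Nat.pow_le_pow_right two_pos hi))

theorem mem_halves {c : ℕ} : c ∈ halves ↔ c < 2 ^ 12 ∧ c.testBit 0 = true ∧ pop c = 6 := by
  have : Nat.land c 1 = c % 2 := Nat.and_one_is_mod c
  rw [halves, List.mem_filter, List.mem_range, Bool.and_eq_true, Nat.beq_eq, Nat.beq_eq, this,
    Nat.testBit_zero, decide_eq_true_eq]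
  rfl

theorem zmod_cast_eq_zero {n : ℕ} : (n : ZMod 2) = 0 ↔ Nat.beq (Nat.land n 1) 0 = true := by
  have : Nat.land n 1 = n % 2 := Nat.and_one_is_mod n
  rw [Nat.beq_eq, this, ZMod.natCast_eq_zero_iff, Nat.dvd_iff_mod_eq_zero]

theorem vec_ne {n a i : ℕ} (hi : i < n) (ha : a.testBit i = true) : vec n a ≠ 0 := fun h => by
  have := congrFun h ⟨i, hi⟩
  simp [vec, ha] at this

variable {k : ℕ} {F : Submodule (ZMod 2) (Fin 23 → ZMod 2)}

theorem Good.compl_mem (h : Good k F) {m : ℕ} (hm : vec 23 m ∈ F) : vec 23 (4095 ^^^ m) ∈ F := by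
  rw [vec_xor]
  exact add_mem h.base hm

theorem Good.le_pop (h : Good k F) {m i : ℕ} (hm : m < 2 ^ 23) (hF : vec 23 m ∈ F) (hi : i < 23)
    (h1 : m.testBit i = true) : 8 ≤ pop m := by
  rw [← wt_vec (by norm_num) hm]
  exact h.min _ hF (vec_ne hi h1)

theorem pop_mkWord {b p c : ℕ} (hb : 12 ≤ b) (hp : 12 ≤ p) (hbp : b ≠ p) (hb' : b < 23)
    (hp' : p < 23) (hc : c < 2 ^ 12) : pop (mkWord b p c) = pop c + 2 := by
  have hc' : c < 2 ^ 24 := hc.trans (by norm_num)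
  rw [pop_eq (mkWord_lt (by omega) (by omega) hc'), pop_eq hc']
  have h : ∀ i ∈ Finset.range 24, ((mkWord b p c).testBit i).toNat = (c.testBit i).toNat +
      ((if b = i then 1 else 0) + if p = i then 1 else 0) := fun i _ => by
    rw [testBit_mkWord]
    rcases lt_or_ge i 12 with hi | hi
    · simp [show b ≠ i by omega, show p ≠ i by omega]
    · rw [testBit_of_lt hc hi]
      rcases eq_or_ne b i with rfl | h1
      · simp [hbp.symm]
      · by_cases h2 : p = i <;> simp [h1, h2]
  rw [Finset.sum_congr rfl h, Finset.sum_add_distrib, Finset.sum_add_distrib, Finset.sum_ite_eq,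
    Finset.sum_ite_eq, if_pos (Finset.mem_range.mpr (by omega)),
    if_pos (Finset.mem_range.mpr (by omega))]

theorem pop_compl {c : ℕ} (hc : c < 2 ^ 12) : pop (4095 ^^^ c) + pop c = 12 := by
  rw [pop_eq ((Nat.xor_lt_two_pow (by norm_num) hc).trans (by norm_num : 2 ^ 12 < 2 ^ 24)),
    pop_eq (hc.trans (by norm_num)), ← Finset.sum_add_distrib,
    show (12 : ℕ) = ∑ i ∈ Finset.range 24, if i < 12 then 1 else 0 by decide]
  refine Finset.sum_congr rfl fun i _ => ?_
  rw [Nat.testBit_xor, testBit_4095]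
  split_ifs with h
  · cases c.testBit i <;> simp [h]
  · simp [h, testBit_of_lt hc (not_lt.mp h)]

theorem compl_mkWord (b p c : ℕ) : 4095 ^^^ mkWord b p c = mkWord b p (4095 ^^^ c) :=
  (Nat.xor_assoc _ _ _).symm

theorem Good.pop_eq_six (h : Good k F) {b p c : ℕ} (hb : 12 ≤ b) (hp : 12 ≤ p) (hbp : b ≠ p)
    (hb' : b < 23) (hp' : p < 23) (hc : c < 2 ^ 12) (hF : vec 23 (mkWord b p c) ∈ F) :
    pop c = 6 := by
  have key : ∀ c < 2 ^ 12, vec 23 (mkWord b p c) ∈ F → 6 ≤ pop c := fun c hc hF => by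
    have := h.le_pop (i := b) (mkWord_lt hb' hp' (hc.trans (by norm_num))) hF hb' (by
      simp [testBit_mkWord, testBit_of_lt hc hb, hbp.symm])
    rw [pop_mkWord hb hp hbp hb' hp' hc] at this
    omega
  have h1 := key c hc hF
  have h2 := key (4095 ^^^ c) (Nat.xor_lt_two_pow (by norm_num) hc)
    (by rw [← compl_mkWord]; exact h.compl_mem hF)
  have h3 := pop_compl hc
  omega

theorem Good.exists_half (h : Good k F) {b p : ℕ} (hbp : b ≠ p) (hb' : b < 23) (hp' : p < 23)
    (hc : cls k p = cls k b) (h0 : cls k b ≠ 0) : ∃ c ∈ halves, vec 23 (mkWord b p c) ∈ F := by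
  have hb : 12 ≤ b := by rwa [← not_lt, ← cls_eq_zero (k := k)]
  have hp : 12 ≤ p := by rwa [← not_lt, ← cls_eq_zero (k := k), hc]
  obtain ⟨v, hv, hvb, hvp, hl⟩ := h.pair ⟨b, hb'⟩ ⟨p, hp'⟩ (by simpa using hbp) hc.symm h0
  obtain ⟨m, -, rfl⟩ := exists_vec v
  have hlt : m % 2 ^ 12 < 2 ^ 12 := Nat.mod_lt _ (by norm_num)
  have hm : vec 23 (mkWord b p (m % 2 ^ 12)) = vec 23 m := by
    funext i
    have key : (mkWord b p (m % 2 ^ 12)).testBit i = m.testBit i := by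
      rw [testBit_mkWord, Nat.testBit_mod_two_pow]
      rcases lt_or_ge i.1 12 with hi | hi
      · simp [show b ≠ i by omega, show p ≠ i by omega, hi]
      · rw [vec_ne_zero] at hvb hvp
        rcases eq_or_ne b i with rfl | h1
        · simpa [hbp.symm, hi] using hvb
        · rcases eq_or_ne p i with rfl | h2
          · simpa [h1, hi] using hvp
          · have := hl i (fun h => h1 (by rw [h])) (fun h => h2 (by rw [h])) hi
            simp only [vec, ite_eq_right_iff, one_ne_zero, imp_false, Bool.not_eq_true] at this
            simp [h1, h2, this]
    simp only [vec, key]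
  rw [← hm] at hv
  have h6 := h.pop_eq_six hb hp hbp hb' hp' hlt hv
  by_cases ho : (m % 2 ^ 12).testBit 0 = true
  · exact ⟨_, mem_halves.mpr ⟨hlt, ho, h6⟩, hv⟩
  · refine ⟨4095 ^^^ (m % 2 ^ 12), mem_halves.mpr ⟨Nat.xor_lt_two_pow (by norm_num) hlt, ?_, ?_⟩,
      ?_⟩
    · rw [Nat.testBit_xor, testBit_4095]
      simpa using ho
    · have := pop_compl hlt
      omega
    · rw [← compl_mkWord]; exact h.compl_mem hv

theorem Good.okWord (h : Good k F) {rows : List ℕ} (hlt : ∀ r ∈ rows, r < 2 ^ 23)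
    (hF : ∀ r ∈ rows, vec 23 r ∈ F) {w p : ℕ} (hw : w < 2 ^ 23) (hwF : vec 23 w ∈ F) (hp : 12 ≤ p)
    (hp' : p < 23) (hwp : w.testBit p = true) (hr : ∀ r ∈ rows, r.testBit p = false) :
    okWord rows w = true := by
  rw [SD.okWord, List.all_eq_true]
  intro r hrm
  have hx : vec 23 (r ^^^ w) ∈ F := by rw [vec_xor]; exact add_mem (hF r hrm) hwF
  have hxl : r ^^^ w < 2 ^ 23 := Nat.xor_lt_two_pow (hlt r hrm) hw
  rw [Bool.and_eq_true, Bool.and_eq_true, Nat.ble_eq, Nat.ble_eq, ← zmod_cast_eq_zero]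
  refine ⟨?_, h.le_pop hxl hx hp' ?_, h.le_pop (Nat.xor_lt_two_pow (by norm_num) hxl)
    (h.compl_mem hx) hp' ?_⟩
  · exact (dot_vec (by norm_num) (hlt r hrm)).symm.trans (h.orth _ (hF r hrm) _ hwF)
  · change (r ^^^ w).testBit p = true
    rw [Nat.testBit_xor, hr r hrm, hwp]; rfl
  · change (4095 ^^^ (r ^^^ w)).testBit p = true
    rw [Nat.testBit_xor, testBit_4095, Nat.testBit_xor, hr r hrm, hwp]
    simp [hp]

/-- After a permutation that preserves the classes, the code contains one of the given systems of
words. -/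
def Reaches (k : ℕ) (F : Submodule (ZMod 2) (Fin 23 → ZMod 2)) (n : ℕ)
    (states : List (List ℕ)) : Prop :=
  ∃ rows ∈ states, (∀ r ∈ rows, r < 2 ^ n) ∧
    ∃ σ : Equiv.Perm (Fin 23), Good k (SD.pull σ F) ∧ ∀ r ∈ rows, vec 23 r ∈ SD.pull σ F

theorem forced_eq {α : Type} (n : ℕ) (f : ℕ → α) : forced n f = f n := by cases n <;> rfl

theorem Good.swap_mem (h : Good k F) {b p q : ℕ} (hbp : b ≠ p) (hbq : b ≠ q)
    (hp : p < 23) (hq : q < 23) (hp' : 12 ≤ p) (hpq : cls k q = cls k p) :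
    Good k (SD.pull (Equiv.swap ⟨p, hp⟩ ⟨q, hq⟩) F) ∧
      (∀ c < 2 ^ 12, vec 23 (mkWord b q c) ∈ F →
        vec 23 (mkWord b p c) ∈ SD.pull (Equiv.swap ⟨p, hp⟩ ⟨q, hq⟩) F) ∧
      (∀ c < 2 ^ 12, vec 23 (mkWord b p c) ∈ F →
        vec 23 (mkWord b q c) ∈ SD.pull (Equiv.swap ⟨p, hp⟩ ⟨q, hq⟩) F) ∧
      ∀ m, m.testBit p = m.testBit q → vec 23 m ∈ F →
        vec 23 m ∈ SD.pull (Equiv.swap ⟨p, hp⟩ ⟨q, hq⟩) F := by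
  have hq' : 12 ≤ q := by rwa [← not_lt, ← cls_eq_zero (k := k), hpq, cls_eq_zero, not_lt]
  refine ⟨h.pull fun i => ?_, fun c hc hF => ?_, fun c hc hF => ?_, fun m hm hF => ?_⟩
  · rcases eq_or_ne i ⟨p, hp⟩ with rfl | hip
    · rw [Equiv.swap_apply_left, hpq]
    · rcases eq_or_ne i ⟨q, hq⟩ with rfl | hiq
      · rw [Equiv.swap_apply_right, hpq]
      · rw [Equiv.swap_apply_of_ne_of_ne hip hiq]
  · rw [← vec_comp_swap (a := mkWord b q c) (p := ⟨p, hp⟩) (q := ⟨q, hq⟩)]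
    · exact comp_mem_pull.mpr hF
    · simp [testBit_mkWord, testBit_of_lt hc hp', testBit_of_lt hc hq', hbp, hbq]
    · simp only [testBit_mkWord, testBit_of_lt hc hp', testBit_of_lt hc hq', hbp, hbq, eq_comm]
    · intro i hi hj
      rw [Ne, Fin.ext_iff] at hi hj
      simp [testBit_mkWord, Ne.symm hi, Ne.symm hj]
  · rw [← vec_comp_swap (a := mkWord b p c) (p := ⟨p, hp⟩) (q := ⟨q, hq⟩)]
    · exact comp_mem_pull.mpr hF
    · simp only [testBit_mkWord, testBit_of_lt hc hp', testBit_of_lt hc hq', hbp, hbq, eq_comm]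
    · simp [testBit_mkWord, testBit_of_lt hc hp', testBit_of_lt hc hq', hbp, hbq]
    · intro i hi hj
      rw [Ne, Fin.ext_iff] at hi hj
      simp [testBit_mkWord, Ne.symm hi, Ne.symm hj]
  · rw [← vec_comp_swap (a := m) (b := m) (p := ⟨p, hp⟩) (q := ⟨q, hq⟩) hm.symm hm
      fun _ _ _ => rfl]
    exact comp_mem_pull.mpr hF

theorem Good.half_ne (h : Good k F) {b p q c d : ℕ} (hp : p < 23) (hq : q < 23) (hpq : p ≠ q)
    (hc : vec 23 (mkWord b p c) ∈ F) (hd : vec 23 (mkWord b q d) ∈ F) : c ≠ d := by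
  rintro rfl
  have hF := add_mem hc hd
  rw [← vec_xor] at hF
  have hbit : ∀ i, (mkWord b p c ^^^ mkWord b q c).testBit i =
      (decide (p = i) ^^ decide (q = i)) := fun i => by
    rw [Nat.testBit_xor, testBit_mkWord, testBit_mkWord]
    cases c.testBit i <;> cases decide (b = i) <;> simp
  have h8 := h.min _ hF (vec_ne hp (by simp [hbit, hpq.symm]))
  have h2 : wt (vec 23 (mkWord b p c ^^^ mkWord b q c)) ≤
      ({⟨p, hp⟩, ⟨q, hq⟩} : Finset (Fin 23)).card := by
    refine Finset.card_le_card fun i hi => ?_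
    rw [Finset.mem_filter, vec_ne_zero, hbit] at hi
    simp only [Finset.mem_insert, Finset.mem_singleton, Fin.ext_iff]
    by_contra! hcon
    simp [hcon.1.symm, hcon.2.symm] at hi
  have := Finset.card_le_two (a := (⟨p, hp⟩ : Fin 23)) (b := ⟨q, hq⟩)
  omega

theorem addSorted_sound (hk : k ≤ 5) {p : ℕ} (hp : 13 ≤ p) (hp' : p < 18) {states : List (List ℕ)}
    (h : Reaches k F p states) : Reaches k F (p + 1) (addSorted p states) := by
  classical
  obtain ⟨rows, hrows, hlt, σ, hG, hR⟩ := h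
  have hex : ∃ c, c ∈ halves ∧ ∃ σ : Equiv.Perm (Fin 23), Good k (SD.pull σ F) ∧
      (∀ r ∈ rows, vec 23 r ∈ SD.pull σ F) ∧ vec 23 (mkWord 12 p c) ∈ SD.pull σ F := by
    obtain ⟨c, hc, hm⟩ := hG.exists_half (b := 12) (p := p) (by omega) (by omega) (by omega)
      (by rw [cls_eq_one (by omega) (by omega), cls_eq_one (by omega) (by omega)])
      (by rw [Ne, cls_eq_zero]; omega)
    exact ⟨c, hc, σ, hG, hR, hm⟩
  obtain ⟨hc, τ, hG, hR, hm⟩ := Nat.find_spec hex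
  have hmin := fun c => Nat.find_min hex (m := c)
  generalize Nat.find hex = c at hc hm hmin
  rw [mem_halves] at hc
  obtain ⟨hc12, hc0, hc6⟩ := hc
  have hlt23 : ∀ r ∈ rows, r < 2 ^ 23 := fun r hr =>
    (hlt r hr).trans_le (Nat.pow_le_pow_right two_pos (by omega))
  have hmlt : mkWord 12 p c < 2 ^ (p + 1) :=
    mkWord_lt (by omega) (by omega) (hc12.trans_le (Nat.pow_le_pow_right two_pos (by omega)))
  have hok : SD.okWord rows (mkWord 12 p c) = true :=
    hG.okWord hlt23 hR (hmlt.trans_le (Nat.pow_le_pow_right two_pos (by omega))) hm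
      (p := p) (by omega) (by omega)
      (by simp [testBit_mkWord, testBit_of_lt hc12 (show 12 ≤ p by omega), show 12 ≠ p by omega])
      fun r hr => testBit_of_lt (hlt r hr) le_rfl
  have hsort : isSorted rows c = true := by
    rw [isSorted, List.all_eq_true]
    intro i hi
    rw [List.mem_range] at hi
    by_contra hcon
    simp only [Bool.or_eq_true, Bool.not_eq_true', List.any_eq_true, bne_iff_ne, not_or,
      Bool.not_eq_true, Bool.not_eq_false, not_exists, not_and, ne_eq, not_not] at hcon
    obtain ⟨⟨h0, h1⟩, h2⟩ := hcon
    have hi0 : i ≠ 0 := fun h => by rw [h, hc0] at h0; exact absurd h0 (by decide)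
    have hbit : ∀ j, (c ^^^ (3 <<< i)).testBit j =
        (c.testBit j ^^ (decide (i = j) || decide (i + 1 = j))) := fun j => by
      rw [Nat.testBit_xor, Nat.testBit_shiftLeft]
      congr 1
      rcases lt_trichotomy j i with h | h | h
      · simp [show ¬ i ≤ j by omega, show i ≠ j by omega, show i + 1 ≠ j by omega]
      · simp [h]
      · rcases eq_or_ne (i + 1) j with rfl | h'
        · simp [show Nat.testBit 3 1 = true from rfl]
        · rw [testBit_of_lt (n := 2) (by norm_num) (show 2 ≤ j - i by omega)]
          simp [h', show i ≠ j by omega]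
    have hc'12 : c ^^^ (3 <<< i) < 2 ^ 12 := by
      refine Nat.xor_lt_two_pow hc12 ?_
      rw [Nat.shiftLeft_eq]
      calc 3 * 2 ^ i ≤ 3 * 2 ^ 10 := Nat.mul_le_mul_left _ (Nat.pow_le_pow_right two_pos (by omega))
        _ < 2 ^ 12 := by norm_num
    have hless : c ^^^ (3 <<< i) < c := by
      refine Nat.lt_of_testBit (i + 1) ?_ h1 fun j hj => ?_
      · simp [hbit, h1]
      · simp [hbit, show i ≠ j by omega, show i + 1 ≠ j by omega]
    let s : Equiv.Perm (Fin 23) := Equiv.swap ⟨i, by omega⟩ ⟨i + 1, by omega⟩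
    have hG' : Good k (SD.pull s (SD.pull τ F)) := hG.pull fun j => by
      rcases eq_or_ne j ⟨i, by omega⟩ with rfl | hip
      · rw [Equiv.swap_apply_left]
        exact (cls_eq_zero.mpr (by simp; omega)).trans (cls_eq_zero.mpr (by simp; omega)).symm
      · rcases eq_or_ne j ⟨i + 1, by omega⟩ with rfl | hiq
        · rw [Equiv.swap_apply_right]
          exact (cls_eq_zero.mpr (by simp; omega)).trans (cls_eq_zero.mpr (by simp; omega)).symm
        · rw [Equiv.swap_apply_of_ne_of_ne hip hiq]
    have hm' : vec 23 (mkWord 12 p (c ^^^ (3 <<< i))) ∈ SD.pull s (SD.pull τ F) := by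
      rw [← vec_comp_swap (a := mkWord 12 p c) (p := ⟨i, by omega⟩) (q := ⟨i + 1, by omega⟩)]
      · exact comp_mem_pull.mpr hm
      · simp [testBit_mkWord, hbit, h0, h1, show 12 ≠ i by omega, show p ≠ i by omega,
          show 12 ≠ i + 1 by omega, show p ≠ i + 1 by omega]
      · simp [testBit_mkWord, hbit, h0, h1, show 12 ≠ i by omega, show p ≠ i by omega,
          show 12 ≠ i + 1 by omega, show p ≠ i + 1 by omega]
      · intro j hj hj'
        rw [Ne, Fin.ext_iff] at hj hj'
        simp [testBit_mkWord, hbit, Ne.symm hj, Ne.symm hj']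
    refine hmin _ hless ⟨mem_halves.mpr ⟨hc'12, ?_, ?_⟩, s.trans τ, hG', ?_, hm'⟩
    · simp [hbit, hc0, hi0]
    · exact hG'.pop_eq_six (by omega) (by omega) (by omega) (by omega) (by omega) hc'12 hm'
    · intro r hr
      rw [← vec_comp_swap (a := r) (b := r) (p := ⟨i, by omega⟩) (q := ⟨i + 1, by omega⟩)
        (h2 r hr).symm (h2 r hr) fun _ _ _ => rfl]
      exact comp_mem_pull.mpr (hR r hr)
  refine ⟨mkWord 12 p c :: rows, ?_, ?_, τ, hG, ?_⟩
  · rw [addSorted, List.mem_flatMap]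
    refine ⟨rows, hrows, List.mem_map.mpr ⟨c, List.mem_filter.mpr
      ⟨mem_halves.mpr ⟨hc12, hc0, hc6⟩, ?_⟩, rfl⟩⟩
    rw [hok, hsort]; rfl
  · exact List.forall_mem_cons.mpr ⟨hmlt, fun r hr => (hlt r hr).trans_le
      (Nat.pow_le_pow_right two_pos (by omega))⟩
  · exact List.forall_mem_cons.mpr ⟨hm, hR⟩

theorem extend_sound {b n : ℕ} (hb : b < n) (hn : n ≤ 23) (h12 : 12 ≤ n) (hb0 : cls k b ≠ 0) :
    ∀ (cs ps rows : List ℕ) (F : Submodule (ZMod 2) (Fin 23 → ZMod 2)), Good k F →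
      (∀ r ∈ rows, r < 2 ^ n) → (∀ r ∈ rows, vec 23 r ∈ F) →
      (∀ p ∈ ps, p < n ∧ p ≠ b ∧ cls k p = cls k b ∧ ∀ r ∈ rows, r.testBit p = false) →
      ps.Nodup → (∀ p ∈ ps, ∃ c ∈ cs, c < 2 ^ 12 ∧ vec 23 (mkWord b p c) ∈ F) →
      Reaches k F n (extend b cs ps rows) := by
  have hb12 : 12 ≤ b := by rwa [← not_lt, ← cls_eq_zero (k := k)]
  have refl : ∀ (rows : List ℕ) (F : Submodule (ZMod 2) (Fin 23 → ZMod 2)), Good k F →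
      (∀ r ∈ rows, r < 2 ^ n) → (∀ r ∈ rows, vec 23 r ∈ F) → Reaches k F n [rows] :=
    fun rows F hG hlt hR => ⟨rows, List.mem_singleton_self _, hlt, Equiv.refl _, hG, hR⟩
  intro cs
  induction cs with
  | nil =>
    intro ps rows F hG hlt hR _ _ hc
    cases ps with
    | nil => rw [extend]; exact refl rows F hG hlt hR
    | cons p ps => exact absurd (hc p List.mem_cons_self) (by simp)
  | cons c cs ih =>
    intro ps rows F hG hlt hR hps hnd hc
    cases ps with
    | nil => rw [extend]; exact refl rows F hG hlt hR
    | cons p ps =>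
      rw [extend, forced_eq]
      obtain ⟨hpn, hpb, hpc, hpr⟩ := hps p List.mem_cons_self
      have hp12 : 12 ≤ p := by rw [← not_lt, ← cls_eq_zero (k := k), hpc]; exact hb0
      by_cases hu : ∃ q ∈ p :: ps, c < 2 ^ 12 ∧ vec 23 (mkWord b q c) ∈ F
      · obtain ⟨q, hq, hc12, hqF⟩ := hu
        obtain ⟨hqn, hqb, hqc, hqr⟩ := hps q hq
        obtain ⟨hG', hs, hs', hm⟩ := hG.swap_mem hpb.symm hqb.symm (hpn.trans_le hn)
          (hqn.trans_le hn) hp12 (hqc.trans hpc.symm)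
        have hw := hs c hc12 hqF
        generalize Equiv.swap (⟨p, hpn.trans_le hn⟩ : Fin 23) ⟨q, hqn.trans_le hn⟩ = s
          at hG' hw hm hs hs'
        have hR' : ∀ r ∈ rows, vec 23 r ∈ SD.pull s F := fun r hr =>
          hm r ((hpr r hr).trans (hqr r hr).symm) (hR r hr)
        have hwlt : mkWord b p c < 2 ^ n :=
          mkWord_lt hb hpn (hc12.trans_le (Nat.pow_le_pow_right two_pos h12))
        have hok : SD.okWord rows (mkWord b p c) = true :=
          hG'.okWord (fun r hr => (hlt r hr).trans_le (Nat.pow_le_pow_right two_pos hn)) hR'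
            (hwlt.trans_le (Nat.pow_le_pow_right two_pos hn)) hw hp12 (hpn.trans_le hn)
            (by simp [testBit_mkWord, testBit_of_lt hc12 hp12, hpb.symm]) hpr
        rw [List.nodup_cons] at hnd
        obtain ⟨rows', hmem, hlt', σ, hσ⟩ := ih ps (mkWord b p c :: rows) (SD.pull s F) hG'
          (List.forall_mem_cons.mpr ⟨hwlt, hlt⟩) (List.forall_mem_cons.mpr ⟨hw, hR'⟩)
          (fun x hx => by
            obtain ⟨h1, h2, h3, h4⟩ := hps x (List.mem_cons_of_mem _ hx)
            refine ⟨h1, h2, h3, List.forall_mem_cons.mpr ⟨?_, h4⟩⟩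
            have hx12 : 12 ≤ x := by rw [← not_lt, ← cls_eq_zero (k := k), h3]; exact hb0
            have : p ≠ x := fun h => hnd.1 (h ▸ hx)
            simp [testBit_mkWord, testBit_of_lt hc12 hx12, h2.symm, this]) hnd.2
          (fun x hx => by
            obtain ⟨h1, h2, h3, h4⟩ := hps x (List.mem_cons_of_mem _ hx)
            have hx12 : 12 ≤ x := by rw [← not_lt, ← cls_eq_zero (k := k), h3]; exact hb0
            have hpx : p ≠ x := fun h => hnd.1 (h ▸ hx)
            have hd : ∃ d ∈ c :: cs, d < 2 ^ 12 ∧ vec 23 (mkWord b x d) ∈ SD.pull s F := by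
              rcases eq_or_ne x q with rfl | hxq
              · obtain ⟨d, hd, hd12, hdF⟩ := hc p List.mem_cons_self
                exact ⟨d, hd, hd12, hs' d hd12 hdF⟩
              · obtain ⟨d, hd, hd12, hdF⟩ := hc x (List.mem_cons_of_mem _ hx)
                refine ⟨d, hd, hd12, hm _ ?_ hdF⟩
                have hq12 : 12 ≤ q := by
                  rw [← not_lt, ← cls_eq_zero (k := k), hqc]; exact hb0
                simp [testBit_mkWord, testBit_of_lt hd12 hp12, testBit_of_lt hd12 hq12, hpb.symm,
                  hqb.symm, hpx.symm, hxq]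
            obtain ⟨d, hd, hd'⟩ := hd
            rcases List.mem_cons.mp hd with rfl | hd
            · exact absurd rfl (hG'.half_ne (hpn.trans_le hn) (h1.trans_le hn) hpx hw hd'.2)
            · exact ⟨d, hd, hd'⟩)
        exact ⟨rows', by rw [hok]; exact List.mem_append_left _ hmem, hlt', σ.trans s, hσ⟩
      · have hc' : ∀ q ∈ p :: ps, ∃ d ∈ cs, d < 2 ^ 12 ∧ vec 23 (mkWord b q d) ∈ F :=
          fun q hq => by
            obtain ⟨d, hd, hd'⟩ := hc q hq
            rcases List.mem_cons.mp hd with rfl | hd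
            · exact absurd ⟨q, hq, hd'⟩ hu
            · exact ⟨d, hd, hd'⟩
        obtain ⟨rows', hmem, h⟩ := ih (p :: ps) rows F hG hlt hR hps hnd hc'
        refine ⟨rows', ?_, h⟩
        cases SD.okWord rows (mkWord b p c)
        · exact hmem
        · exact List.mem_append_right _ hmem

theorem extendAll_sound {b n : ℕ} (hb : b < n) (hn : n ≤ 23) (h12 : 12 ≤ n) (hb0 : cls k b ≠ 0)
    (hG : Good k F) {rows : List ℕ} (hlt : ∀ r ∈ rows, r < 2 ^ n) (hR : ∀ r ∈ rows, vec 23 r ∈ F)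
    {ps : List ℕ} (hnd : ps.Nodup)
    (hps : ∀ p ∈ ps, p < n ∧ p ≠ b ∧ cls k p = cls k b ∧ ∀ r ∈ rows, r.testBit p = false) :
    Reaches k F n (extendAll b rows ps) := by
  cases ps with
  | nil => exact ⟨rows, List.mem_singleton_self _, hlt, Equiv.refl _, hG, hR⟩
  | cons p ps =>
    refine extend_sound hb hn h12 hb0 _ _ _ F hG hlt hR hps hnd fun q hq => ?_
    obtain ⟨hpn, hpb, hpc, hpr⟩ := hps p List.mem_cons_self
    obtain ⟨hqn, hqb, hqc, hqr⟩ := hps q hq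
    have hp12 : 12 ≤ p := by rw [← not_lt, ← cls_eq_zero (k := k), hpc]; exact hb0
    obtain ⟨c, hc, hcF⟩ := hG.exists_half hqb.symm (hb.trans_le hn) (hqn.trans_le hn) hqc hb0
    have hc12 := (mem_halves.mp hc).1
    refine ⟨c, List.mem_filter.mpr ⟨hc, ?_⟩, hc12, hcF⟩
    obtain ⟨hG', hs, -, hm⟩ := hG.swap_mem hpb.symm hqb.symm (hpn.trans_le hn) (hqn.trans_le hn)
      hp12 (hqc.trans hpc.symm)
    exact hG'.okWord (fun r hr => (hlt r hr).trans_le (Nat.pow_le_pow_right two_pos hn))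
      (fun r hr => hm r ((hpr r hr).trans (hqr r hr).symm) (hR r hr))
      (mkWord_lt (hb.trans_le hn) (hpn.trans_le hn) (hc12.trans (by norm_num))) (hs c hc12 hcF)
      hp12 (hpn.trans_le hn) (by simp [testBit_mkWord, testBit_of_lt hc12 hp12, hpb.symm]) hpr

theorem systems_sound (hk : 1 ≤ k) (hk' : k ≤ 5) (hG : Good k F)
    (hR : ∀ r ∈ rowsStart, vec 23 r ∈ F) : Reaches k F 23 (systems k) := by
  have hstart : ∀ r ∈ rowsStart, r < 2 ^ 17 := by decide
  obtain ⟨rows, hmem, hlt, σ, hσ, hσR⟩ := extendAll_sound (b := 12) (n := 23 - k) (by omega)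
    (by omega) (by omega) (by rw [Ne, cls_eq_zero]; omega) hG
    (fun r hr => (hstart r hr).trans_le (Nat.pow_le_pow_right two_pos (by omega))) hR
    (ps := List.range' 17 (6 - k)) List.nodup_range' fun p hp => by
      rw [List.mem_range'_1] at hp
      refine ⟨by omega, by omega, ?_, fun r hr => testBit_of_lt (hstart r hr) hp.1⟩
      rw [cls_eq_one (by omega) (by omega), cls_eq_one (by omega) (by omega)]
  obtain ⟨rows', hmem', hlt', σ', hσ'⟩ := extendAll_sound (b := 23 - k) (n := 23) (by omega)
    le_rfl (by omega) (by rw [Ne, cls_eq_zero]; omega) hσ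
    (fun r hr => (hlt r hr).trans_le (Nat.pow_le_pow_right two_pos (by omega))) hσR
    (ps := List.range' (24 - k) (k - 1)) List.nodup_range' fun p hp => by
      rw [List.mem_range'_1] at hp
      refine ⟨by omega, by omega, ?_, fun r hr => testBit_of_lt (hlt r hr) (by omega)⟩
      simp only [cls]
      split_ifs <;> omega
  exact ⟨rows', List.mem_flatMap.mpr ⟨rows, hmem, hmem'⟩, hlt', σ'.trans σ, hσ'⟩

end Soundness

section Checks

/-- The sum (exclusive or) of `acc` and the members of a list selected by `g`. -/
def xorSel : List Bool → List ℕ → ℕ → ℕ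
  | b :: g, a :: q, acc => xorSel g q (bif b then a ^^^ acc else acc)
  | _, _, acc => acc

theorem pick_eq (g : List Bool) : ∀ (q : List ℕ) (acc : ℕ) (f : ℕ → Bool),
    pick g q acc f = f (xorSel g q acc) := by
  induction g with
  | nil => intro q acc f; rfl
  | cons b g ih =>
    intro q acc f
    cases q with
    | nil => rfl
    | cons a q =>
      cases b with
      | false => exact ih q acc f
      | true => exact (forced_eq (a ^^^ acc) fun x => pick g q x f).trans (ih q _ f)

theorem vec_xorSel (n : ℕ) {m : ℕ} (g : Fin m → Bool) : ∀ (a : Fin m → ℕ) (acc : ℕ),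
    vec n (xorSel (List.ofFn g) (List.ofFn a) acc) =
      vec n acc + ∑ i, if g i then vec n (a i) else 0 := by
  induction m with
  | zero => intro a acc; simp [xorSel]
  | succ m ih =>
    intro a acc
    rw [List.ofFn_succ, List.ofFn_succ, xorSel, ih, Fin.sum_univ_succ, ← add_assoc]
    cases g 0
    · simp
    · simp [vec_xor, add_comm (vec n acc)]

theorem powers_eq (n : ℕ) : ∀ (m : ℕ) (l : List ℕ), (∀ a ∈ l, ∃ e, a = 2 ^ e) →
    ∃ l' : List ℕ, (∀ a ∈ l', ∃ e, a = 2 ^ e) ∧ l'.length = l.length + n ∧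
      ∀ {α : Type} (f : List ℕ → α), powers n m l f = f l' := by
  induction n with
  | zero => intro m l hl; exact ⟨l, hl, rfl, fun _ => rfl⟩
  | succ n ih =>
    intro m l hl
    obtain ⟨l', h1, h2, h3⟩ := ih (m >>> 5) ((1 <<< (m &&& 31)) :: l)
      (List.forall_mem_cons.mpr ⟨⟨_, Nat.one_shiftLeft _⟩, hl⟩)
    refine ⟨l', h1, ?_, fun f => ?_⟩
    · rw [h2, List.length_cons]; omega
    · exact (forced_eq (1 <<< (m &&& 31)) fun a => forced (m >>> 5) fun m =>
        powers n m (a :: l) f).trans ((forced_eq (m >>> 5) fun x =>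
          powers n x ((1 <<< (m &&& 31)) :: l) f).trans (h3 f))

theorem digits_eq (m : ℕ) : digits m = List.ofFn fun i : Fin 23 => m.testBit (Fin.rev i) := by
  refine List.ext_getElem (by rw [digits, List.length_map, List.length_range, List.length_ofFn])
    fun i h1 h2 => ?_
  rw [List.getElem_ofFn]
  simp only [digits, List.getElem_map, List.getElem_range, Fin.val_rev]
  congr 1
  omega

theorem withPerm_sound {c : ℕ} {f : List ℕ → Bool} (h : withPerm c f = true) :
    ∃ q : List ℕ, f q = true ∧ ∃ σ : Equiv.Perm (Fin 23),
      ∀ m, vec 23 (xorSel (digits m) q 0) = vec 23 m ∘ σ := by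
  obtain ⟨q, hq, hlen, heq⟩ := powers_eq 23 c [] (by simp)
  rw [withPerm, heq, pick_eq] at h
  cases hb : Nat.beq (xorSel (List.replicate 23 true) q 0) 8388607
  · rw [hb] at h; exact absurd h Bool.false_ne_true
  rw [hb] at h
  refine ⟨q, h, ?_⟩
  have hlen : q.length = 23 := by simpa using hlen
  obtain ⟨a, rfl⟩ : ∃ a : Fin 23 → ℕ, q = List.ofFn a :=
    ⟨fun i => q[i], List.ext_getElem (hlen.trans (List.length_ofFn).symm) fun i _ _ => by
      rw [List.getElem_ofFn]; rfl⟩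
  choose e he using fun i => hq (a i) (List.mem_ofFn.mpr ⟨i, rfl⟩)
  have hvec : ∀ (g : Fin 23 → Bool) (b : Fin 23), vec 23 (xorSel (List.ofFn g) (List.ofFn a) 0) b =
      ∑ i, if e i = b then (if g i then 1 else 0) else 0 := fun g b => by
    rw [vec_xorSel, vec_zero, zero_add, Finset.sum_apply]
    refine Finset.sum_congr rfl fun i _ => ?_
    rw [he]
    cases g i
    · simp
    · simp [vec, Nat.testBit_two_pow]
  have hall : ∀ b : Fin 23, ∃ i, e i = b := fun b => by
    by_contra! hcon
    have h1 := hvec (fun _ => true) b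
    rw [List.ofFn_const, Nat.eq_of_beq_eq_true hb, Finset.sum_eq_zero fun i _ => if_neg (hcon i),
      vec, show 8388607 = 2 ^ 23 - 1 by norm_num, Nat.testBit_two_pow_sub_one] at h1
    simp at h1
  choose r hr using hall
  have hinj : Function.Injective r := fun x y hxy => by
    rw [Fin.ext_iff, ← hr, ← hr, hxy]
  have hbij := Finite.injective_iff_bijective.mp hinj
  refine ⟨(Equiv.ofBijective r hbij).trans Fin.revPerm, fun m => ?_⟩
  funext b
  rw [digits_eq, hvec, Finset.sum_eq_single (r b)]
  · simp [hr, vec]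
  · intro i _ hi
    obtain ⟨x, rfl⟩ := hbij.2 i
    rw [hr, if_neg]
    exact fun h => hi (by rw [Fin.ext h])
  · exact fun h => absurd (Finset.mem_univ _) h

variable {k : ℕ} {F : Submodule (ZMod 2) (Fin 23 → ZMod 2)}

theorem vec_reduce {rows : List ℕ} (hR : ∀ r ∈ rows, vec 23 r ∈ F) :
    ∀ v, vec 23 (reduce rows v) ∈ F → vec 23 v ∈ F := by
  induction rows with
  | nil => exact fun v h => h
  | cons r rows ih =>
    rw [List.forall_mem_cons] at hR
    intro v h
    have h' : vec 23 (reduce rows (v ^^^ ((1 &&& (v >>> r.log2)) * r))) ∈ F := by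
      rwa [← forced_eq (v ^^^ ((1 &&& (v >>> r.log2)) * r)) (reduce rows)]
    have := ih hR.2 _ h'
    rw [Nat.one_and_eq_mod_two] at this
    rcases Nat.mod_two_eq_zero_or_one (v >>> r.log2) with h0 | h0
    · simpa [h0] using this
    · rw [h0, one_mul, vec_xor] at this
      simpa using sub_mem this hR.1

theorem Good.mem_of_isTrivial (h : Good k F) {rows : List ℕ} (hR : ∀ r ∈ rows, vec 23 r ∈ F)
    {v : ℕ} (hv : isTrivial (reduce rows v) = true) : vec 23 v ∈ F := by
  refine vec_reduce hR v ?_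
  have := Nat.eq_of_beq_eq_true hv
  obtain h0 | h0 : _ ∨ 4095 ^^^ reduce rows v = 0 := Nat.mul_eq_zero.mp this
  · rw [h0, vec_zero]; exact zero_mem _
  · rw [← Nat.xor_eq_zero_iff.mp h0]; exact h.base

theorem allOf_eq (l : List (List Bool)) (f : List Bool → Bool) : allOf l f = l.all f := by
  induction l with
  | nil => rfl
  | cons a l ih =>
    rw [List.all_cons, ← ih]
    change (Bool.rec false (allOf l f) (f a) : Bool) = _
    cases f a <;> rfl

/-- Up to a permutation, the code contains one of the three tails. -/
def HasTail (F : Submodule (ZMod 2) (Fin 23 → ZMod 2)) : Prop :=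
  ∃ i < 3, ∃ σ : Equiv.Perm (Fin 23), ∀ m ∈ tailGens i, vec 23 m ∈ SD.pull σ F

theorem HasTail.of_pull {σ : Equiv.Perm (Fin 23)} (h : HasTail (SD.pull σ F)) : HasTail F := by
  obtain ⟨i, hi, τ, h⟩ := h
  exact ⟨i, hi, τ.trans σ, h⟩

theorem checkSystem_sound (hG : Good k F) {rows : List ℕ} (hR : ∀ r ∈ rows, vec 23 r ∈ F) {c : ℕ}
    (h : checkSystem rows c = true) : HasTail F := by
  rw [checkSystem, forced_eq] at h
  cases hc : Nat.beq (Nat.land c 3) 3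
  · rw [hc] at h
    obtain ⟨q, hq, σ, hσ⟩ := withPerm_sound h
    have h4 : Nat.land c 3 < 4 := Nat.and_lt_two_pow c (n := 2) (by norm_num)
    refine ⟨Nat.land c 3, lt_of_le_of_ne (Nat.le_of_lt_succ h4) (Nat.ne_of_beq_eq_false hc),
      σ.symm, fun m hm => ?_⟩
    rw [allOf_eq, List.all_eq_true] at hq
    have := hq (digits m) (by rw [tailDigits_eq _ h4]; exact List.mem_map_of_mem hm)
    rw [pick_eq] at this
    have := hG.mem_of_isTrivial hR this
    rw [hσ] at this
    exact this
  · rw [hc] at h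
    simp only [cond_true, Bool.and_eq_true] at h
    obtain ⟨h1, ⟨h2, h3⟩, h4⟩ := h
    have hm := hG.mem_of_isTrivial hR h1
    generalize Nat.shiftRight c 2 = w at *
    have h2 : 0 < w := Nat.le_of_ble_eq_true h2
    have h3 : w < 2 ^ 23 := Nat.le_of_ble_eq_true h3
    have h4 : pop w < 8 := Nat.le_of_ble_eq_true h4
    have := hG.min _ hm fun h0 => h2.ne' (vec_inj h3 (by norm_num) (h0.trans (vec_zero 23).symm))
    rw [wt_vec (by norm_num) h3] at this
    omega

theorem checkStart_sound (hk : k ≤ 5) (hG : Good k F) {rows : List ℕ}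
    (hR : ∀ r ∈ rows, vec 23 r ∈ F) {c : ℕ} (h : checkStart rows c = true) :
    ∃ σ : Equiv.Perm (Fin 23), Good k (SD.pull σ F) ∧ ∀ r ∈ rowsStart, vec 23 r ∈ SD.pull σ F := by
  obtain ⟨q, hq, σ, hσ⟩ := withPerm_sound h
  simp only [Bool.and_eq_true, List.all_eq_true, pick_eq] at hq
  obtain ⟨hq1, hq2⟩ := hq
  have hfix : ∀ m ∈ [4095, 126976] ++ (List.range' 17 6).map (fun i => 2 ^ i), ∀ i : Fin 23,
      m.testBit (σ i) = m.testBit i := fun m hm i => by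
    have h1 := hσ m
    rw [Nat.eq_of_beq_eq_true (hq1 m hm)] at h1
    have := congrFun h1 i
    simp only [vec, Function.comp_apply] at this
    revert this
    cases m.testBit i <;> cases m.testBit (σ i) <;> simp
  have hcls : ∀ i, cls k (σ.symm i) = cls k i := fun i => by
    obtain ⟨i, rfl⟩ := σ.surjective i
    rw [σ.symm_apply_apply]
    have h1 := hfix 4095 (by simp) i
    have h2 := hfix 126976 (by simp) i
    have h3 : ∀ j ∈ List.range' 17 6, j = σ i ↔ j = i := fun j hj => by
      have := hfix (2 ^ j) (List.mem_append_right _ (List.mem_map_of_mem hj)) i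
      rwa [Nat.testBit_two_pow, Nat.testBit_two_pow, decide_eq_decide] at this
    have h4 : ∀ j : ℕ, (126976).testBit j = (decide (12 ≤ j) && decide (j < 17)) := fun j => by
      rw [show 126976 = (2 ^ 5 - 1) <<< 12 from rfl, Nat.testBit_shiftLeft,
        Nat.testBit_two_pow_sub_one]
      by_cases h : 12 ≤ j
      · simp [h, show j - 12 < 5 ↔ j < 17 by omega]
      · simp [h]
    rw [testBit_4095, testBit_4095, decide_eq_decide] at h1
    rw [h4, h4, ← Bool.decide_and, ← Bool.decide_and, decide_eq_decide] at h2
    rcases lt_or_ge i.1 17 with h17 | h17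
    · unfold cls
      split_ifs <;> omega
    · rw [← (h3 i (List.mem_range'_1.mpr ⟨h17, by omega⟩)).mpr rfl]
  refine ⟨σ.symm, hG.pull hcls, fun r hr => ?_⟩
  have := hG.mem_of_isTrivial hR (hq2 r hr)
  rw [hσ] at this
  exact this

theorem exists_of_checkAll {f : List ℕ → ℕ → Bool} : ∀ {l : List (List ℕ)} {cs : List ℕ},
    checkAll f l cs = true → ∀ r ∈ l, ∃ c, f r c = true
  | [], _, _ => by simp
  | _ :: _, [], h => absurd h (by simp [checkAll])
  | r :: l, c :: cs, h => by
    rw [checkAll, Bool.and_eq_true] at h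
    exact List.forall_mem_cons.mpr ⟨⟨c, h.1⟩, exists_of_checkAll h.2⟩

theorem Good.hasTail (hk : 1 ≤ k) (hk' : k ≤ 5) (hG : Good k F) : HasTail F := by
  have h0 : Reaches k F 13 [[]] :=
    ⟨[], List.mem_singleton_self _, by simp, Equiv.refl _, hG, by simp⟩
  obtain ⟨rows, hrows, -, σ, hσ, hR⟩ := addSorted_sound hk' (by norm_num) (by norm_num)
    (addSorted_sound hk' (by norm_num) (by norm_num) (addSorted_sound hk' (by norm_num)
      (by norm_num) (addSorted_sound hk' (by norm_num) (by norm_num) h0)))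
  obtain ⟨c, hc⟩ := exists_of_checkAll checkAll_start rows hrows
  obtain ⟨τ, hτ, hR⟩ := checkStart_sound hk' hσ hR hc
  refine HasTail.of_pull (σ := σ) (HasTail.of_pull (σ := τ) ?_)
  obtain ⟨rows, hrows, -, ρ, hρ, hR⟩ := systems_sound hk hk' hτ hR
  have hcheck : checkAll checkSystem (systems k) (systemCerts k) = true := by
    interval_cases k
    · exact checkAll_systems_one
    · exact checkAll_systems_two
    · exact checkAll_systems_three
    · exact checkAll_systems_four
    · exact checkAll_systems_five
  obtain ⟨c, hc⟩ := exists_of_checkAll hcheck rows hrows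
  exact (checkSystem_sound hρ hR hc).of_pull

end Checks

section Partition

theorem exists_perm_comp {α β : Type*} [Fintype α] [DecidableEq β] (f g : α → β)
    (h : ∀ b, (Finset.univ.filter fun a => f a = b).card =
      (Finset.univ.filter fun a => g a = b).card) : ∃ σ : Equiv.Perm α, ∀ a, f (σ a) = g a := by
  have h' : ∀ b, Nonempty ({a // g a = b} ≃ {a // f a = b}) := fun b =>
    Fintype.card_eq.mp (by rw [Fintype.card_subtype, Fintype.card_subtype, h])
  refine ⟨(Equiv.sigmaFiberEquiv g).symm.trans ((Equiv.sigmaCongrRight fun b => (h' b).some).trans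
    (Equiv.sigmaFiberEquiv f)), fun a => ?_⟩
  exact ((h' (g a)).some ⟨a, rfl⟩).2

theorem card_cls {k : ℕ} (hk : 1 ≤ k) (hk' : k ≤ 5) (b : ℕ) :
    (Finset.univ.filter fun i : Fin 23 => cls k i = b).card =
      if b = 0 then 12 else if b = 1 then 11 - k else if b = 2 then k else 0 := by
  split_ifs with h0 h1 h2
  · subst h0; interval_cases k <;> decide
  · subst h1; interval_cases k <;> decide
  · subst h2; interval_cases k <;> decide
  · rw [Finset.card_eq_zero, Finset.filter_eq_empty_iff]
    intro i _
    unfold cls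
    split_ifs <;> omega

/-- If a hyperplane contains `W` and has dimension at most `dim W + 1`, then `W` contains one of
`x`, `y`, `x + y` for any elements `x`, `y` of the hyperplane. -/
theorem mem_or_mem_or_add_mem {α : Type*} [Fintype α] {W H : Submodule (ZMod 2) (α → ZMod 2)}
    (hle : W ≤ H) (hrank : Module.finrank (ZMod 2) H ≤ Module.finrank (ZMod 2) W + 1)
    {x y : α → ZMod 2} (hx : x ∈ H) (hy : y ∈ H) : x ∈ W ∨ y ∈ W ∨ x + y ∈ W := by
  by_contra! hcon
  obtain ⟨h1, h2, h3⟩ := hcon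
  have hlt : W < W ⊔ Submodule.span (ZMod 2) {x} := by
    refine lt_of_le_of_ne le_sup_left fun h => h1 ?_
    rw [h]
    exact Submodule.mem_sup_right (Submodule.mem_span_singleton_self x)
  have hH : W ⊔ Submodule.span (ZMod 2) {x} = H := by
    refine Submodule.eq_of_le_of_finrank_le
      (sup_le hle ((Submodule.span_singleton_le_iff_mem _ _).mpr hx)) ?_
    have := Submodule.finrank_lt_finrank_of_lt hlt
    omega
  rw [← hH] at hy
  obtain ⟨w, hw, z, hz, rfl⟩ := Submodule.mem_sup.mp hy
  obtain ⟨a, rfl⟩ := Submodule.mem_span_singleton.mp hz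
  by_cases ha : a = 0
  · exact h2 (by simpa [ha] using hw)
  · rw [zmod_two_ne_zero.mp ha, one_smul, add_comm w, ← add_assoc, add_self_eq_zero, zero_add] at h3
    exact h3 hw

theorem exists_small_class {α : Type*} [DecidableEq α] (L : Finset α) (hL : L.card = 11)
    (R : α → α → Prop) (hrefl : ∀ i, R i i) (hsymm : ∀ i j, R i j → R j i)
    (htrans : ∀ i j k, R i j → R j k → R i k)
    (hthree : ∀ i ∈ L, ∀ j ∈ L, ∀ k ∈ L, R i j ∨ R i k ∨ R j k) :
    ∃ s ⊆ L, 1 ≤ s.card ∧ s.card ≤ 5 ∧ (∀ i ∈ s, ∀ j ∈ s, R i j) ∧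
      ∀ i ∈ L, i ∉ s → ∀ j ∈ L, j ∉ s → R i j := by
  classical
  obtain ⟨i₀, hi₀⟩ : L.Nonempty := Finset.card_pos.mp (by omega)
  have hS : ∀ i ∈ L.filter (R i₀), ∀ j ∈ L.filter (R i₀), R i j := fun i hi j hj =>
    htrans _ _ _ (hsymm _ _ (Finset.mem_filter.mp hi).2) (Finset.mem_filter.mp hj).2
  have hS' : ∀ i ∈ L.filter fun j => ¬ R i₀ j, ∀ j ∈ L.filter fun j => ¬ R i₀ j, R i j :=
    fun i hi j hj => by
      rw [Finset.mem_filter] at hi hj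
      exact ((hthree i₀ hi₀ i hi.1 j hj.1).resolve_left hi.2).resolve_left hj.2
  have hcard := Finset.card_filter_add_card_filter_not (s := L) (R i₀)
  rw [hL] at hcard
  by_cases h5 : (L.filter (R i₀)).card ≤ 5
  · refine ⟨L.filter (R i₀), Finset.filter_subset _ _,
      Finset.card_pos.mpr ⟨i₀, Finset.mem_filter.mpr ⟨hi₀, hrefl _⟩⟩, h5, hS,
      fun i hi his j hj hjs => hS' i ?_ j ?_⟩
    · exact Finset.mem_filter.mpr ⟨hi, fun h => his (Finset.mem_filter.mpr ⟨hi, h⟩)⟩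
    · exact Finset.mem_filter.mpr ⟨hj, fun h => hjs (Finset.mem_filter.mpr ⟨hj, h⟩)⟩
  · by_cases h0 : (L.filter fun j => ¬ R i₀ j).card = 0
    · have hall : ∀ i ∈ L, i ∈ L.filter (R i₀) := fun i hi => by
        rw [Finset.card_eq_zero, Finset.filter_eq_empty_iff] at h0
        exact Finset.mem_filter.mpr ⟨hi, not_not.mp (h0 hi)⟩
      refine ⟨{i₀}, Finset.singleton_subset_iff.mpr hi₀, by simp, by simp, fun i hi j hj => ?_,
        fun i hi _ j hj _ => hS i (hall i hi) j (hall j hj)⟩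
      rw [Finset.mem_singleton.mp hi, Finset.mem_singleton.mp hj]
      exact hrefl _
    · refine ⟨L.filter fun j => ¬ R i₀ j, Finset.filter_subset _ _, by omega, by omega, hS',
        fun i hi his j hj hjs => hS i ?_ j ?_⟩
      · exact Finset.mem_filter.mpr ⟨hi, not_not.mp fun h => his (Finset.mem_filter.mpr ⟨hi, h⟩)⟩
      · exact Finset.mem_filter.mpr ⟨hj, not_not.mp fun h => hjs (Finset.mem_filter.mpr ⟨hj, h⟩)⟩

/-- A self-orthogonal code of length 23, dimension at least 10 and minimum weight at least 8
contains one of the three tails. -/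
theorem hasTail_of_finrank {F : Submodule (ZMod 2) (Fin 23 → ZMod 2)}
    (horth : ∀ v ∈ F, ∀ w ∈ F, v ⬝ᵥ w = 0) (hmin : ∀ v ∈ F, v ≠ 0 → 8 ≤ wt v)
    (hrank : 10 ≤ Module.finrank (ZMod 2) F) : HasTail F := by
  obtain ⟨u, hu, hu12⟩ := exists_dodecad horth hmin hrank
  have hu12' : Fintype.card {i // u i ≠ 0} = 12 := by rw [Fintype.card_subtype]; exact hu12
  set E : Submodule (ZMod 2) (Fin 23 → ZMod 2) := LinearMap.range
    (Function.ExtendByZero.linearMap (ZMod 2) (Subtype.val : {i // u i ≠ 0} → Fin 23)) with hE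
  have hErank : Module.finrank (ZMod 2) E = 12 := by
    rw [LinearMap.finrank_range_of_inj, Module.finrank_fintype_fun_eq_card, hu12']
    intro f g h
    funext a
    have h1 : Function.extend Subtype.val f 0 a.1 = Function.extend Subtype.val g 0 a.1 :=
      congrFun h a.1
    rwa [Subtype.val_injective.extend_apply, Subtype.val_injective.extend_apply] at h1
  have hE0 : ∀ v ∈ E, ∀ i, u i = 0 → v i = 0 := by
    rintro _ ⟨w, rfl⟩ i hi
    exact Function.extend_apply' _ _ _ fun ⟨a, ha⟩ => a.2 (by rw [ha, hi])
  have hFE : F ⊓ E ≤ Submodule.span (ZMod 2) {u} := by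
    rintro v ⟨hvF, hvE⟩
    by_contra hv
    have h1 := hmin v hvF fun h => hv (h ▸ zero_mem _)
    have h2 := hmin (v + u) (add_mem hvF hu) fun h => hv (by
      have : v = u := by rw [← add_zero v, ← add_self_eq_zero u, ← add_assoc, h, zero_add]
      rw [this]; exact Submodule.mem_span_singleton_self u)
    have h3 := wt_add v u
    have h4 : (Finset.univ.filter fun i => v i ≠ 0 ∧ u i ≠ 0).card = wt v := by
      refine congrArg _ (Finset.filter_congr fun i _ => and_iff_left_of_imp fun h => ?_)
      exact mt (hE0 v hvE i) h
    rw [h4, hu12] at h3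
    omega
  set W := F ⊔ E with hW
  have hWrank : 21 ≤ Module.finrank (ZMod 2) W := by
    have h1 := Submodule.finrank_sup_add_finrank_inf_eq F E
    rw [← hW] at h1
    have h2 := (Submodule.finrank_mono hFE).trans (finrank_span_singleton (K := ZMod 2)
      (show u ≠ 0 from fun h => by simp [wt, h] at hu12)).le
    omega
  set H := dual (Submodule.span (ZMod 2) {1 + u}) with hH
  obtain ⟨i₁, hi₁⟩ : ∃ i, u i = 0 := by
    by_contra! h
    rw [wt, Finset.filter_true_of_mem fun i _ => h i] at hu12
    exact absurd hu12 (by decide)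
  have hHmem : ∀ v, v ∈ H ↔ v ⬝ᵥ (1 + u) = 0 := fun v => by
    rw [hH, mem_dual]
    refine ⟨fun h => h _ (Submodule.mem_span_singleton_self _), fun h p hp => ?_⟩
    obtain ⟨a, rfl⟩ := Submodule.mem_span_singleton.mp hp
    rw [dotProduct_smul, h, smul_zero]
  have hHrank : Module.finrank (ZMod 2) H = 22 := by
    have h1 := finrank_add_finrank_dual (Submodule.span (ZMod 2) {1 + u})
    rw [finrank_span_singleton, Fintype.card_fin, ← hH] at h1
    · omega
    · exact fun h => by simpa [hi₁] using congrFun h i₁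
  have hWH : W ≤ H := by
    refine sup_le (fun v hv => (hHmem v).mpr ?_) fun v hv => (hHmem v).mpr ?_
    · rw [dotProduct_add, horth v hv u hu, add_zero, ← horth v hv v hv]
      refine Finset.sum_congr rfl fun i _ => ?_
      rw [Pi.one_apply]
      generalize v i = a
      revert a; decide
    · refine Finset.sum_eq_zero fun i _ => ?_
      by_cases h : u i = 0
      · rw [hE0 v hv i h, zero_mul]
      · rw [Pi.add_apply, zmod_two_ne_zero.mp h, Pi.one_apply, CharTwo.add_self_eq_zero, mul_zero]
  let e : Fin 23 → Fin 23 → ZMod 2 := fun i => Pi.single i 1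
  have heH : ∀ i j, u i = 0 → u j = 0 → e i + e j ∈ H := fun i j hi hj => by
    rw [hHmem, add_dotProduct, single_one_dotProduct, single_one_dotProduct, Pi.add_apply,
      Pi.add_apply, hi, hj, Pi.one_apply, Pi.one_apply]
    decide
  have hthird : ∀ i j k, (e i + e j) + (e j + e k) = e i + e k := fun i j k => by
    rw [add_assoc, ← add_assoc (e j), add_self_eq_zero, zero_add]
  have hL : (Finset.univ.filter fun i => u i = 0).card = 11 := by
    have := Finset.card_filter_add_card_filter_not (s := Finset.univ) fun i => u i ≠ 0
    simp only [not_not, Finset.card_univ, Fintype.card_fin] at this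
    unfold wt at hu12
    omega
  obtain ⟨s, hsL, hs1, hs5, hss, hsc⟩ := exists_small_class _ hL (fun i j => e i + e j ∈ W)
    (fun i => by rw [add_self_eq_zero]; exact zero_mem _) (fun i j h => by rwa [add_comm])
    (fun i j k h h' => by rw [← hthird i j k]; exact add_mem h h')
    (fun i hi j hj k hk => by
      rw [Finset.mem_filter] at hi hj hk
      have := mem_or_mem_or_add_mem hWH (by omega) (heH i j hi.2 hj.2) (heH i k hi.2 hk.2)
      rwa [add_comm (e i) (e j), hthird, add_comm (e j) (e i)] at this)
  have hsu : ∀ i ∈ s, u i = 0 := fun i hi => (Finset.mem_filter.mp (hsL hi)).2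
  obtain ⟨σ, hσ⟩ := exists_perm_comp
    (fun i => if u i ≠ 0 then 0 else if i ∈ s then 2 else 1) (fun i : Fin 23 => cls s.card i)
    (fun b => by
      rw [card_cls hs1 hs5]
      split_ifs with h0 h1 h2
      · rw [← hu12]
        refine congrArg _ (Finset.filter_congr fun i _ => ?_)
        by_cases hi : u i = 0 <;> by_cases his : i ∈ s <;> simp [hi, his, h0]
      · rw [← hL, ← Finset.card_sdiff_of_subset hsL]
        refine congrArg _ (Finset.ext fun i => ?_)
        by_cases hi : u i = 0 <;> by_cases his : i ∈ s <;> simp [hi, his, h1]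
      · refine congrArg _ (Finset.ext fun i => ?_)
        by_cases his : i ∈ s
        · simp [his, hsu i his, h2]
        · by_cases hi : u i = 0 <;> simp [hi, his, h2]
      · rw [Finset.card_eq_zero, Finset.filter_eq_empty_iff]
        intro i _
        split_ifs <;> omega)
  refine HasTail.of_pull (σ := σ) (Good.hasTail hs1 hs5 ⟨?_, ?_, ?_, ?_⟩)
  · rw [mem_pull]
    convert hu using 1
    funext i
    have h1 := hσ (σ.symm i)
    rw [Equiv.apply_symm_apply] at h1
    have h2 : (4095).testBit (σ.symm i) = true ↔ u i ≠ 0 := by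
      rw [testBit_4095, decide_eq_true_iff, ← cls_eq_zero (k := s.card), ← h1]
      by_cases hi : u i = 0 <;> simp [hi, apply_ite (· = 0)]
    rw [← vec_ne_zero (n := 23), zmod_two_ne_zero, zmod_two_ne_zero] at h2
    exact (by decide : ∀ a b : ZMod 2, (a = 1 ↔ b = 1) → a = b) _ _ h2
  · intro v hv w hw
    rw [← dot_comp σ.symm]
    exact horth _ hv _ hw
  · intro v hv h0
    rw [← wt_comp σ.symm]
    refine hmin _ hv fun h' => h0 ?_
    funext i
    simpa using congrFun h' (σ i)
  · intro i j hij hc h0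
    have hu0 : ∀ l : Fin 23, cls s.card l ≠ 0 → u (σ l) = 0 := fun l hl => by
      rw [← hσ] at hl
      by_contra h
      exact hl (if_pos h)
    have hiW : e (σ i) + e (σ j) ∈ W := by
      have hi := hu0 i h0
      have hj := hu0 j (hc ▸ h0)
      rw [← hσ, ← hσ, if_neg (not_not.mpr hi), if_neg (not_not.mpr hj)] at hc
      by_cases his : σ i ∈ s
      · by_cases hjs : σ j ∈ s
        · exact hss _ his _ hjs
        · simp [his, hjs] at hc
      · by_cases hjs : σ j ∈ s
        · simp [his, hjs] at hc
        · exact hsc _ (by simpa using hi) his _ (by simpa using hj) hjs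
    obtain ⟨f, hf, x, hx, hfx⟩ := Submodule.mem_sup.mp hiW
    have hval : ∀ l : Fin 23, cls s.card l ≠ 0 → f (σ l) = (e (σ i) + e (σ j)) (σ l) :=
        fun l hl => by
      rw [← hfx, Pi.add_apply, hE0 x hx _ (hu0 l hl), add_zero]
    refine ⟨f ∘ σ, comp_mem_pull.mpr hf, ?_, ?_, fun l hli hlj hl => ?_⟩
    · rw [Function.comp_apply, hval i h0]
      simp [e, hij]
    · rw [Function.comp_apply, hval j (hc ▸ h0)]
      simp [e, hij.symm]
    · rw [Function.comp_apply, hval l (by rwa [Ne, cls_eq_zero, not_lt])]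
      simp [e, hli, hlj]

end Partition

section Blocks

/-- The coordinates, arranged as three blocks of length 7 and a tail of length 23. -/
abbrev Pos := (Fin 3 × ZMod 7) ⊕ Fin 23

/-- The word with given blocks and given tail. -/
def word (x : Fin 3 → ZMod 7 → ZMod 2) (y : Fin 23 → ZMod 2) : Pos → ZMod 2 :=
  Sum.elim (fun p => x p.1 p.2) y

theorem exists_word (v : Pos → ZMod 2) : ∃ x y, v = word x y :=
  ⟨fun j i => v (.inl (j, i)), fun t => v (.inr t), by ext (p | t) <;> rfl⟩

theorem word_add (x x' : Fin 3 → ZMod 7 → ZMod 2) (y y' : Fin 23 → ZMod 2) :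
    word x y + word x' y' = word (x + x') (y + y') := by
  ext (p | t) <;> rfl

theorem word_eq_zero {x : Fin 3 → ZMod 7 → ZMod 2} {y : Fin 23 → ZMod 2} :
    word x y = 0 ↔ x = 0 ∧ y = 0 :=
  ⟨fun h => ⟨funext fun j => funext fun i => congrFun h (.inl (j, i)),
    funext fun t => congrFun h (.inr t)⟩, by rintro ⟨rfl, rfl⟩; ext (p | t) <;> rfl⟩

theorem dot_word (x x' : Fin 3 → ZMod 7 → ZMod 2) (y y' : Fin 23 → ZMod 2) :
    word x y ⬝ᵥ word x' y' = ∑ j, x j ⬝ᵥ x' j + y ⬝ᵥ y' := by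
  rw [word, word, dot_elim, dotProduct, Fintype.sum_prod_type]
  rfl

theorem wt_word (x : Fin 3 → ZMod 7 → ZMod 2) (y : Fin 23 → ZMod 2) :
    wt (word x y) = ∑ j, wt (x j) + wt y := by
  rw [word, wt_elim]
  congr 1
  simp only [wt, Finset.card_filter, Fintype.sum_prod_type]

/-- Cyclic shift of a block. -/
def sh (s : ZMod 7) (f : ZMod 7 → ZMod 2) : ZMod 7 → ZMod 2 := fun i => f (i + s)

theorem sh_sh (s t : ZMod 7) (f : ZMod 7 → ZMod 2) : sh s (sh t f) = sh (s + t) f :=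
  funext fun i => congrArg f (add_assoc i s t)

theorem sh_zero (f : ZMod 7 → ZMod 2) : sh 0 f = f := funext fun i => congrArg f (add_zero i)

theorem sh_eq_zero {s : ZMod 7} {f : ZMod 7 → ZMod 2} : sh s f = 0 ↔ f = 0 := by
  refine ⟨fun h => ?_, fun h => by rw [h]; rfl⟩
  rw [← sh_zero f, ← neg_add_cancel s, ← sh_sh, h]
  rfl

theorem dot_sh_sh (s : ZMod 7) (f g : ZMod 7 → ZMod 2) : sh s f ⬝ᵥ sh s g = f ⬝ᵥ g :=
  dot_comp (Equiv.addRight s) f g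

theorem dot_sh (s : ZMod 7) (f g : ZMod 7 → ZMod 2) : sh s f ⬝ᵥ g = f ⬝ᵥ sh (-s) g := by
  rw [← dot_sh_sh s f, sh_sh, add_neg_cancel, sh_zero]

/-- The projection to the first of the two nontrivial simple submodules of a block. -/
def eps₁ (f : ZMod 7 → ZMod 2) : ZMod 7 → ZMod 2 := f + sh 1 f + sh 2 f + sh 4 f

/-- The projection to the second of the two nontrivial simple submodules of a block. -/
def eps₂ (f : ZMod 7 → ZMod 2) : ZMod 7 → ZMod 2 := f + sh 3 f + sh 5 f + sh 6 f

theorem dot_eps₁ (f g : ZMod 7 → ZMod 2) : eps₁ f ⬝ᵥ g = f ⬝ᵥ eps₂ g := by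
  simp only [eps₁, eps₂, add_dotProduct, dotProduct_add, dot_sh]
  rw [show (-1 : ZMod 7) = 6 by decide, show (-2 : ZMod 7) = 5 by decide,
    show (-4 : ZMod 7) = 3 by decide]
  abel

theorem dot_eps₂ (f g : ZMod 7 → ZMod 2) : eps₂ f ⬝ᵥ g = f ⬝ᵥ eps₁ g := by
  rw [dotProduct_comm, ← dot_eps₁, dotProduct_comm]

theorem eps₁_sh (s : ZMod 7) (f : ZMod 7 → ZMod 2) : eps₁ (sh s f) = sh s (eps₁ f) := by
  unfold eps₁
  simp only [sh_sh, add_comm _ s]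
  simp only [← sh_sh]
  rfl

theorem eps₂_sh (s : ZMod 7) (f : ZMod 7 → ZMod 2) : eps₂ (sh s f) = sh s (eps₂ f) := by
  unfold eps₂
  simp only [sh_sh, add_comm _ s]
  simp only [← sh_sh]
  rfl

theorem eps₁_add (f g : ZMod 7 → ZMod 2) : eps₁ (f + g) = eps₁ f + eps₁ g := by
  funext i
  simp only [eps₁, sh, Pi.add_apply]
  ring

theorem eps₂_add (f g : ZMod 7 → ZMod 2) : eps₂ (f + g) = eps₂ f + eps₂ g := by
  funext i
  simp only [eps₂, sh, Pi.add_apply]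
  ring

theorem eps₂_eps₂ : ∀ f : ZMod 7 → ZMod 2, eps₂ (eps₂ f) = eps₂ f := by decide +kernel

theorem eps₁_eps₁ : ∀ f : ZMod 7 → ZMod 2, eps₁ (eps₁ f) = eps₁ f := by decide +kernel

theorem eps₂_neg : ∀ f : ZMod 7 → ZMod 2, eps₂ (f ∘ Neg.neg) = eps₁ f ∘ Neg.neg := by
  decide +kernel

/-- A generator of the first simple submodule. -/
def gen₁ : ZMod 7 → ZMod 2 := vec 7 105

/-- A generator of the second simple submodule. -/
def gen₂ : ZMod 7 → ZMod 2 := vec 7 23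

theorem eq_zero_or_sh_gen₁ : ∀ f, eps₁ f = f → f = 0 ∨ ∃ s, f = sh s gen₁ := by decide +kernel

theorem eq_zero_or_sh_gen₂ : ∀ f, eps₂ f = f → f = 0 ∨ ∃ s, f = sh s gen₂ := by decide +kernel

theorem eps₁_gen₁ : eps₁ gen₁ = gen₁ := by decide +kernel

theorem eps₂_gen₂ : eps₂ gen₂ = gen₂ := by decide +kernel

theorem exists_dot_gen : ∀ s s', ∃ t, sh s gen₁ ⬝ᵥ sh t (sh s' gen₂) ≠ 0 := by decide +kernel

theorem wt_sh_gen₁ : ∀ s, wt (sh s gen₁) = 4 := by decide +kernel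

theorem wt_sh_gen₂ : ∀ s, wt (sh s gen₂) = 4 := by decide +kernel

theorem sum_sh : ∀ f : ZMod 7 → ZMod 2, f + eps₁ f + eps₂ f = fun _ => ∑ i, f i := by
  decide +kernel

end Blocks

section Cyclic

/-- A self-dual code of minimum weight at least 8 invariant under the simultaneous cyclic shift
of the three blocks. -/
structure IsCyclic (D : Submodule (ZMod 2) (Pos → ZMod 2)) : Prop where
  selfDual : dual D = D
  min : ∀ v ∈ D, v ≠ 0 → 8 ≤ wt v
  shift : ∀ x y, word x y ∈ D → word (fun j => sh 1 (x j)) y ∈ D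

variable {D : Submodule (ZMod 2) (Pos → ZMod 2)}

theorem IsCyclic.orth (hD : IsCyclic D) {v w : Pos → ZMod 2} (hv : v ∈ D) (hw : w ∈ D) :
    v ⬝ᵥ w = 0 := by
  rw [← hD.selfDual, mem_dual] at hv
  exact hv w hw

theorem IsCyclic.mem (hD : IsCyclic D) {v : Pos → ZMod 2} (h : ∀ w ∈ D, v ⬝ᵥ w = 0) : v ∈ D := by
  rw [← hD.selfDual, mem_dual]
  exact h

theorem IsCyclic.sh_mem (hD : IsCyclic D) (s : ZMod 7) {x : Fin 3 → ZMod 7 → ZMod 2}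
    {y : Fin 23 → ZMod 2} (h : word x y ∈ D) : word (fun j => sh s (x j)) y ∈ D := by
  have key : ∀ n : ℕ, word (fun j => sh n (x j)) y ∈ D := fun n => by
    induction n with
    | zero => simpa only [Nat.cast_zero, sh_zero] using h
    | succ n ih =>
      have := hD.shift _ _ ih
      simp only [sh_sh] at this
      rwa [Nat.cast_succ, add_comm]
  simpa only [ZMod.natCast_zmod_val] using key s.val

theorem IsCyclic.eps₁_mem (hD : IsCyclic D) {x : Fin 3 → ZMod 7 → ZMod 2} {y : Fin 23 → ZMod 2}
    (h : word x y ∈ D) : word (fun j => eps₁ (x j)) 0 ∈ D := by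
  have := add_mem (add_mem (add_mem h (hD.sh_mem 1 h)) (hD.sh_mem 2 h)) (hD.sh_mem 4 h)
  rw [word_add, word_add, word_add] at this
  rwa [add_self_eq_zero, zero_add, add_self_eq_zero] at this

theorem IsCyclic.eps₂_mem (hD : IsCyclic D) {x : Fin 3 → ZMod 7 → ZMod 2} {y : Fin 23 → ZMod 2}
    (h : word x y ∈ D) : word (fun j => eps₂ (x j)) 0 ∈ D := by
  have := add_mem (add_mem (add_mem h (hD.sh_mem 3 h)) (hD.sh_mem 5 h)) (hD.sh_mem 6 h)
  rw [word_add, word_add, word_add] at this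
  rwa [add_self_eq_zero, zero_add, add_self_eq_zero] at this

/-- The words of `D` with zero tail and all blocks in the first simple submodule. -/
def part₁ (D : Submodule (ZMod 2) (Pos → ZMod 2)) : Set (Fin 3 → ZMod 7 → ZMod 2) :=
  {x | (∀ j, eps₁ (x j) = x j) ∧ word x 0 ∈ D}

/-- The words of `D` with zero tail and all blocks in the second simple submodule. -/
def part₂ (D : Submodule (ZMod 2) (Pos → ZMod 2)) : Set (Fin 3 → ZMod 7 → ZMod 2) :=
  {x | (∀ j, eps₂ (x j) = x j) ∧ word x 0 ∈ D}

theorem IsCyclic.mem_part₁ (hD : IsCyclic D) {x : Fin 3 → ZMod 7 → ZMod 2}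
    (hx : ∀ j, eps₁ (x j) = x j) (h : ∀ z ∈ part₂ D, ∑ j, x j ⬝ᵥ z j = 0) : x ∈ part₁ D := by
  refine ⟨hx, hD.mem fun w hw => ?_⟩
  obtain ⟨z, y, rfl⟩ := exists_word w
  rw [dot_word, zero_dotProduct, add_zero, ← h _ ⟨fun j => eps₂_eps₂ (z j), hD.eps₂_mem hw⟩]
  exact Finset.sum_congr rfl fun j _ => by rw [← dot_eps₁, hx]

theorem IsCyclic.mem_part₂ (hD : IsCyclic D) {x : Fin 3 → ZMod 7 → ZMod 2}
    (hx : ∀ j, eps₂ (x j) = x j) (h : ∀ z ∈ part₁ D, ∑ j, x j ⬝ᵥ z j = 0) : x ∈ part₂ D := by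
  refine ⟨hx, hD.mem fun w hw => ?_⟩
  obtain ⟨z, y, rfl⟩ := exists_word w
  rw [dot_word, zero_dotProduct, add_zero, ← h _ ⟨fun j => eps₁_eps₁ (z j), hD.eps₁_mem hw⟩]
  exact Finset.sum_congr rfl fun j _ => by rw [← dot_eps₂, hx]

theorem IsCyclic.sh_mem_part₁ (hD : IsCyclic D) (s : ZMod 7) {x : Fin 3 → ZMod 7 → ZMod 2}
    (hx : x ∈ part₁ D) : (fun j => sh s (x j)) ∈ part₁ D :=
  ⟨fun j => by rw [eps₁_sh, hx.1], hD.sh_mem s hx.2⟩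

theorem IsCyclic.sh_mem_part₂ (hD : IsCyclic D) (s : ZMod 7) {x : Fin 3 → ZMod 7 → ZMod 2}
    (hx : x ∈ part₂ D) : (fun j => sh s (x j)) ∈ part₂ D :=
  ⟨fun j => by rw [eps₂_sh, hx.1], hD.sh_mem s hx.2⟩

theorem add_mem_part₁ {x z : Fin 3 → ZMod 7 → ZMod 2} (hx : x ∈ part₁ D) (hz : z ∈ part₁ D) :
    x + z ∈ part₁ D :=
  ⟨fun j => by rw [Pi.add_apply, eps₁_add, hx.1, hz.1], by
    have := add_mem hx.2 hz.2
    rwa [word_add, add_zero] at this⟩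

theorem add_mem_part₂ {x z : Fin 3 → ZMod 7 → ZMod 2} (hx : x ∈ part₂ D) (hz : z ∈ part₂ D) :
    x + z ∈ part₂ D :=
  ⟨fun j => by rw [Pi.add_apply, eps₂_add, hx.1, hz.1], by
    have := add_mem hx.2 hz.2
    rwa [word_add, add_zero] at this⟩

theorem wt_le_four₁ {f : ZMod 7 → ZMod 2} (h : eps₁ f = f) : wt f ≤ 4 := by
  obtain rfl | ⟨s, rfl⟩ := eq_zero_or_sh_gen₁ f h
  · simp [wt]
  · rw [wt_sh_gen₁]

theorem wt_le_four₂ {f : ZMod 7 → ZMod 2} (h : eps₂ f = f) : wt f ≤ 4 := by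
  obtain rfl | ⟨s, rfl⟩ := eq_zero_or_sh_gen₂ f h
  · simp [wt]
  · rw [wt_sh_gen₂]

/-- A word with zero tail and at most one nonzero block, of weight at most 4, is zero. -/
theorem IsCyclic.eq_zero_of_single (hD : IsCyclic D) {x : Fin 3 → ZMod 7 → ZMod 2}
    (hx : word x 0 ∈ D) (j : Fin 3) (h4 : wt (x j) ≤ 4) (h : ∀ k, k ≠ j → x k = 0) : x = 0 := by
  by_contra h0
  have := hD.min _ hx fun h => h0 (word_eq_zero.mp h).1
  rw [wt_word, Finset.sum_eq_single j (fun k _ hk => by rw [h k hk]; simp [wt]) (by simp),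
    wt_eq_zero.mpr rfl] at this
  omega

theorem exists_dot_ne_zero {f g : ZMod 7 → ZMod 2} (hf : eps₁ f = f) (hg : eps₂ g = g)
    (hf0 : f ≠ 0) (hg0 : g ≠ 0) : ∃ t, f ⬝ᵥ sh t g ≠ 0 := by
  obtain ⟨s, rfl⟩ := (eq_zero_or_sh_gen₁ f hf).resolve_left hf0
  obtain ⟨s', rfl⟩ := (eq_zero_or_sh_gen₂ g hg).resolve_left hg0
  exact exists_dot_gen s s'

theorem eps_zero₁ : eps₁ 0 = 0 := by decide +kernel

theorem eps_zero₂ : eps₂ 0 = 0 := by decide +kernel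

theorem exists_third : ∀ j j' : Fin 3, j ≠ j' →
    ∃ k, k ≠ j ∧ k ≠ j' ∧ ∀ l, l ≠ k → l = j ∨ l = j' := by decide

theorem IsCyclic.eq_of_blocks_eq_zero (hD : IsCyclic D) {x z : Fin 3 → ZMod 7 → ZMod 2}
    (hx : x ∈ part₁ D) (hz : z ∈ part₂ D) (hx0 : x ≠ 0) (hz0 : z ≠ 0) {j j' : Fin 3}
    (hj : x j = 0) (hj' : z j' = 0) : j = j' := by
  by_contra hne
  obtain ⟨k, hkj, hkj', hk⟩ : ∃ k, k ≠ j ∧ k ≠ j' ∧ ∀ l, l ≠ k → l = j ∨ l = j' :=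
    exists_third j j' hne
  have hxk : x k ≠ 0 := fun h => hx0 <|
    hD.eq_zero_of_single hx.2 j' (wt_le_four₁ (hx.1 j')) fun l hl => by
      by_cases hlk : l = k
      · rw [hlk, h]
      · rw [(hk l hlk).resolve_right hl, hj]
  have hzk : z k ≠ 0 := fun h => hz0 <|
    hD.eq_zero_of_single hz.2 j (wt_le_four₂ (hz.1 j)) fun l hl => by
      by_cases hlk : l = k
      · rw [hlk, h]
      · rw [(hk l hlk).resolve_left hl, hj']
  obtain ⟨t, ht⟩ := exists_dot_ne_zero (hx.1 k) (hz.1 k) hxk hzk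
  have := hD.orth hx.2 (hD.sh_mem t hz.2)
  rw [dot_word, zero_dotProduct, add_zero, Finset.sum_eq_single k (fun l _ hl => ?_) (by simp)]
    at this
  · exact ht this
  · obtain rfl | rfl := hk l hl
    · rw [hj, zero_dotProduct]
    · rw [hj', sh_eq_zero.mpr rfl, dotProduct_zero]

/-- Every nonzero element of `part₁` has three nonzero blocks. -/
def Full₁ (D : Submodule (ZMod 2) (Pos → ZMod 2)) : Prop := ∀ x ∈ part₁ D, x ≠ 0 → ∀ j, x j ≠ 0

/-- Every nonzero element of `part₂` has three nonzero blocks. -/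
def Full₂ (D : Submodule (ZMod 2) (Pos → ZMod 2)) : Prop := ∀ x ∈ part₂ D, x ≠ 0 → ∀ j, x j ≠ 0

theorem IsCyclic.full (hD : IsCyclic D) : Full₁ D ∨ Full₂ D := by
  by_contra! hcon
  obtain ⟨h1, h2⟩ := hcon
  simp only [Full₁, Full₂] at h1 h2
  push Not at h1 h2
  obtain ⟨x, hx, hx0, j, hj⟩ := h1
  obtain ⟨x', hx', hx'0, j', hj'⟩ := h2
  obtain rfl := hD.eq_of_blocks_eq_zero hx hx' hx0 hx'0 hj hj'
  obtain ⟨z, hz, hzj⟩ : ∃ z ∈ part₂ D, z j ≠ 0 := by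
    by_contra! h
    have hg : Pi.single j gen₁ ∈ part₁ D := by
      refine hD.mem_part₁ (fun k => ?_) fun z hz => ?_
      · by_cases hk : k = j
        · rw [hk, Pi.single_eq_same, eps₁_gen₁]
        · rw [Pi.single_eq_of_ne hk, eps_zero₁]
      · refine Finset.sum_eq_zero fun k _ => ?_
        by_cases hk : k = j
        · rw [hk, h z hz, dotProduct_zero]
        · rw [Pi.single_eq_of_ne hk, zero_dotProduct]
    have := hD.eq_zero_of_single hg.2 j (wt_le_four₁ (hg.1 j)) fun k hk => Pi.single_eq_of_ne hk _
    have h4 := wt_sh_gen₁ 0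
    rw [sh_zero, ← Pi.single_eq_same (M := fun _ => ZMod 7 → ZMod 2) j gen₁, this] at h4
    simp [wt] at h4
  by_cases hl : ∃ l, z l = 0
  · obtain ⟨l, hl⟩ := hl
    obtain rfl := hD.eq_of_blocks_eq_zero hx hz hx0 (fun h => hzj (congrFun h j)) hj hl
    exact hzj hl
  push Not at hl
  obtain ⟨k, hk, hx'k⟩ : ∃ k, k ≠ j ∧ x' k ≠ 0 := by
    by_contra! h
    exact hx'0 (funext fun k => by
      by_cases hk : k = j
      · rw [hk, hj']; rfl
      · exact h k hk)
  obtain ⟨s, hs⟩ := (eq_zero_or_sh_gen₂ _ (hx'.1 k)).resolve_left hx'k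
  obtain ⟨s', hs'⟩ := (eq_zero_or_sh_gen₂ _ (hz.1 k)).resolve_left (hl k)
  have hz' := add_mem_part₂ (hD.sh_mem_part₂ (s - s') hz) hx'
  refine hk (hD.eq_of_blocks_eq_zero hx hz' hx0 (fun h => hzj ?_) hj (j' := k) ?_).symm
  · have := congrFun h j
    rw [Pi.add_apply, hj', add_zero] at this
    exact sh_eq_zero.mp this
  · rw [Pi.add_apply, hs, hs', sh_sh, sub_add_cancel, add_self_eq_zero]

/-- The codes with the standard blocks. -/
structure IsStandard (D : Submodule (ZMod 2) (Pos → ZMod 2)) : Prop extends IsCyclic D where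
  diag : ∀ s, word (fun _ => sh s gen₁) 0 ∈ D
  pair : ∀ j k s, j ≠ k → word (Pi.single j (sh s gen₂) + Pi.single k (sh s gen₂)) 0 ∈ D

/-- Rotation of the individual blocks. -/
def rot (s : Fin 3 → ZMod 7) : Equiv.Perm Pos :=
  (Equiv.prodShear (Equiv.refl (Fin 3)) fun j => Equiv.addRight (s j)).sumCongr (Equiv.refl _)

/-- Reflection of all blocks. -/
def reflect : Equiv.Perm Pos :=
  ((Equiv.refl (Fin 3)).prodCongr (Equiv.neg (ZMod 7))).sumCongr (Equiv.refl _)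

theorem word_rot (s : Fin 3 → ZMod 7) (x : Fin 3 → ZMod 7 → ZMod 2) (y : Fin 23 → ZMod 2) :
    word x y ∘ rot s = word (fun j => sh (s j) (x j)) y := by
  ext (p | t) <;> rfl

theorem word_rot_symm (s : Fin 3 → ZMod 7) (x : Fin 3 → ZMod 7 → ZMod 2) (y : Fin 23 → ZMod 2) :
    word x y ∘ (rot s).symm = word (fun j => sh (-s j) (x j)) y := by
  ext (p | t) <;> rfl

theorem word_reflect (x : Fin 3 → ZMod 7 → ZMod 2) (y : Fin 23 → ZMod 2) :
    word x y ∘ reflect.symm = word (fun j => x j ∘ Neg.neg) y := by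
  ext (p | t) <;> rfl

theorem IsCyclic.pull (hD : IsCyclic D) {e : Equiv.Perm Pos}
    (h : ∀ x y, word x y ∈ pull e D → word (fun j => sh 1 (x j)) y ∈ pull e D) :
    IsCyclic (pull e D) where
  selfDual := by rw [dual_pull, hD.selfDual]
  min v hv h0 := by
    rw [← wt_comp e.symm]
    refine hD.min _ hv fun h' => h0 ?_
    funext i
    simpa using congrFun h' (e i)
  shift := h

theorem IsCyclic.rot (hD : IsCyclic D) (s : Fin 3 → ZMod 7) : IsCyclic (SD.pull (rot s) D) :=
  hD.pull fun x y h => by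
    rw [mem_pull, word_rot_symm] at h ⊢
    have := hD.sh_mem 1 h
    simpa only [sh_sh, add_comm] using this

theorem IsCyclic.reflect (hD : IsCyclic D) : IsCyclic (SD.pull reflect D) :=
  hD.pull fun x y h => by
    rw [mem_pull, word_reflect] at h ⊢
    convert hD.sh_mem (-1) h using 2
    funext j i
    simp [sh, add_comm]

theorem Full₂.reflect (h : Full₂ D) : Full₁ (pull reflect D) := by
  rintro x ⟨hx, hxD⟩ h0 j hj
  rw [mem_pull, word_reflect] at hxD
  refine h _ ⟨fun k => ?_, hxD⟩ (fun h' => h0 ?_) j ?_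
  · rw [eps₂_neg, hx]
  · funext k i
    simpa using congrFun (congrFun h' k) (-i)
  · rw [hj]; rfl

theorem Full₁.exists_isStandard (h : Full₁ D) (hD : IsCyclic D) :
    ∃ e : Equiv.Perm Pos, IsStandard (pull e D) := by
  obtain ⟨x, hx, hx0⟩ : ∃ x ∈ part₁ D, x ≠ 0 := by
    by_contra! h0
    have hg : Pi.single 0 gen₂ ∈ part₂ D := by
      refine hD.mem_part₂ (fun k => ?_) fun z hz => ?_
      · by_cases hk : k = 0
        · rw [hk, Pi.single_eq_same, eps₂_gen₂]
        · rw [Pi.single_eq_of_ne hk, eps_zero₂]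
      · rw [h0 z hz]
        exact Finset.sum_eq_zero fun k _ => dotProduct_zero _
    have := hD.eq_zero_of_single hg.2 0 (wt_le_four₂ (hg.1 0)) fun k hk => Pi.single_eq_of_ne hk _
    have h4 := wt_sh_gen₂ 0
    rw [sh_zero, ← Pi.single_eq_same (M := fun _ => ZMod 7 → ZMod 2) (0 : Fin 3) gen₂, this] at h4
    simp [wt] at h4
  have hs : ∀ j, ∃ s, x j = sh s gen₁ := fun j =>
    (eq_zero_or_sh_gen₁ _ (hx.1 j)).resolve_left (h x hx hx0 j)
  choose s hs using hs
  have hall : ∀ z ∈ part₁ D, z = 0 ∨ ∃ t, z = fun j => sh t (x j) := fun z hz => by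
    by_cases hz0 : z = 0
    · exact .inl hz0
    obtain ⟨t, ht⟩ := (eq_zero_or_sh_gen₁ _ (hz.1 0)).resolve_left (h z hz hz0 0)
    refine .inr ⟨t - s 0, ?_⟩
    by_contra hne
    refine h _ (add_mem_part₁ hz (hD.sh_mem_part₁ (t - s 0) hx)) (fun h' => hne ?_) 0 ?_
    · funext j
      rw [← add_zero (z j), ← add_self_eq_zero (sh (t - s 0) (x j)), ← add_assoc]
      exact (congrArg (· + _) (congrFun h' j)).trans (zero_add _)
    · rw [Pi.add_apply, ht, hs, sh_sh, sub_add_cancel, add_self_eq_zero]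
  refine ⟨rot fun j => -s j, hD.rot _, fun r => ?_, fun j k r hjk => ?_⟩
  · rw [mem_pull, word_rot_symm]
    convert hD.sh_mem r hx.2 using 2
    funext j
    rw [hs, sh_sh, sh_sh, neg_neg, add_comm]
  · rw [mem_pull, word_rot_symm]
    refine (hD.mem_part₂ (fun l => ?_) fun z hz => ?_).2
    · rw [eps₂_sh, Pi.add_apply, eps₂_add]
      congr 2
      · by_cases hl : l = j
        · rw [hl, Pi.single_eq_same, eps₂_sh, eps₂_gen₂]
        · rw [Pi.single_eq_of_ne hl, eps_zero₂]
      · by_cases hl : l = k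
        · rw [hl, Pi.single_eq_same, eps₂_sh, eps₂_gen₂]
        · rw [Pi.single_eq_of_ne hl, eps_zero₂]
    · obtain rfl | ⟨t, rfl⟩ := hall z hz
      · exact Finset.sum_eq_zero fun k _ => dotProduct_zero _
      · have : ∀ l, sh (- -s l) ((Pi.single j (sh r gen₂) + Pi.single k (sh r gen₂) :
            Fin 3 → ZMod 7 → ZMod 2) l) ⬝ᵥ sh t (x l) =
            (Pi.single j (sh r gen₂ ⬝ᵥ sh t gen₁) : Fin 3 → ZMod 2) l +
              (Pi.single k (sh r gen₂ ⬝ᵥ sh t gen₁) : Fin 3 → ZMod 2) l := fun l => by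
          rw [hs, neg_neg, sh_sh, add_comm t, ← sh_sh, dot_sh_sh, Pi.add_apply, add_dotProduct]
          congr 1
          · by_cases hl : l = j
            · rw [hl, Pi.single_eq_same, Pi.single_eq_same]
            · rw [Pi.single_eq_of_ne hl, Pi.single_eq_of_ne hl, zero_dotProduct]
          · by_cases hl : l = k
            · rw [hl, Pi.single_eq_same, Pi.single_eq_same]
            · rw [Pi.single_eq_of_ne hl, Pi.single_eq_of_ne hl, zero_dotProduct]
        rw [Finset.sum_congr rfl fun l _ => this l, Finset.sum_add_distrib,
          Finset.sum_pi_single', Finset.sum_pi_single', if_pos (Finset.mem_univ _),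
          if_pos (Finset.mem_univ _), CharTwo.add_self_eq_zero]

theorem IsCyclic.exists_isStandard (hD : IsCyclic D) :
    ∃ e : Equiv.Perm Pos, IsStandard (SD.pull e D) := by
  obtain h | h := hD.full
  · exact h.exists_isStandard hD
  · obtain ⟨e, he⟩ := h.reflect.exists_isStandard hD.reflect
    exact ⟨e.trans SD.reflect, he⟩

end Cyclic

section Codes

/-- The linear combination of binary words given by their masks. -/
def comb (n : ℕ) {m : ℕ} (a : Fin m → ℕ) : (Fin m → ZMod 2) →ₗ[ZMod 2] (Fin n → ZMod 2) :=
  Fintype.linearCombination (ZMod 2) fun k => vec n (a k)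

theorem comb_apply (n : ℕ) {m : ℕ} (a : Fin m → ℕ) (c : Fin m → ZMod 2) :
    comb n a c = ∑ k, c k • vec n (a k) := rfl

theorem comb_single (n : ℕ) {m : ℕ} (a : Fin m → ℕ) (k : Fin m) :
    comb n a (Pi.single k 1) = vec n (a k) := by
  rw [comb, Fintype.linearCombination_apply_single, one_smul]

/-- The words of the code with zero tail, as masks. -/
def blockGens : Fin 9 → ℕ :=
  ![1733865, 1915508, 957754, 2967, 9675, 13029, 379776, 1238400, 1667712]

/-- The all-one words of the three blocks, as masks. -/
def onesGens : Fin 3 → ℕ := ![127, 16256, 2080768]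

/-- The words of the tail code, as masks. -/
def tailGen (i : ℕ) (k : Fin 10) : ℕ := (tailGens i).getD k 0

/-- The tails that belong to the all-one words of the blocks, as masks. -/
def glueGens : ℕ → Fin 3 → ℕ
  | 0 => ![4194304, 4978, 5036]
  | 1 => ![3872, 223, 7309]
  | _ => ![4194307, 7248, 33195]

/-- The coefficients of a codeword. -/
abbrev Coeff := (Fin 3 → ZMod 2) × (Fin 9 → ZMod 2) × (Fin 10 → ZMod 2)

/-- The codewords of the `i`-th standard code. -/
def codeword (i : ℕ) : Coeff →ₗ[ZMod 2] (Fin 21 ⊕ Fin 23 → ZMod 2) where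
  toFun c := Sum.elim (comb 21 onesGens c.1 + comb 21 blockGens c.2.1)
    (comb 23 (glueGens i) c.1 + comb 23 (tailGen i) c.2.2)
  map_add' c d := by
    ext (p | t)
    · simp only [Sum.elim_inl, Pi.add_apply, Prod.fst_add, Prod.snd_add, map_add]
      ring
    · simp only [Sum.elim_inr, Pi.add_apply, Prod.fst_add, Prod.snd_add, map_add]
      ring
  map_smul' a c := by
    ext (p | t)
    · simp [mul_add]
    · simp [mul_add]

/-- The sum of `2 ^ (23 * weight)` over a coset of a code. -/
def coset : List ℕ → ℕ → ℕ
  | [], acc => 2 ^ (23 * pop acc)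
  | g :: gs, acc => coset gs acc + coset gs (acc ^^^ g)

theorem sum_fin_cons {m : ℕ} (f : (Fin (m + 1) → ZMod 2) → ℕ) :
    ∑ c, f c = ∑ c, f (Fin.cons 0 c) + ∑ c, f (Fin.cons 1 c) := by
  rw [← (Fin.consEquiv fun _ : Fin (m + 1) => ZMod 2).sum_comp, Fintype.sum_prod_type]
  exact Fin.sum_univ_two fun a : Fin 2 => ∑ c, f (Fin.cons (a : ZMod 2) c)

theorem comb_cons (n : ℕ) {m : ℕ} (a : Fin (m + 1) → ℕ) (x : ZMod 2) (c : Fin m → ZMod 2) :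
    comb n a (Fin.cons x c) = x • vec n (a 0) + comb n (fun k => a k.succ) c := by
  rw [comb_apply, Fin.sum_univ_succ, Fin.cons_zero]
  simp only [Fin.cons_succ]
  rfl

theorem coset_eq {n : ℕ} (hn : n ≤ 24) : ∀ {m : ℕ} (a : Fin m → ℕ) (acc : ℕ),
    (∀ k, a k < 2 ^ n) → acc < 2 ^ n →
    coset (List.ofFn a) acc = ∑ c, 2 ^ (23 * wt (vec n acc + comb n a c))
  | 0, a, acc, _, h => by
    simp [coset, comb_apply, wt_vec hn h]
  | m + 1, a, acc, ha, h => by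
    rw [sum_fin_cons, List.ofFn_succ, coset, coset_eq hn _ _ (fun k => ha _) h,
      coset_eq hn _ _ (fun k => ha _) (Nat.xor_lt_two_pow h (ha 0))]
    simp only [comb_cons, zero_smul, zero_add, one_smul, vec_xor, add_assoc]

/-- The sum of `2 ^ (23 * weight)` over the sum of a product code and a code given by pairs of
masks. -/
def gluedCoset (bs ts : List ℕ) : List (ℕ × ℕ) → ℕ → ℕ → ℕ
  | [], a, b => coset bs a * coset ts b
  | g :: gs, a, b => gluedCoset bs ts gs a b + gluedCoset bs ts gs (a ^^^ g.1) (b ^^^ g.2)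

theorem gluedCoset_eq {n n' m m' : ℕ} (hn : n ≤ 24) (hn' : n' ≤ 24) {b : Fin m → ℕ}
    {t : Fin m' → ℕ} (hb : ∀ k, b k < 2 ^ n) (ht : ∀ k, t k < 2 ^ n') :
    ∀ {l : ℕ} (p q : Fin l → ℕ) (x y : ℕ), (∀ k, p k < 2 ^ n) → (∀ k, q k < 2 ^ n') →
    x < 2 ^ n → y < 2 ^ n' →
    gluedCoset (List.ofFn b) (List.ofFn t) (List.ofFn fun k => (p k, q k)) x y =
      ∑ z, (∑ c, 2 ^ (23 * wt (vec n x + (comb n p z + comb n b c)))) *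
        ∑ d, 2 ^ (23 * wt (vec n' y + (comb n' q z + comb n' t d)))
  | 0, p, q, x, y, _, _, hx, hy => by
    simp [gluedCoset, coset_eq hn _ _ hb hx, coset_eq hn' _ _ ht hy, comb_apply]
  | l + 1, p, q, x, y, hp, hq, hx, hy => by
    rw [sum_fin_cons, List.ofFn_succ, gluedCoset,
      gluedCoset_eq hn hn' hb ht _ _ _ _ (fun k => hp _) (fun k => hq _) hx hy,
      gluedCoset_eq hn hn' hb ht _ _ _ _ (fun k => hp _) (fun k => hq _)
        (Nat.xor_lt_two_pow hx (hp 0)) (Nat.xor_lt_two_pow hy (hq 0))]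
    simp only [comb_cons, zero_smul, zero_add, one_smul, vec_xor, add_assoc]

/-- The sum of `2 ^ (23 * weight)` over the `i`-th standard code. -/
def total (i : ℕ) : ℕ :=
  gluedCoset (List.ofFn blockGens) (List.ofFn (tailGen i))
    (List.ofFn fun k => (onesGens k, glueGens i k)) 0 0

theorem total_mod : ∀ i < 3, total i % 2 ^ (23 * 8) = 1 := by decide +kernel

theorem total_ne : ∀ i < 3, ∀ j < 3, i ≠ j → total i ≠ total j := by decide +kernel

theorem blockGens_lt : ∀ k, blockGens k < 2 ^ 21 := by decide

theorem onesGens_lt : ∀ k, onesGens k < 2 ^ 21 := by decide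

theorem tailGen_lt : ∀ i < 3, ∀ k, tailGen i k < 2 ^ 23 := by decide +kernel

theorem glueGens_lt : ∀ i < 3, ∀ k, glueGens i k < 2 ^ 23 := by decide +kernel

theorem total_eq {i : ℕ} (hi : i < 3) : total i = ∑ c, 2 ^ (23 * wt (codeword i c)) := by
  rw [total, gluedCoset_eq (n := 21) (n' := 23) (by norm_num) (by norm_num) blockGens_lt
    (tailGen_lt i hi) _ _ _ _ onesGens_lt (glueGens_lt i hi) (by norm_num) (by norm_num),
    Fintype.sum_prod_type]
  refine Finset.sum_congr rfl fun z _ => ?_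
  rw [Fintype.sum_prod_type, Finset.sum_mul_sum]
  refine Finset.sum_congr rfl fun b _ => Finset.sum_congr rfl fun t _ => ?_
  rw [vec_zero, vec_zero, zero_add, zero_add, ← pow_add, ← mul_add, ← wt_elim]
  rfl

theorem le_of_sum_mod {κ : Type*} [Fintype κ] [DecidableEq κ] {w : κ → ℕ} {q : ℕ}
    (hcard : Fintype.card κ < 2 ^ q) (hmod : (∑ d, 2 ^ (q * w d)) % 2 ^ (q * 8) = 1) {z c : κ}
    (hz : w z = 0) (hc : c ≠ z) : 8 ≤ w c := by
  by_contra! hlt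
  rw [← Finset.sum_filter_add_sum_filter_not Finset.univ fun d => w d < 8] at hmod
  have hdvd : 2 ^ (q * 8) ∣ ∑ d with ¬ w d < 8, 2 ^ (q * w d) :=
    Finset.dvd_sum fun d hd => pow_dvd_pow 2
      (Nat.mul_le_mul_left q (not_lt.mp (Finset.mem_filter.mp hd).2))
  rw [Nat.add_mod, Nat.mod_eq_zero_of_dvd hdvd, add_zero, Nat.mod_mod] at hmod
  rw [Nat.mod_eq_of_lt] at hmod
  · have h1 : ∑ d ∈ {z, c}, 2 ^ (q * w d) ≤ ∑ d with w d < 8, 2 ^ (q * w d) := by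
      refine Finset.sum_le_sum_of_subset fun d hd => ?_
      rw [Finset.mem_insert, Finset.mem_singleton] at hd
      obtain rfl | rfl := hd
      · exact Finset.mem_filter.mpr ⟨Finset.mem_univ _, by rw [hz]; norm_num⟩
      · exact Finset.mem_filter.mpr ⟨Finset.mem_univ _, hlt⟩
    rw [Finset.sum_pair hc.symm, hmod] at h1
    have h2 := Nat.one_le_two_pow (n := q * w z)
    have h3 := Nat.one_le_two_pow (n := q * w c)
    omega
  · calc ∑ d with w d < 8, 2 ^ (q * w d)
        ≤ ∑ d with w d < 8, 2 ^ (q * 7) :=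
          Finset.sum_le_sum fun d hd => Nat.pow_le_pow_right two_pos <| Nat.mul_le_mul_left q <|
            Nat.le_of_lt_succ (Finset.mem_filter.mp hd).2
      _ ≤ ∑ _d : κ, 2 ^ (q * 7) := Finset.sum_le_sum_of_subset (Finset.filter_subset _ _)
      _ < 2 ^ (q * 8) := by
          rw [Finset.sum_const, Finset.card_univ, smul_eq_mul, show q * 8 = q + q * 7 by ring,
            pow_add]
          exact Nat.mul_lt_mul_of_pos_right hcard (by positivity)

theorem le_wt_codeword {i : ℕ} (hi : i < 3) {c : Coeff} (hc : c ≠ 0) : 8 ≤ wt (codeword i c) := by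
  refine le_of_sum_mod (q := 23) (z := 0) (w := fun c => wt (codeword i c)) ?_ ?_ ?_ hc
  · simp only [Fintype.card_prod, Fintype.card_fun, ZMod.card, Fintype.card_fin]
    norm_num
  · rw [← total_eq hi]
    exact total_mod i hi
  · rw [map_zero, wt_eq_zero]

theorem codeword_injective {i : ℕ} (hi : i < 3) : Function.Injective (codeword i) := by
  rw [injective_iff_map_eq_zero]
  intro c hc
  by_contra h
  have := le_wt_codeword hi h
  rw [hc, wt_eq_zero.mpr rfl] at this
  omega

/-- The `i`-th standard code. -/
def std (i : ℕ) : Submodule (ZMod 2) (Fin 21 ⊕ Fin 23 → ZMod 2) := LinearMap.range (codeword i)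

theorem finrank_std {i : ℕ} (hi : i < 3) : Module.finrank (ZMod 2) (std i) = 22 := by
  rw [std, LinearMap.finrank_range_of_inj (codeword_injective hi)]
  simp

theorem std_min {i : ℕ} (hi : i < 3) : ∀ v ∈ std i, v ≠ 0 → 8 ≤ wt v := by
  rintro _ ⟨c, rfl⟩ h
  exact le_wt_codeword hi fun hc => h (by rw [hc, map_zero])

theorem std_le {i : ℕ} {W : Submodule (ZMod 2) (Fin 21 ⊕ Fin 23 → ZMod 2)}
    (hones : ∀ k, Sum.elim (vec 21 (onesGens k)) (vec 23 (glueGens i k)) ∈ W)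
    (hblock : ∀ k, Sum.elim (vec 21 (blockGens k)) (0 : Fin 23 → ZMod 2) ∈ W)
    (htail : ∀ k, Sum.elim (0 : Fin 21 → ZMod 2) (vec 23 (tailGen i k)) ∈ W) : std i ≤ W := by
  rintro _ ⟨c, rfl⟩
  have : codeword i c = ∑ k, c.1 k • Sum.elim (vec 21 (onesGens k)) (vec 23 (glueGens i k)) +
      ∑ k, c.2.1 k • Sum.elim (vec 21 (blockGens k)) (0 : Fin 23 → ZMod 2) +
      ∑ k, c.2.2 k • Sum.elim (0 : Fin 21 → ZMod 2) (vec 23 (tailGen i k)) := by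
    ext (p | t) <;> simp [codeword, comb_apply, Finset.sum_apply]
  rw [this]
  exact add_mem (add_mem (Submodule.sum_mem _ fun k _ => Submodule.smul_mem _ _ (hones k))
    (Submodule.sum_mem _ fun k _ => Submodule.smul_mem _ _ (hblock k)))
    (Submodule.sum_mem _ fun k _ => Submodule.smul_mem _ _ (htail k))

theorem ones_mem_std (i : ℕ) (k : Fin 3) :
    Sum.elim (vec 21 (onesGens k)) (vec 23 (glueGens i k)) ∈ std i :=
  ⟨(Pi.single k 1, 0, 0), by simp [codeword, comb_single]⟩

theorem block_mem_std (i : ℕ) (k : Fin 9) :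
    Sum.elim (vec 21 (blockGens k)) (0 : Fin 23 → ZMod 2) ∈ std i :=
  ⟨(0, Pi.single k 1, 0), by simp [codeword, comb_single]⟩

theorem tail_mem_std (i : ℕ) (k : Fin 10) :
    Sum.elim (0 : Fin 21 → ZMod 2) (vec 23 (tailGen i k)) ∈ std i :=
  ⟨(0, 0, Pi.single k 1), by simp [codeword, comb_single]⟩

theorem le_dual {α : Type*} [Fintype α] {W U : Submodule (ZMod 2) (α → ZMod 2)} :
    W ≤ dual U ↔ U ≤ dual W :=
  ⟨fun h u hu => mem_dual.mpr fun w hw => by rw [dotProduct_comm]; exact mem_dual.mp (h hw) u hu,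
    fun h u hu => mem_dual.mpr fun w hw => by rw [dotProduct_comm]; exact mem_dual.mp (h hw) u hu⟩

/-- A vector orthogonal to the generators of a standard code is in the dual code. -/
theorem mem_dual_std {i : ℕ} {a : Fin 21 → ZMod 2} {b : Fin 23 → ZMod 2}
    (hones : ∀ k, a ⬝ᵥ vec 21 (onesGens k) + b ⬝ᵥ vec 23 (glueGens i k) = 0)
    (hblock : ∀ k, a ⬝ᵥ vec 21 (blockGens k) = 0)
    (htail : ∀ k, b ⬝ᵥ vec 23 (tailGen i k) = 0) : Sum.elim a b ∈ dual (std i) := by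
  rw [← Submodule.span_singleton_le_iff_mem, le_dual]
  refine std_le (fun k => ?_) (fun k => ?_) (fun k => ?_) <;>
    rw [mem_dual] <;> intro p hp <;> obtain ⟨r, rfl⟩ := Submodule.mem_span_singleton.mp hp <;>
    rw [dotProduct_smul, dotProduct_comm, dot_elim]
  · rw [hones, smul_zero]
  · rw [hblock, dotProduct_zero, add_zero, smul_zero]
  · rw [htail, dotProduct_zero, add_zero, smul_zero]

theorem gens_orth : ∀ i < 3,
    ((∀ k l, (pop (onesGens k &&& onesGens l) + pop (glueGens i k &&& glueGens i l)) % 2 = 0) ∧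
      (∀ k l, pop (glueGens i k &&& tailGen i l) % 2 = 0) ∧
      ∀ k l, pop (tailGen i k &&& tailGen i l) % 2 = 0) ∧
    (∀ k l, pop (blockGens k &&& onesGens l) % 2 = 0) ∧
    (∀ k l, pop (onesGens k &&& blockGens l) % 2 = 0) ∧
    (∀ k l, pop (tailGen i k &&& glueGens i l) % 2 = 0) ∧
    ∀ k l, pop (blockGens k &&& blockGens l) % 2 = 0 := by
  decide +kernel

theorem cast_eq_zero_of_mod {n : ℕ} (h : n % 2 = 0) : (n : ZMod 2) = 0 :=
  (ZMod.natCast_eq_zero_iff _ 2).mpr (Nat.dvd_of_mod_eq_zero h)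

theorem dual_std {i : ℕ} (hi : i < 3) : dual (std i) = std i := by
  obtain ⟨⟨h1, h2, h3⟩, h4, h5, h6, h7⟩ := gens_orth i hi
  refine (Submodule.eq_of_le_of_finrank_eq (std_le (fun k => ?_) (fun k => ?_) fun k => ?_) ?_).symm
  · refine mem_dual_std (fun l => ?_) (fun l => ?_) fun l => ?_
    · rw [dot_vec (by norm_num) (onesGens_lt k), dot_vec (by norm_num) (glueGens_lt i hi k),
        ← Nat.cast_add, cast_eq_zero_of_mod (h1 k l)]
    · rw [dot_vec (by norm_num) (onesGens_lt k), cast_eq_zero_of_mod (h5 k l)]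
    · rw [dot_vec (by norm_num) (glueGens_lt i hi k), cast_eq_zero_of_mod (h2 k l)]
  · refine mem_dual_std (fun l => ?_) (fun l => ?_) fun l => ?_
    · rw [dot_vec (by norm_num) (blockGens_lt k), cast_eq_zero_of_mod (h4 k l), zero_dotProduct,
        zero_add]
    · rw [dot_vec (by norm_num) (blockGens_lt k), cast_eq_zero_of_mod (h7 k l)]
    · rw [zero_dotProduct]
  · refine mem_dual_std (fun l => ?_) (fun l => ?_) fun l => ?_
    · rw [dot_vec (by norm_num) (tailGen_lt i hi k), cast_eq_zero_of_mod (h6 k l), zero_dotProduct,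
        zero_add]
    · rw [zero_dotProduct]
    · rw [dot_vec (by norm_num) (tailGen_lt i hi k), cast_eq_zero_of_mod (h3 k l)]
  · have := finrank_add_finrank_dual (std i)
    rw [finrank_std hi, Fintype.card_sum, Fintype.card_fin, Fintype.card_fin] at this
    rw [finrank_std hi]
    omega

theorem pop_onesGens : ∀ l k,
    (pop (onesGens l &&& onesGens k) : ZMod 2) = if l = k then 1 else 0 := by decide +kernel

/-- A word of a standard code with zero blocks lies in every code that contains the tail. -/
theorem mem_of_elim_zero_mem_std {i : ℕ} (hi : i < 3) {y : Fin 23 → ZMod 2}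
    (hy : Sum.elim (0 : Fin 21 → ZMod 2) y ∈ std i) {F : Submodule (ZMod 2) (Fin 23 → ZMod 2)}
    (hF : ∀ k, vec 23 (tailGen i k) ∈ F) : y ∈ F := by
  obtain ⟨⟨z, b, t⟩, h⟩ := hy
  have h1 : comb 21 onesGens z + comb 21 blockGens b = 0 := funext fun p => congrFun h (.inl p)
  have h2 : comb 23 (glueGens i) z + comb 23 (tailGen i) t = y :=
    funext fun p => congrFun h (.inr p)
  have hz : z = 0 := by
    funext k
    have h3 := congrArg (· ⬝ᵥ vec 21 (onesGens k)) h1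
    simp only [zero_dotProduct, comb_apply, add_dotProduct, sum_dotProduct, smul_dotProduct] at h3
    have h4 : ∀ l, vec 21 (onesGens l) ⬝ᵥ vec 21 (onesGens k) = if l = k then 1 else 0 :=
      fun l => by
      rw [dot_vec (by norm_num) (onesGens_lt l), pop_onesGens]
    have h5 : ∀ l, vec 21 (blockGens l) ⬝ᵥ vec 21 (onesGens k) = 0 := fun l => by
      rw [dot_vec (by norm_num) (blockGens_lt l), cast_eq_zero_of_mod ((gens_orth i hi).2.1 l k)]
    simpa [h4, h5] using h3
  subst hz
  rw [map_zero, zero_add] at h1 h2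
  rw [← h2, comb_apply]
  exact Submodule.sum_mem _ fun k _ => Submodule.smul_mem _ _ (hF k)

end Codes

section Tails

variable {D : Submodule (ZMod 2) (Pos → ZMod 2)}

theorem smul_word (a : ZMod 2) (x : Fin 3 → ZMod 7 → ZMod 2) (y : Fin 23 → ZMod 2) :
    a • word x y = word (a • x) (a • y) := by
  ext (p | t) <;> rfl

theorem sum_zero_dot (x : Fin 3 → ZMod 7 → ZMod 2) :
    ∑ j, (0 : Fin 3 → ZMod 7 → ZMod 2) j ⬝ᵥ x j = 0 :=
  Finset.sum_eq_zero fun _ _ => zero_dotProduct _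

theorem sum_dot_zero (x : Fin 3 → ZMod 7 → ZMod 2) :
    ∑ j, x j ⬝ᵥ (0 : Fin 3 → ZMod 7 → ZMod 2) j = 0 :=
  Finset.sum_eq_zero fun _ _ => dotProduct_zero _

/-- The tails of the words of `D` with zero blocks. -/
def tailCode (D : Submodule (ZMod 2) (Pos → ZMod 2)) : Submodule (ZMod 2) (Fin 23 → ZMod 2) where
  carrier := {y | word 0 y ∈ D}
  add_mem' {y y'} h h' := by
    have := D.add_mem h h'
    rwa [word_add, add_zero] at this
  zero_mem' := by
    change word 0 0 ∈ D
    rw [word_eq_zero.mpr ⟨rfl, rfl⟩]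
    exact zero_mem D
  smul_mem' a y h := by
    have := D.smul_mem a h
    rwa [smul_word, smul_zero] at this

theorem mem_tailCode {y : Fin 23 → ZMod 2} : y ∈ tailCode D ↔ word 0 y ∈ D := Iff.rfl

/-- The tails of all words of `D`. -/
def allTails (D : Submodule (ZMod 2) (Pos → ZMod 2)) : Submodule (ZMod 2) (Fin 23 → ZMod 2) where
  carrier := {y | ∃ x, word x y ∈ D}
  add_mem' := by
    rintro y y' ⟨x, h⟩ ⟨x', h'⟩
    exact ⟨x + x', word_add x x' y y' ▸ D.add_mem h h'⟩
  zero_mem' := ⟨0, by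
    rw [word_eq_zero.mpr ⟨rfl, rfl⟩]
    exact zero_mem D⟩
  smul_mem' := by
    rintro a y ⟨x, h⟩
    exact ⟨a • x, smul_word a x y ▸ D.smul_mem a h⟩

/-- The vectors of block values of the words of `D` with constant blocks. -/
def constCode (D : Submodule (ZMod 2) (Pos → ZMod 2)) : Submodule (ZMod 2) (Fin 3 → ZMod 2) where
  carrier := {z | ∃ y, word (fun j _ => z j) y ∈ D}
  add_mem' := by
    rintro z z' ⟨y, h⟩ ⟨y', h'⟩
    have := D.add_mem h h'
    rw [word_add] at this
    exact ⟨y + y', this⟩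
  zero_mem' := ⟨0, by
    change word 0 0 ∈ D
    rw [word_eq_zero.mpr ⟨rfl, rfl⟩]
    exact zero_mem D⟩
  smul_mem' := by
    rintro a z ⟨y, h⟩
    have := D.smul_mem a h
    rw [smul_word] at this
    exact ⟨a • y, this⟩

theorem IsCyclic.parity_mem (hD : IsCyclic D) {x : Fin 3 → ZMod 7 → ZMod 2} {y : Fin 23 → ZMod 2}
    (h : word x y ∈ D) : word (fun j _ => ∑ i, x j i) y ∈ D := by
  have := add_mem (add_mem h (hD.eps₁_mem h)) (hD.eps₂_mem h)
  rw [word_add, word_add, add_zero, add_zero] at this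
  convert this using 2
  funext j
  exact (sum_sh (x j)).symm

theorem eq_zero_or_odd_or_pair : ∀ z : Fin 3 → ZMod 2, z = 0 ∨ ∑ j, 7 * (z j * z j) ≠ 0 ∨
    ∃ j k, j ≠ k ∧ (fun j' _ => z j') + (Pi.single j (sh 0 gen₂) + Pi.single k (sh 0 gen₂)) =
      (Pi.single j (1 + gen₂) + Pi.single k (1 + gen₂) : Fin 3 → ZMod 7 → ZMod 2) := by
  decide +kernel

theorem wt_pair : ∀ j k : Fin 3, j ≠ k →
    ∑ l, wt ((Pi.single j (1 + gen₂) + Pi.single k (1 + gen₂) : Fin 3 → ZMod 7 → ZMod 2) l) =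
      6 := by
  decide +kernel

theorem IsStandard.exists_ones (hD : IsStandard D) (j : Fin 3) :
    ∃ a, word (Pi.single j 1) a ∈ D := by
  have hmem : Pi.single j 1 ∈ constCode D := mem_of_forall_dual fun z hz => by
    suffices z = 0 by rw [this, zero_dotProduct]
    have hzD : word (fun j _ => z j) 0 ∈ D := hD.mem fun w hw => by
      obtain ⟨x, y, rfl⟩ := exists_word w
      rw [dot_word, zero_dotProduct, add_zero, ← hz _ ⟨y, hD.parity_mem hw⟩]
      exact Finset.sum_congr rfl fun j _ => (Finset.mul_sum _ _ _).symm
    obtain h | h | ⟨j, k, hjk, h⟩ := eq_zero_or_odd_or_pair z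
    · exact h
    · have := hD.orth hzD hzD
      rw [dot_word, zero_dotProduct, add_zero] at this
      refine absurd ?_ h
      rw [← this]
      refine Finset.sum_congr rfl fun j _ => ?_
      rw [dotProduct, Finset.sum_const, Finset.card_univ, ZMod.card, nsmul_eq_mul]
      rfl
    · have h1 := add_mem hzD (hD.pair j k 0 hjk)
      rw [word_add, h, add_zero] at h1
      have h2 := wt_word (Pi.single j (1 + gen₂) + Pi.single k (1 + gen₂)) 0
      rw [wt_pair j k hjk, wt_eq_zero.mpr rfl] at h2
      have h3 := hD.min _ h1 fun h => by rw [wt_eq_zero.mpr h] at h2; omega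
      omega
  obtain ⟨a, ha⟩ := hmem
  refine ⟨a, ?_⟩
  convert ha using 2
  funext k
  by_cases hk : k = j
  · rw [hk, Pi.single_eq_same, Pi.single_eq_same]; rfl
  · rw [Pi.single_eq_of_ne hk, Pi.single_eq_of_ne hk]; rfl

theorem IsCyclic.le_finrank_tailCode (hD : IsCyclic D)
    (h : ∀ j, ∃ a, word (Pi.single j 1) a ∈ D) : 10 ≤ Module.finrank (ZMod 2) (tailCode D) := by
  choose a ha using h
  have h1 : dual (allTails D) ≤ tailCode D := fun y hy => hD.mem fun w hw => by
    obtain ⟨x, y', rfl⟩ := exists_word w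
    rw [dot_word, mem_dual.mp hy y' ⟨x, hw⟩, add_zero]
    exact sum_zero_dot x
  have h2 : allTails D ≤ tailCode D ⊔ Submodule.span (ZMod 2) (Set.range a) := by
    rintro y ⟨x, hy⟩
    have h3 := add_mem (hD.parity_mem hy) (D.sum_mem (t := Finset.univ) fun j _ =>
      D.smul_mem (∑ i, x j i) (ha j))
    have h4 : word (fun j _ => ∑ i, x j i) y + ∑ j, (∑ i, x j i) • word (Pi.single j 1) (a j) =
        word 0 (y + ∑ j, (∑ i, x j i) • a j) := by
      ext (⟨l, p⟩ | t)
      · simp only [word, Pi.add_apply, Sum.elim_inl, Finset.sum_apply, Pi.smul_apply, smul_eq_mul,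
          Pi.zero_apply]
        rw [Finset.sum_eq_single l (fun j _ hj => by rw [Pi.single_eq_of_ne hj.symm]; simp)
          (fun h => absurd (Finset.mem_univ l) h), Pi.single_eq_same, Pi.one_apply, mul_one,
          CharTwo.add_self_eq_zero]
      · simp [word]
    rw [h4] at h3
    have h5 : y = (y + ∑ j, (∑ i, x j i) • a j) + ∑ j, (∑ i, x j i) • a j := by
      rw [add_assoc, add_self_eq_zero, add_zero]
    rw [h5]
    exact add_mem (Submodule.mem_sup_left h3) (Submodule.mem_sup_right
      (Submodule.sum_mem _ fun j _ => Submodule.smul_mem _ _ (Submodule.subset_span ⟨j, rfl⟩)))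
  have h6 := Submodule.finrank_mono h1
  have h7 := (Submodule.finrank_mono h2).trans (Submodule.finrank_add_le_finrank_add_finrank _ _)
  have h8 := finrank_range_le_card (R := ZMod 2) a
  have h9 := finrank_add_finrank_dual (allTails D)
  rw [Fintype.card_fin] at h8 h9
  rw [Set.finrank] at h8
  omega

theorem IsStandard.hasTail (hD : IsStandard D) : HasTail (tailCode D) := by
  refine hasTail_of_finrank (fun v hv w hw => ?_) (fun v hv h0 => ?_)
    (hD.le_finrank_tailCode hD.exists_ones)
  · have := hD.orth (mem_tailCode.mp hv) (mem_tailCode.mp hw)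
    rwa [dot_word, sum_zero_dot, zero_add] at this
  · have := hD.min _ (mem_tailCode.mp hv) fun h => h0 (word_eq_zero.mp h).2
    rwa [wt_word, Finset.sum_eq_zero fun j _ => wt_eq_zero.mpr (Pi.zero_apply j), zero_add] at this

/-- Permutation of the blocks and of the tail. -/
def arrange (π : Equiv.Perm (Fin 3)) (σ : Equiv.Perm (Fin 23)) : Equiv.Perm Pos :=
  (π.prodCongr (Equiv.refl _)).sumCongr σ

theorem word_arrange (π : Equiv.Perm (Fin 3)) (σ : Equiv.Perm (Fin 23))
    (x : Fin 3 → ZMod 7 → ZMod 2) (y : Fin 23 → ZMod 2) :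
    word x y ∘ (arrange π σ).symm = word (x ∘ π.symm) (y ∘ σ.symm) := by
  ext (p | t) <;> rfl

theorem single_comp (π : Equiv.Perm (Fin 3)) (j : Fin 3) (f : ZMod 7 → ZMod 2) :
    (Pi.single j f : Fin 3 → ZMod 7 → ZMod 2) ∘ π.symm = Pi.single (π j) f := by
  funext k
  by_cases hk : k = π j
  · simp [hk]
  · rw [Pi.single_eq_of_ne hk, Function.comp_apply, Pi.single_eq_of_ne]
    rwa [Ne, Equiv.symm_apply_eq]

theorem IsStandard.arrange (hD : IsStandard D) (π : Equiv.Perm (Fin 3)) (σ : Equiv.Perm (Fin 23)) :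
    IsStandard (pull (arrange π σ) D) where
  toIsCyclic := hD.toIsCyclic.pull fun x y h => by
    rw [mem_pull, word_arrange] at h ⊢
    exact hD.shift _ _ h
  diag s := by
    rw [mem_pull, word_arrange]
    exact hD.diag s
  pair j k s hjk := by
    rw [mem_pull, word_arrange, Pi.add_comp, single_comp, single_comp]
    exact hD.pair _ _ s (π.injective.ne hjk)

theorem exists_perm_of_orthogonal : ∀ β : Fin 3 → Fin 3 → ZMod 2,
    (∀ j k, (if j = k then 1 else 0) + ∑ l, β j l * β k l = 0) →
    ∃ π : Equiv.Perm (Fin 3), ∀ k, β (π k) = Pi.single k 1 := by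
  decide +kernel

theorem pop_glueGens : ∀ i < 3, ∀ l k,
    (pop (glueGens i l &&& glueGens i k) : ZMod 2) = if l = k then 1 else 0 := by decide +kernel

theorem dot_ones : ∀ j k : Fin 3,
    ∑ l, (Pi.single j 1 : Fin 3 → ZMod 7 → ZMod 2) l ⬝ᵥ
      (Pi.single k 1 : Fin 3 → ZMod 7 → ZMod 2) l = if j = k then 1 else 0 := by
  decide +kernel

theorem dot_comb {n m : ℕ} {a : Fin m → ℕ} (h : ∀ l k, vec n (a l) ⬝ᵥ vec n (a k) =
    if l = k then 1 else 0) (z z' : Fin m → ZMod 2) :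
    comb n a z ⬝ᵥ comb n a z' = ∑ l, z l * z' l := by
  simp only [comb_apply, sum_dotProduct, dotProduct_sum, smul_dotProduct, dotProduct_smul, h,
    smul_eq_mul]
  simp [mul_comm]

theorem dot_glueGens {i : ℕ} (hi : i < 3) (l k : Fin 3) :
    vec 23 (glueGens i l) ⬝ᵥ vec 23 (glueGens i k) = if l = k then 1 else 0 := by
  rw [dot_vec (by norm_num) (glueGens_lt i hi _), pop_glueGens i hi]

theorem elim_mem_std {i : ℕ} (hi : i < 3) {a : Fin 23 → ZMod 2}
    (ha : ∀ k, a ⬝ᵥ vec 23 (tailGen i k) = 0) :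
    Sum.elim (comb 21 onesGens fun l => a ⬝ᵥ vec 23 (glueGens i l)) a ∈ std i := by
  rw [← dual_std hi]
  refine mem_dual_std (fun k => ?_) (fun k => ?_) ha
  · rw [comb_apply, sum_dotProduct]
    simp only [smul_dotProduct, dot_vec (n := 21) (by norm_num) (onesGens_lt _), pop_onesGens]
    simp [CharTwo.add_self_eq_zero]
  · rw [comb_apply, sum_dotProduct]
    simp only [smul_dotProduct, dot_vec (n := 21) (by norm_num) (onesGens_lt _)]
    exact Finset.sum_eq_zero fun l _ => by
      rw [cast_eq_zero_of_mod ((gens_orth i hi).2.2.1 l k), smul_zero]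

theorem add_comb_mem {i : ℕ} (hi : i < 3) {a : Fin 23 → ZMod 2}
    (ha : ∀ k, a ⬝ᵥ vec 23 (tailGen i k) = 0) {F : Submodule (ZMod 2) (Fin 23 → ZMod 2)}
    (hF : ∀ k, vec 23 (tailGen i k) ∈ F) :
    a + comb 23 (glueGens i) (fun l => a ⬝ᵥ vec 23 (glueGens i l)) ∈ F := by
  refine mem_of_elim_zero_mem_std hi ?_ hF
  have h1 := elim_mem_std hi ha
  generalize (fun l => a ⬝ᵥ vec 23 (glueGens i l)) = β at h1 ⊢
  have h2 : codeword i (β, 0, 0) ∈ std i := ⟨_, rfl⟩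
  convert add_mem h1 h2 using 1
  ext (p | t) <;> simp [codeword, CharTwo.add_self_eq_zero]

theorem IsStandard.exists_glue (hD : IsStandard D) {i : ℕ} (hi : i < 3)
    (hF : ∀ k, vec 23 (tailGen i k) ∈ tailCode D) : ∃ π : Equiv.Perm (Fin 3),
    ∀ k, word (Pi.single (π k) 1) (vec 23 (glueGens i k)) ∈ D := by
  have hmem : ∀ j, ∃ β, word (Pi.single j 1) (comb 23 (glueGens i) β) ∈ D := fun j => by
    obtain ⟨a, ha⟩ := hD.exists_ones j
    have h1 := add_comb_mem hi (fun k => by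
      have := hD.orth ha (hF k)
      rwa [dot_word, sum_dot_zero, zero_add] at this) hF
    have h2 := add_mem ha (mem_tailCode.mp h1)
    rw [word_add, add_zero, ← add_assoc, add_self_eq_zero, zero_add] at h2
    exact ⟨_, h2⟩
  choose β hβ using hmem
  obtain ⟨π, hπ⟩ := exists_perm_of_orthogonal β fun j k => by
    rw [← dot_ones, ← dot_comb (dot_glueGens hi), ← dot_word]
    exact hD.orth (hβ j) (hβ k)
  refine ⟨π, fun k => ?_⟩
  have := hβ (π k)
  rwa [hπ, comb_single] at this

theorem tailGen_mem : ∀ i < 3, ∀ k, tailGen i k ∈ tailGens i := by decide +kernel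

/-- The standard numbering of the positions in the blocks. -/
def blockNumbering : Fin 3 × ZMod 7 ≃ Fin 21 := finProdFinEquiv (m := 3) (n := 7)

/-- The standard numbering of the positions. -/
def numbering : Pos ≃ Fin 21 ⊕ Fin 23 := blockNumbering.sumCongr (Equiv.refl _)

theorem word_numbering (x : Fin 3 → ZMod 7 → ZMod 2) (y : Fin 23 → ZMod 2) :
    word x y ∘ numbering.symm =
      Sum.elim (fun p : Fin 21 => x (blockNumbering.symm p).1 (blockNumbering.symm p).2) y := by
  ext (p | t) <;> rfl

theorem block_eq : ∀ k, (∃ s, ∀ p : Fin 21, vec 21 (blockGens k) p =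
      (fun _ => sh s gen₁ : Fin 3 → ZMod 7 → ZMod 2) (blockNumbering.symm p).1
        (blockNumbering.symm p).2) ∨
    ∃ j j' s, j ≠ j' ∧ ∀ p : Fin 21, vec 21 (blockGens k) p =
      (Pi.single j (sh s gen₂) + Pi.single j' (sh s gen₂) : Fin 3 → ZMod 7 → ZMod 2)
        (blockNumbering.symm p).1 (blockNumbering.symm p).2 := by
  decide +kernel

theorem ones_eq : ∀ k, ∀ p : Fin 21, vec 21 (onesGens k) p =
      (Pi.single k 1 : Fin 3 → ZMod 7 → ZMod 2) (blockNumbering.symm p).1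
        (blockNumbering.symm p).2 := by
  decide +kernel

theorem IsStandard.exists_std (hD : IsStandard D) :
    ∃ i < 3, ∃ e : Fin 21 ⊕ Fin 23 ≃ Pos, pull e D = std i := by
  obtain ⟨i, hi, σ, h⟩ := hD.hasTail
  have hD₁ := hD.arrange (Equiv.refl _) σ
  have hF : ∀ k, vec 23 (tailGen i k) ∈ tailCode (pull (SD.arrange (Equiv.refl _) σ) D) :=
    fun k => by
      rw [mem_tailCode, mem_pull, word_arrange]
      exact h _ (tailGen_mem i hi k)
  obtain ⟨π, hπ⟩ := hD₁.exists_glue hi hF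
  have hD₂ := hD₁.arrange π (Equiv.refl _)
  set D₂ := pull (SD.arrange π (Equiv.refl _)) (pull (SD.arrange (Equiv.refl _) σ) D) with hD₂'
  have hle : std i ≤ pull numbering.symm D₂ := by
    refine std_le (fun k => ?_) (fun k => ?_) fun k => ?_
    · have h1 : word (Pi.single k 1) (vec 23 (glueGens i k)) ∈ D₂ := by
        rw [hD₂', mem_pull, word_arrange, single_comp]
        exact hπ k
      convert comp_mem_pull.mpr h1 using 1
      rw [word_numbering]
      exact congrArg (Sum.elim · _) (funext (ones_eq k))
    · obtain ⟨s, hs⟩ | ⟨j, j', s, hjj', hs⟩ := block_eq k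
      · convert comp_mem_pull.mpr (hD₂.diag s) using 1
        rw [word_numbering]
        exact congrArg (Sum.elim · _) (funext hs)
      · convert comp_mem_pull.mpr (hD₂.pair j j' s hjj') using 1
        rw [word_numbering]
        exact congrArg (Sum.elim · _) (funext hs)
    · have h1 : word 0 (vec 23 (tailGen i k)) ∈ D₂ := by
        rw [hD₂', mem_pull, word_arrange]
        exact hF k
      convert comp_mem_pull.mpr h1 using 1
      rw [word_numbering]
      rfl
  refine ⟨i, hi, numbering.symm.trans
    ((SD.arrange π (Equiv.refl _)).trans (SD.arrange (Equiv.refl _) σ)), ?_⟩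
  change pull numbering.symm D₂ = std i
  refine le_antisymm ?_ hle
  rw [← dual_std hi, le_dual, dual_pull, hD₂.selfDual]
  exact hle

end Tails

section Conjugation

/-- The rotation of all blocks, on the numbers of the positions. -/
def blockRot : Equiv.Perm (Fin 21) :=
  blockNumbering.permCongr ((Equiv.refl (Fin 3)).prodCongr (Equiv.addRight (1 : ZMod 7)))

/-- The standard permutation with three cycles of length seven. -/
def stdPerm : Equiv.Perm (Fin 44) :=
  (finSumFinEquiv (m := 21) (n := 23)).permCongr (blockRot.sumCongr (Equiv.refl _))

/-- The positions as coordinates. -/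
def place : Pos ≃ Fin 44 := numbering.trans (finSumFinEquiv (m := 21) (n := 23))

theorem stdPerm_place : ∀ p, stdPerm (place p) = place (rot (fun _ => 1) p) := by
  decide +kernel

theorem autOfType_stdPerm : autOfType stdPerm 7 3 23 := by
  have : Fact (Nat.Prime 7) := ⟨by norm_num⟩
  refine ⟨orderOf_eq_prime ?_ ?_, ?_, rfl⟩ <;> decide +kernel

theorem cycleType_of_autOfType {σ : Equiv.Perm (Fin 44)} (h : autOfType σ 7 3 23) :
    σ.cycleType = Multiset.replicate 3 7 := by
  obtain ⟨h1, h2, -⟩ := h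
  obtain ⟨n, hn⟩ := Equiv.Perm.cycleType_prime_order (σ := σ) (h1 ▸ by norm_num)
  have h3 := σ.sum_cycleType
  have h4 : σ.support = Finset.univ.filter fun i => ¬ σ i = i := by
    ext i
    simp
  have h5 := Finset.card_filter_add_card_filter_not (s := Finset.univ) fun i => σ i = i
  rw [hn, h1, Multiset.sum_replicate, smul_eq_mul, h4] at h3
  rw [h2, Finset.card_univ, Fintype.card_fin] at h5
  rw [hn, h1, show n = 2 by omega]

theorem exists_conj {σ : Equiv.Perm (Fin 44)} (h : autOfType σ 7 3 23) :
    ∃ e : Pos ≃ Fin 44, ∀ p, σ (e p) = e (rot (fun _ => 1) p) := by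
  have : IsConj stdPerm σ := Equiv.Perm.isConj_iff_cycleType_eq.mpr <| by
    rw [cycleType_of_autOfType h, cycleType_of_autOfType autOfType_stdPerm]
  obtain ⟨c, rfl⟩ := isConj_iff.mp this
  refine ⟨place.trans c, fun p => ?_⟩
  simp [stdPerm_place]

variable {C : Submodule (ZMod 2) (Fin 44 → ZMod 2)}

theorem exists_isCyclic (hdual : dual C = C) (hmin : ∀ v ∈ C, v ≠ 0 → 8 ≤ wt v)
    {σ : Equiv.Perm (Fin 44)} (hσ : permCode σ C = C) (htype : autOfType σ 7 3 23) :
    ∃ e : Pos ≃ Fin 44, IsCyclic (pull e C) := by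
  obtain ⟨e, he⟩ := exists_conj htype
  refine ⟨e, by rw [dual_pull, hdual], fun v hv h0 => ?_, fun x y h => ?_⟩
  · rw [← wt_comp e.symm]
    refine hmin _ hv fun h' => h0 ?_
    funext i
    simpa using congrFun h' (e i)
  · rw [mem_pull] at h ⊢
    rw [← hσ]
    refine ⟨_, h, ?_⟩
    rw [← word_rot]
    funext i
    obtain ⟨p, rfl⟩ := e.surjective i
    simp [permLM, he]

/-- The `i`-th standard code, on the coordinates of the classification. -/
def code44 (i : ℕ) : Submodule (ZMod 2) (Fin 44 → ZMod 2) :=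
  pull (finSumFinEquiv (m := 21) (n := 23)).symm (std i)

theorem exists_permCode_eq (hdual : dual C = C) (hmin : ∀ v ∈ C, v ≠ 0 → 8 ≤ wt v)
    {σ : Equiv.Perm (Fin 44)} (hσ : permCode σ C = C) (htype : autOfType σ 7 3 23) :
    ∃ i < 3, ∃ τ : Equiv.Perm (Fin 44), permCode τ C = code44 i := by
  obtain ⟨e, he⟩ := exists_isCyclic hdual hmin hσ htype
  obtain ⟨e₁, he₁⟩ := he.exists_isStandard
  obtain ⟨i, hi, e₂, he₂⟩ := he₁.exists_std
  refine ⟨i, hi, (finSumFinEquiv (m := 21) (n := 23)).symm.trans (e₂.trans (e₁.trans e)), ?_⟩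
  rw [permCode_eq_pull, code44, ← he₂]
  rfl

end Conjugation

section Classification

theorem blockRot_ones : ∀ k p, vec 21 (onesGens k) (blockRot p) = vec 21 (onesGens k) p := by
  decide +kernel

theorem blockRot_orth : ∀ k : Fin 9,
    (∀ l, (fun p => vec 21 (blockGens k) (blockRot p)) ⬝ᵥ vec 21 (onesGens l) = 0) ∧
    ∀ l, (fun p => vec 21 (blockGens k) (blockRot p)) ⬝ᵥ vec 21 (blockGens l) = 0 := by
  decide +kernel

theorem std_comp_mem {i : ℕ} (hi : i < 3) {v : Fin 21 ⊕ Fin 23 → ZMod 2} (hv : v ∈ std i) :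
    v ∘ blockRot.sumCongr (Equiv.refl _) ∈ std i := by
  suffices std i ≤ pull (blockRot.sumCongr (Equiv.refl _)).symm (std i) from this hv
  refine std_le (fun k => ?_) (fun k => ?_) fun k => ?_
  · change _ ∈ std i
    convert ones_mem_std i k using 1
    ext (p | t)
    · exact blockRot_ones k p
    · rfl
  · change _ ∈ std i
    rw [← dual_std hi]
    convert mem_dual_std (i := i) (a := fun p => vec 21 (blockGens k) (blockRot p)) (b := 0)
      (fun l => ?_) (blockRot_orth k).2 fun l => ?_ using 1
    · ext (p | t) <;> rfl
    · rw [(blockRot_orth k).1, zero_dotProduct, zero_add]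
    · rw [zero_dotProduct]
  · change _ ∈ std i
    convert tail_mem_std i k using 1
    ext (p | t) <;> rfl

theorem permCode_code44 {i : ℕ} (hi : i < 3) : permCode stdPerm (code44 i) = code44 i := by
  refine Submodule.eq_of_le_of_finrank_eq ?_ ?_
  · rintro _ ⟨v, hv, rfl⟩
    change _ ∈ std i
    convert std_comp_mem hi hv using 1
    funext p
    simp [permLM, stdPerm]
  · rw [permCode_eq_pull, finrank_pull]

theorem minWtEq_code44 {i : ℕ} (hi : i < 3) : minWtEq (code44 i) 8 := by
  refine ⟨fun v hv h0 => ?_, ?_⟩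
  · rw [← wt_comp (finSumFinEquiv (m := 21) (n := 23))]
    refine std_min hi _ hv fun h' => h0 ?_
    funext p
    simpa using congrFun h' (finSumFinEquiv.symm p)
  · have h : wt (Sum.elim (vec 21 (blockGens 3)) (0 : Fin 23 → ZMod 2) ∘
        (finSumFinEquiv (m := 21) (n := 23)).symm) = 8 := by
      rw [wt_comp, wt_elim, wt_vec (by norm_num) (blockGens_lt 3), wt_eq_zero.mpr rfl]
      decide +kernel
    exact ⟨_, comp_mem_pull.mpr (block_mem_std i 3),
      fun h0 => by rw [wt_eq_zero.mpr h0] at h; omega, h⟩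

theorem dual_code44 {i : ℕ} (hi : i < 3) : dual (code44 i) = code44 i := by
  rw [code44, dual_pull, dual_std hi]

variable {α β : Type*} [Fintype α] [Fintype β]

/-- The sum of `2 ^ (23 * weight)` over a code. -/
noncomputable def weightSum (W : Submodule (ZMod 2) (α → ZMod 2)) : ℕ :=
  ∑ᶠ v : W, 2 ^ (23 * wt v.1)

theorem weightSum_pull (e : α ≃ β) (W : Submodule (ZMod 2) (β → ZMod 2)) :
    weightSum (pull e W) = weightSum W :=
  finsum_eq_of_bijective (fun v : pull e W => (⟨v.1 ∘ e.symm, v.2⟩ : W))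
    ⟨fun v w h => Subtype.ext <| by
      funext i
      simpa using congrFun (congrArg Subtype.val h) (e i),
     fun w => ⟨⟨w.1 ∘ e, comp_mem_pull.mpr w.2⟩, Subtype.ext <| by
      funext i
      simp⟩⟩ fun v => by rw [wt_comp]

theorem weightSum_std {i : ℕ} (hi : i < 3) : weightSum (std i) = total i := by
  rw [total_eq hi, ← finsum_eq_sum_of_fintype]
  exact (finsum_eq_of_bijective (LinearEquiv.ofInjective _ (codeword_injective hi))
    (LinearEquiv.bijective _) fun c => rfl).symm

theorem weightSum_code44 {i : ℕ} (hi : i < 3) : weightSum (code44 i) = total i := by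
  rw [code44, weightSum_pull, weightSum_std hi]

end Classification

/-- There are exactly 3 inequivalent binary self-dual [44,22,8] codes having an
automorphism of type 7 3 23 (counted as equivalence classes under coordinate permutation). -/
theorem sd44_aut_type_7_3_23_classification :
    Nat.card (Quot (fun (C₁ C₂ : {Code : Submodule (ZMod 2) (Fin 44 → ZMod 2) //
        isSelfDual Code ∧ Module.finrank (ZMod 2) Code = 22 ∧ minWtEq Code 8 ∧
        ∃ σ : Equiv.Perm (Fin 44), permCode σ Code = Code ∧ autOfType σ 7 3 23}) =>
      codeEquiv C₁.1 C₂.1)) = 3 := by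
  refine (Nat.card_eq_of_bijective (α := Fin 3) (fun i => Quot.mk _ ⟨code44 i,
    isSelfDual_iff_dual.mpr (dual_code44 i.2), by rw [code44, finrank_pull, finrank_std i.2],
    minWtEq_code44 i.2, stdPerm, permCode_code44 i.2, autOfType_stdPerm⟩) ⟨fun i j h => ?_,
      ?_⟩).symm.trans (Nat.card_fin 3)
  · have h1 := congrArg (Quot.lift (fun C => weightSum C.1) fun C₁ C₂ ⟨σ, hσ⟩ => by
      rw [← hσ, permCode_eq_pull, weightSum_pull]) h
    change weightSum (code44 i) = weightSum (code44 j) at h1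
    rw [weightSum_code44 i.2, weightSum_code44 j.2] at h1
    by_contra h2
    exact total_ne i i.2 j j.2 (Fin.val_ne_of_ne h2) h1
  · rintro ⟨C, hdual, -, hmin, σ, hσ, htype⟩
    obtain ⟨i, hi, τ, hτ⟩ := exists_permCode_eq (isSelfDual_iff_dual.mp hdual) hmin.1 hσ htype
    exact ⟨⟨i, hi⟩, (Quot.sound ⟨τ, hτ⟩).symm⟩

end SD
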